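/- Let q ∈ {7, 8, 9, 11, 13, 16, 17, 19} and n ≥ 3. Then (q,n) ∈ B(3,2), except possibly for (q,n) in the set {(7,3),(7,4),(7,5),(7,6),(7,8),(7,12),(8,3),(8,4),(8,7),(9,3),(9,4),(9,5),(9,6),(9,8),(11,3),(11,4),(11,5),(11,6),(13,3),(13,4),(13,6),(16,3),(16,4),(16,5),(17,3),(17,4),(19,3),(19,4),(19,6)}. -/

import Mathlib

open Polynomial

noncomputable section

/-- An element of a finite field is *primitive* if it generates the multiplicative group. -/
def IsPrimitiveElem {L : Type} [Field L] [Fintype L] (α : L) : Prop :=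
  orderOf α = Fintype.card L - 1

/-- `β` is a *normal element* of `L` over `K`, where `n = [L : K]`:
the conjugates `β, β^q, …, β^(q^(n-1))` form a `K`-basis of `L`. -/
def IsNormalElem (K : Type) {L : Type} [Field K] [Fintype K] [Field L] [Algebra K L]
    (n : ℕ) (β : L) : Prop :=
  LinearIndependent K (fun i : Fin n => β ^ Fintype.card K ^ (i : ℕ)) ∧
    Submodule.span K (Set.range fun i : Fin n => β ^ Fintype.card K ^ (i : ℕ)) = ⊤

/-- The set `Υ_Q(m₁, m₂)` of rational functions over the field `F` with `Q` elements. -/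
def Upsilon (F : Type) [Field F] [Fintype F] (m₁ m₂ : ℕ) : Set (RatFunc F) :=
  {f | ∃ f₁ f₂ : F[X], f₂ ≠ 0 ∧
      f = algebraMap F[X] (RatFunc F) f₁ / algebraMap F[X] (RatFunc F) f₂ ∧
      f₁.natDegree ≤ m₁ ∧ f₂.natDegree ≤ m₂ ∧ IsCoprime f₁ f₂ ∧
      ∃ (k : ℕ) (g : F[X]), 0 < k ∧ g.Monic ∧ Irreducible g ∧ g ≠ X ∧
        Nat.gcd k (Fintype.card F - 1) = 1 ∧
        g ^ k ∣ f₁ * f₂ ∧ ¬ g ^ (k + 1) ∣ f₁ * f₂}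

/-- Evaluation of a rational function at a point of the same field (`0` if undefined). -/
def ratEval {F : Type} [Field F] (f : RatFunc F) (α : F) : F :=
  f.eval (RingHom.id F) α

/-- `α` is `s`-free. -/
def IsFree {F : Type} [Field F] (s : ℕ) (α : F) : Prop :=
  α ≠ 0 ∧ ∀ d : ℕ, d ∣ s → d ≠ 1 → ¬ ∃ β : F, β ^ d = α

/-- The `F_q[x]`-module action `h ∘ β = ∑ hᵢ β^(qⁱ)` on `L`. -/
def polyAct {K L : Type} [Field K] [Fintype K] [Field L] [Algebra K L]
    (h : K[X]) (β : L) : L :=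
  h.sum fun i a => algebraMap K L a * β ^ Fintype.card K ^ i

/-- `α` is `g`-free with respect to the `F_q[x]`-module structure of `L`. -/
def IsPolyFree (K : Type) {L : Type} [Field K] [Fintype K] [Field L] [Algebra K L]
    (g : K[X]) (α : L) : Prop :=
  ∀ h : K[X], h.Monic → h ∣ g → (∃ lam : L, α = polyAct h lam) → h = 1

/-- `N_f(e₁, e₂, g)`: the number of `α ∈ L` such that `α` is `e₁`-free,
`f(α)` is `e₂`-free and `α` is `g`-free. -/
def NElems (K : Type) {L : Type} [Field K] [Fintype K] [Field L] [Fintype L] [Algebra K L]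
    (f : RatFunc L) (e₁ e₂ : ℕ) (g : K[X]) : ℕ :=
  Nat.card {α : L | IsFree e₁ α ∧ IsFree e₂ (ratEval f α) ∧ IsPolyFree K g α}

/-- `W(ℓ)`: the number of squarefree divisors of `ℓ`. -/
def Wnat (ℓ : ℕ) : ℕ := (ℓ.divisors.filter Squarefree).card

/-- `W_q(g)`: the number of monic squarefree divisors of `g` in `F_q[x]`. -/
def Wpoly {K : Type} [Field K] (g : K[X]) : ℕ :=
  Nat.card {h : K[X] // h.Monic ∧ Squarefree h ∧ h ∣ g}

/-- `Φ(g) = |(F_q[x]/(g))ˣ|`. -/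
def PhiPoly {K : Type} [Field K] (g : K[X]) : ℕ :=
  Nat.card ((K[X] ⧸ Ideal.span ({g} : Set K[X]))ˣ)

/-- `(q, n) ∈ B(m₁, m₂)`: for every `f ∈ Υ_{qⁿ}(m₁, m₂)` there is a primitive element
`α` of `F_{qⁿ}`, normal over `F_q`, with `f(α)` also primitive. -/
def memB (m₁ m₂ q n : ℕ) : Prop :=
  ∀ (K L : Type) [Field K] [Field L] [Fintype K] [Fintype L] [Algebra K L],
    Fintype.card K = q → Fintype.card L = q ^ n →
    ∀ f ∈ Upsilon L m₁ m₂,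
      ∃ α : L, IsPrimitiveElem α ∧ IsNormalElem K n α ∧ IsPrimitiveElem (ratEval f α)

/-- `𝔑(q, n)`: the number of primitive elements of `F_{qⁿ}` that are normal over `F_q`. -/
def NNum (K L : Type) [Field K] [Fintype K] [Field L] [Fintype L] [Algebra K L] (n : ℕ) : ℕ :=
  Nat.card {α : L | IsPrimitiveElem α ∧ IsNormalElem K n α}

end


theorem kummer_irred {K : Type*} [Field K] {e : ℕ} (he : 0 < e) {ζ : K} (hζ : IsPrimitiveRoot ζ e)
    {A : K} (hA : A ≠ 0) (h : ∀ l : ℕ, l.Prime → l ∣ e → ∀ b : K, b ^ l ≠ A) :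
    Irreducible (X ^ e - C A : K[X]) := by
  classical
  obtain ⟨θ, hθ⟩ := IsAlgClosed.exists_pow_nat_eq (algebraMap K (AlgebraicClosure K) A) he
  have hA' : algebraMap K (AlgebraicClosure K) A ≠ 0 := by simpa using hA
  have hθ0 : θ ≠ 0 := by
    rintro rfl
    rw [zero_pow he.ne'] at hθ
    exact hA' hθ.symm
  have hintg : IsIntegral K θ := Algebra.IsIntegral.isIntegral θ
  set p := minpoly K θ with hp
  have hdvd : p ∣ X ^ e - C A := minpoly.dvd K θ (by simp [hθ])
  have hmonic : (X ^ e - C A : K[X]).Monic := monic_X_pow_sub_C A he.ne'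
  -- roots
  have hroots : ∀ ρ ∈ (p.map (algebraMap K (AlgebraicClosure K))).roots,
      ∃ c : K, ρ = algebraMap K _ c * θ := by
    intro ρ hρ
    have h1 : aeval ρ p = 0 := by
      have := (mem_roots'.1 hρ).2
      simpa [IsRoot, eval_map_algebraMap] using this
    have h2 : aeval ρ (X ^ e - C A : K[X]) = 0 := by
      obtain ⟨r, hr⟩ := hdvd
      rw [hr, map_mul, h1, zero_mul]
    have h3 : ρ ^ e = θ ^ e := by
      rw [hθ]; simpa [sub_eq_zero] using h2
    have h4 : (ρ / θ) ^ e = 1 := by rw [div_pow, h3, div_self (pow_ne_zero _ hθ0)]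
    have hζ' : IsPrimitiveRoot (algebraMap K (AlgebraicClosure K) ζ) e :=
      hζ.map_of_injective (algebraMap K (AlgebraicClosure K)).injective
    have : NeZero e := ⟨he.ne'⟩
    obtain ⟨i, -, hi⟩ := hζ'.eq_pow_of_pow_eq_one h4
    refine ⟨ζ ^ i, ?_⟩
    rw [map_pow, hi, div_mul_cancel₀ _ hθ0]
  have hprod : ∀ s : Multiset (AlgebraicClosure K), (∀ ρ ∈ s, ∃ c : K, ρ = algebraMap K _ c * θ) →
      ∃ c : K, s.prod = algebraMap K _ c * θ ^ s.card := by
    intro s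
    induction s using Multiset.induction with
    | empty => intro _; exact ⟨1, by simp⟩
    | cons a s ih =>
      intro hs
      obtain ⟨c, hc⟩ := ih (fun ρ hρ => hs ρ (Multiset.mem_cons_of_mem hρ))
      obtain ⟨c', hc'⟩ := hs a (Multiset.mem_cons_self a s)
      refine ⟨c' * c, ?_⟩
      rw [Multiset.prod_cons, hc, hc', Multiset.card_cons, map_mul]; ring
  obtain ⟨c, hc⟩ := hprod _ hroots
  have hpm : p.Monic := minpoly.monic hintg
  have hsplit := IsAlgClosed.splits (p.map (algebraMap K (AlgebraicClosure K)))
  have hcard : (p.map (algebraMap K (AlgebraicClosure K))).roots.card = p.natDegree := by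
    rw [← hsplit.natDegree_eq_card_roots, hpm.natDegree_map]
  have hcoeff : algebraMap K (AlgebraicClosure K) (p.coeff 0) =
      (-1) ^ p.natDegree * (algebraMap K _ c * θ ^ p.natDegree) := by
    rw [← coeff_map, hsplit.coeff_zero_eq_prod_roots_of_monic (hpm.map _), hc, hcard,
      hpm.natDegree_map]
  have hc0 : algebraMap K (AlgebraicClosure K) c ≠ 0 := by
    intro h0
    rw [h0, zero_mul, mul_zero] at hcoeff
    have : p.coeff 0 = 0 := by simpa using hcoeff
    have h1 := minpoly.coeff_zero_ne_zero hintg hθ0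
    exact h1 this
  set d := p.natDegree with hd
  let S : Subfield (AlgebraicClosure K) := (algebraMap K (AlgebraicClosure K)).fieldRange
  have hmem : ∀ x : K, algebraMap K (AlgebraicClosure K) x ∈ S := fun x => ⟨x, rfl⟩
  have hθd : θ ^ d ∈ S := by
    have : θ ^ d = (algebraMap K (AlgebraicClosure K) (p.coeff 0)) * ((-1) ^ d) /
        algebraMap K _ c := by
      rw [hcoeff]
      field_simp
      rw [← pow_mul, mul_comm d 2, pow_mul]; simp
    rw [this]
    exact S.div_mem (S.mul_mem (hmem _) (S.pow_mem (S.neg_mem S.one_mem) _)) (hmem _)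
  have hθe : θ ^ e ∈ S := by rw [hθ]; exact hmem _
  have hθg : θ ^ (Nat.gcd d e) ∈ S := by
    have h1 : θ ^ ((Nat.gcd d e : ℕ) : ℤ) ∈ S := by
      rw [Nat.gcd_eq_gcd_ab, zpow_add₀ hθ0, zpow_mul, zpow_mul]
      exact S.mul_mem (S.zpow_mem (by simpa using hθd) _) (S.zpow_mem (by simpa using hθe) _)
    simpa using h1
  have hge : Nat.gcd d e = e := by
    by_contra hne
    obtain ⟨k, hk⟩ := Nat.gcd_dvd_right d e
    have hk1 : k ≠ 1 := by rintro rfl; exact hne (by simpa using hk.symm)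
    obtain ⟨l, hl, m, hm⟩ := Nat.exists_prime_and_dvd hk1
    obtain ⟨b, hb⟩ := hθg
    refine h l hl ⟨Nat.gcd d e * m, hk.trans (by rw [hm]; ring)⟩ (b ^ m) ?_
    apply (algebraMap K (AlgebraicClosure K)).injective
    rw [map_pow, map_pow]
    have hb' : algebraMap K (AlgebraicClosure K) b = θ ^ (Nat.gcd d e) := hb
    rw [hb', ← hθ]
    rw [← pow_mul, ← pow_mul]; congr 1; exact ((hk.trans (by rw [hm]; ring)) : e = _).symm
  have hed : e ∣ d := by rw [← hge]; exact Nat.gcd_dvd_left d e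
  have hde : d ≤ e := by
    have := natDegree_le_of_dvd hdvd hmonic.ne_zero
    rwa [natDegree_X_pow_sub_C] at this
  have hd0 : 0 < d := minpoly.natDegree_pos hintg
  have hdeq : d = e := le_antisymm hde (Nat.le_of_dvd hd0 hed)
  have : p = X ^ e - C A := by
    refine (eq_of_monic_of_dvd_of_natDegree_le hpm hmonic hdvd ?_).symm
    rw [natDegree_X_pow_sub_C, ← hd, hdeq]
  rw [← this]
  exact minpoly.irreducible hintg


theorem natDegree_resultant_bound {F : Type*} [Field F] (f g : F[X][X]) (m n df dg : ℕ)
    (hf : ∀ i, (f.coeff i).natDegree ≤ df) (hg : ∀ i, (g.coeff i).natDegree ≤ dg) :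
    (resultant f g m n).natDegree ≤ m * dg + n * df := by
  rw [resultant, Matrix.det_apply]
  refine natDegree_sum_le_of_forall_le _ _ fun σ _ => ?_
  refine (natDegree_smul_le _ _).trans ?_
  refine (natDegree_prod_le _ _).trans ?_
  rw [Fin.sum_univ_add]
  refine add_le_add ?_ ?_
  · refine (Finset.sum_le_card_nsmul _ _ dg fun i _ => ?_).trans (by simp)
    simp only [sylvester, Matrix.of_apply, Fin.addCases_left]
    split_ifs
    · exact hg _
    · simp
  · refine (Finset.sum_le_card_nsmul _ _ df fun i _ => ?_).trans (by simp)
    simp only [sylvester, Matrix.of_apply, Fin.addCases_right]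
    split_ifs
    · exact hf _
    · simp

/-- Non-degeneracy of `H` with respect to the exponent `e`. -/
def NonDeg {F : Type*} [Field F] (H : F[X]) (e : ℕ) : Prop :=
  ∀ l : ℕ, l.Prime → l ∣ e → ∃ (b : AlgebraicClosure F) (j : ℕ) (r : (AlgebraicClosure F)[X]),
    ¬ l ∣ j ∧ H.map (algebraMap F (AlgebraicClosure F)) = (X - C b) ^ j * r ∧ r.eval b ≠ 0

theorem nonDeg_not_pow {F : Type*} [Field F] {H : F[X]} {e : ℕ} (hH : NonDeg H e) {l : ℕ}
    (hl : l.Prime) (hle : l ∣ e) {c : F} (hc : c ≠ 0) (x y : F[X]) (hy : y ≠ 0)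
    (h : x ^ l * H = C c * y ^ l) : False := by
  classical
  obtain ⟨b, j, r, hj, hr, hrb⟩ := hH l hl hle
  have h1 := congrArg (Polynomial.map (algebraMap F (AlgebraicClosure F))) h
  rw [Polynomial.map_mul, Polynomial.map_mul, Polynomial.map_pow, Polynomial.map_pow, hr,
    Polynomial.map_C] at h1
  have hinj : Function.Injective (algebraMap F (AlgebraicClosure F)) :=
    (algebraMap F (AlgebraicClosure F)).injective
  set y' := y.map (algebraMap F (AlgebraicClosure F)) with hy'
  set x' := x.map (algebraMap F (AlgebraicClosure F)) with hx'
  have hy0 : y' ≠ 0 := by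
    rw [hy', Ne, Polynomial.map_eq_zero_iff hinj]; exact hy
  have hc0 : (C (algebraMap F (AlgebraicClosure F) c)) ≠ 0 := by
    simpa using hc
  have hR : C (algebraMap F (AlgebraicClosure F) c) * y' ^ l ≠ 0 :=
    mul_ne_zero hc0 (pow_ne_zero _ hy0)
  have hL : x' ^ l * ((X - C b) ^ j * r) ≠ 0 := by rw [h1]; exact hR
  have h2 := congrArg (rootMultiplicity b) h1
  rw [rootMultiplicity_mul hL, rootMultiplicity_mul hR, rootMultiplicity_C,
    rootMultiplicity_mul (right_ne_zero_of_mul hL), rootMultiplicity_X_sub_C_pow,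
    rootMultiplicity_eq_zero (p := r) (by simpa [IsRoot] using hrb), ← count_roots, ← count_roots,
    roots_pow, roots_pow, Multiset.count_nsmul, Multiset.count_nsmul, count_roots, count_roots] at h2
  apply hj
  have h3 : l ∣ l * rootMultiplicity b x' + j := by
    have : l * rootMultiplicity b x' + j = l * rootMultiplicity b y' := by omega
    rw [this]; exact dvd_mul_right _ _
  exact (Nat.dvd_add_right (dvd_mul_right _ _)).1 h3

theorem stepanov_indep {F : Type*} [Field F] [Fintype F] {e : ℕ} (he : 0 < e)
    (hediv : e ∣ Fintype.card F - 1) {H : F[X]} (hm : H.Monic) (h0 : H.eval 0 ≠ 0)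
    (hND : NonDeg H e) (a : Fin e → F[X]) (D : ℕ) (hD : ∀ i, (a i).natDegree ≤ D)
    (hq : e * D + e * H.natDegree < Fintype.card F)
    (hdiv : X ^ Fintype.card F ∣ ∑ i, a i * H ^ ((i : ℕ) * ((Fintype.card F - 1) / e))) :
    ∀ i, a i = 0 := by
  classical
  set q := Fintype.card F with hqdef
  set M := (q - 1) / e with hM
  have hq1 : 1 ≤ q := by omega
  have heM : e * M = q - 1 := Nat.mul_div_cancel' hediv
  set B : F[X][X] := ∑ i : Fin e, C (a i) * X ^ (i : ℕ) with hB
  set P : F[X][X] := C H * X ^ e - C (C (H.eval 0)) with hP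
  have hBcoeff : ∀ k, B.coeff k = if h : k < e then a ⟨k, h⟩ else 0 := by
    intro k
    rw [hB, finsetSum_coeff]
    simp only [coeff_C_mul, coeff_X_pow, mul_ite, mul_one, mul_zero]
    split_ifs with h
    · rw [Finset.sum_eq_single ⟨k, h⟩]
      · simp
      · intro b _ hb
        rw [if_neg]
        intro hk; apply hb; ext; exact hk.symm
      · simp
    · refine Finset.sum_eq_zero fun i _ => ?_
      rw [if_neg]; have := i.2; omega
  by_contra hcon
  push Not at hcon
  obtain ⟨i0, hi0⟩ := hcon
  have hB0 : B ≠ 0 := by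
    intro h
    have := hBcoeff i0
    rw [h] at this
    simp at this
    exact hi0 this.symm
  have hBdeg : B.natDegree < e := by
    by_contra hlt
    have h1 := hBcoeff B.natDegree
    rw [dif_neg hlt] at h1
    exact hB0 (leadingCoeff_eq_zero.1 h1)
  have hH0 : H ≠ 0 := hm.ne_zero
  have hPdeg : P.natDegree = e := by
    rw [hP, natDegree_sub_C, natDegree_C_mul_X_pow _ _ hH0]
  -- coprimality over the fraction field
  set K := RatFunc F
  let φ : F[X] →+* K := algebraMap F[X] K
  have hφ : Function.Injective φ := RatFunc.algebraMap_injective F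
  have hφH : φ H ≠ 0 := by rwa [Ne, map_eq_zero_iff φ hφ]
  have hφc : φ (C (H.eval 0)) ≠ 0 := by
    rw [Ne, map_eq_zero_iff φ hφ, C_eq_zero]; exact h0
  set A : K := φ (C (H.eval 0)) / φ H with hA
  have hA0 : A ≠ 0 := div_ne_zero hφc hφH
  have hprim : ∃ ζ : F, IsPrimitiveRoot ζ e := by
    obtain ⟨g, hg⟩ := IsCyclic.exists_generator (α := Fˣ)
    have hord : orderOf g = q - 1 := by
      rw [orderOf_eq_card_of_forall_mem_zpowers hg, Nat.card_eq_fintype_card,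
        Fintype.card_units]
    refine ⟨((g ^ M : Fˣ) : F), ?_⟩
    have h1 : IsPrimitiveRoot (g ^ M) e := by
      have h2 := IsPrimitiveRoot.orderOf g
      rw [hord] at h2
      have hq2 : 0 < q - 1 := by
        rw [hqdef, ← Fintype.card_units]; exact Fintype.card_pos
      exact h2.pow hq2 (by rw [← heM]; ring)
    exact IsPrimitiveRoot.coe_units_iff.2 h1
  obtain ⟨ζ, hζ⟩ := hprim
  have hζK : IsPrimitiveRoot (φ (C ζ)) e :=
    (hζ.map_of_injective (C_injective)).map_of_injective hφ
  have hirr : Irreducible (X ^ e - C A : K[X]) := by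
    refine kummer_irred he hζK hA0 ?_
    intro l hl hle b hb
    have hb0 : b.denom ≠ 0 := RatFunc.denom_ne_zero b
    refine nonDeg_not_pow hND hl hle h0 b.num b.denom hb0 ?_
    apply hφ
    have hd : φ b.denom ≠ 0 := by rwa [Ne, map_eq_zero_iff φ hφ]
    have hb' : b = φ b.num / φ b.denom := (RatFunc.num_div_denom b).symm
    rw [hb', div_pow, hA, div_eq_div_iff (pow_ne_zero _ hd) hφH] at hb
    rw [map_mul, map_mul, map_pow, map_pow]
    exact hb
  have hPmap : P.map φ = C (φ H) * (X ^ e - C A) := by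
    rw [hP, Polynomial.map_sub, Polynomial.map_mul, Polynomial.map_C, Polynomial.map_C,
      Polynomial.map_pow, Polynomial.map_X, mul_sub, ← C_mul, hA, mul_div_cancel₀ _ hφH]
  have hBmap0 : B.map φ ≠ 0 := by rwa [Ne, Polynomial.map_eq_zero_iff hφ]
  have hcop : IsCoprime (B.map φ) (P.map φ) := by
    rw [hPmap]
    have h1 : IsCoprime (X ^ e - C A) (B.map φ) := by
      refine (hirr.coprime_iff_not_dvd).2 ?_
      intro hd
      have := natDegree_le_of_dvd hd hBmap0
      rw [natDegree_X_pow_sub_C, natDegree_map_eq_of_injective hφ] at this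
      omega
    have hu : IsUnit (C (φ H) : K[X]) := isUnit_C.2 (isUnit_iff_ne_zero.2 hφH)
    exact (isCoprime_mul_unit_left_right hu _ _).2 h1.symm
  have hres0 : resultant B P ≠ 0 := by
    intro h
    have h1 := resultant_map_map B P B.natDegree P.natDegree φ
    rw [h, map_zero, ← natDegree_map_eq_of_injective hφ B,
      ← natDegree_map_eq_of_injective hφ P] at h1
    exact (resultant_eq_zero_iff.1 h1).2 hcop
  obtain ⟨p, r, -, -, hpr⟩ := exists_mul_add_mul_eq_C_resultant (m := B.natDegree)
    (n := P.natDegree) B P le_rfl le_rfl (Or.inr (by omega))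
  have hev := congrArg (Polynomial.eval (H ^ M)) hpr
  rw [eval_add, eval_mul, eval_mul, eval_C] at hev
  have hBev : X ^ q ∣ B.eval (H ^ M) := by
    have : B.eval (H ^ M) = ∑ i : Fin e, a i * H ^ ((i : ℕ) * M) := by
      rw [hB, eval_finsetSum]
      refine Finset.sum_congr rfl fun i _ => ?_
      rw [eval_mul, eval_C, eval_pow, eval_X, ← pow_mul, mul_comm M]
    rw [this]; exact hdiv
  have hPev : X ^ q ∣ P.eval (H ^ M) := by
    have h1 : P.eval (H ^ M) = H ^ q - C (H.eval 0) := by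
      rw [hP, eval_sub, eval_mul, eval_C, eval_C, eval_pow, eval_X, ← pow_mul, mul_comm M, heM,
        ← pow_succ', Nat.sub_add_cancel hq1]
    have h2 : H ^ q = expand F q H := (FiniteField.expand_card H).symm
    have h3 : X ∣ H - C (H.eval 0) := by
      rw [X_dvd_iff]; simp [coeff_zero_eq_eval_zero]
    obtain ⟨k, hk⟩ := h3
    refine ⟨expand F q k, ?_⟩
    rw [h1, h2]
    have h4 := congrArg (expand F q) hk
    rw [map_sub, expand_C, map_mul, expand_X] at h4
    exact h4
  have hdvdres : X ^ q ∣ resultant B P := by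
    rw [← hev]
    exact dvd_add (dvd_mul_of_dvd_left hBev _) (dvd_mul_of_dvd_left hPev _)
  have h5 := natDegree_le_of_dvd hdvdres hres0
  have h6 := natDegree_resultant_bound B P B.natDegree P.natDegree D H.natDegree
    (by
      intro i; rw [hBcoeff]; split_ifs
      · exact hD _
      · simp)
    (by
      intro i
      rw [hP, coeff_sub, coeff_C_mul, coeff_X_pow, coeff_C]
      refine (natDegree_sub_le _ _).trans (max_le ?_ ?_)
      · split_ifs <;> simp
      · split_ifs <;> simp)
  rw [natDegree_X_pow] at h5
  rw [hPdeg] at h5 h6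
  have h7 : B.natDegree * H.natDegree ≤ e * H.natDegree := Nat.mul_le_mul_right _ hBdeg.le
  omega


theorem pow_dvd_hasseDeriv {F : Type*} [Field F] (a H : F[X]) (N : ℕ) :
    ∀ l, H ^ (N - l) ∣ hasseDeriv l (a * H ^ N) := by
  induction N with
  | zero => intro l; simp
  | succ N ih =>
    intro l
    rw [pow_succ, ← mul_assoc, hasseDeriv_mul]
    refine Finset.dvd_sum fun ij hij => ?_
    have hsum : ij.1 + ij.2 = l := Finset.HasAntidiagonal.mem_antidiagonal.1 hij
    rcases Nat.eq_zero_or_pos ij.2 with h | h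
    · rw [h, hasseDeriv_zero']
      have h1 : ij.1 = l := by omega
      rw [h1]
      refine dvd_trans (pow_dvd_pow H (show N + 1 - l ≤ (N - l) + 1 by omega)) ?_
      rw [pow_succ]
      exact mul_dvd_mul_right (ih l) H
    · exact dvd_mul_of_dvd_left (dvd_trans (pow_dvd_pow H (by omega)) (ih ij.1)) _

/-- The quotient of the Hasse derivative of `a * H ^ N` by `H ^ (N - l)`. -/
noncomputable def hasseQuot {F : Type*} [Field F] (H : F[X]) (N l : ℕ) (a : F[X]) : F[X] :=
  (pow_dvd_hasseDeriv a H N l).choose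

theorem hasseQuot_spec {F : Type*} [Field F] (H : F[X]) (N l : ℕ) (a : F[X]) :
    hasseDeriv l (a * H ^ N) = H ^ (N - l) * hasseQuot H N l a :=
  (pow_dvd_hasseDeriv a H N l).choose_spec

theorem hasseQuot_add {F : Type*} [Field F] {H : F[X]} (hH : H ≠ 0) (N l : ℕ) (a b : F[X]) :
    hasseQuot H N l (a + b) = hasseQuot H N l a + hasseQuot H N l b := by
  apply mul_left_cancel₀ (pow_ne_zero (N - l) hH)
  rw [mul_add, ← hasseQuot_spec, ← hasseQuot_spec, ← hasseQuot_spec, add_mul, map_add]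

theorem hasseQuot_smul {F : Type*} [Field F] {H : F[X]} (hH : H ≠ 0) (N l : ℕ) (c : F) (a : F[X]) :
    hasseQuot H N l (c • a) = c • hasseQuot H N l a := by
  apply mul_left_cancel₀ (pow_ne_zero (N - l) hH)
  rw [mul_smul_comm, ← hasseQuot_spec, ← hasseQuot_spec, smul_mul_assoc, map_smul]

theorem natDegree_hasseQuot {F : Type*} [Field F] {H : F[X]} (hH : H.Monic) {N l : ℕ} (hl : l ≤ N)
    (a : F[X]) : (hasseQuot H N l a).natDegree ≤ a.natDegree + l * H.natDegree := by
  by_cases h0 : hasseQuot H N l a = 0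
  · rw [h0]; simp
  have h1 := congrArg natDegree (hasseQuot_spec H N l a)
  rw [(hH.pow _).natDegree_mul' h0, hH.natDegree_pow] at h1
  have h2 := natDegree_hasseDeriv_le (a * H ^ N) l
  have h3 : (a * H ^ N).natDegree ≤ a.natDegree + N * H.natDegree := by
    refine natDegree_mul_le.trans ?_
    rw [hH.natDegree_pow]
  obtain ⟨k, rfl⟩ := Nat.exists_eq_add_of_le hl
  have h4 : l + k - l = k := by omega
  rw [h4] at h1
  rw [add_mul] at h3
  omega

theorem X_sub_C_pow_dvd_iff_taylor {F : Type*} [Field F] (R : F[X]) (x : F) (l : ℕ) :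
    (X - C x) ^ l ∣ R ↔ X ^ l ∣ taylor x R := by
  constructor
  · rintro ⟨k, rfl⟩
    rw [taylor_mul, taylor_pow]
    simp
  · rintro ⟨k, hk⟩
    refine ⟨taylor (-x) k, ?_⟩
    have := congrArg (taylor (-x)) hk
    rw [taylor_taylor, taylor_mul, taylor_pow] at this
    simpa [sub_eq_add_neg] using this

theorem stepanov_core {F : Type*} [Field F] [Fintype F] [DecidableEq F] {e : ℕ} (he : 0 < e)
    (hediv : e ∣ Fintype.card F - 1) {H : F[X]} (hm : H.Monic) (h0 : H.eval 0 ≠ 0)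
    (hND : NonDeg H e) (u : F) (D K l : ℕ) (hD : 0 < D) (hl : l ≤ Fintype.card F)
    (hq : e * D + e * H.natDegree ≤ Fintype.card F)
    (hpar : l * (D + K + l * H.natDegree) < e * K * D) :
    l * (Finset.univ.filter fun x : F => H.eval x ^ ((Fintype.card F - 1) / e) = u).card
      ≤ l * H.natDegree + D + H.natDegree * Fintype.card F + K * Fintype.card F := by
  classical
  set q := Fintype.card F with hqdef
  set M := (q - 1) / e with hM
  have heM : e * M = q - 1 := Nat.mul_div_cancel' hediv
  set m := H.natDegree with hmdef
  set E := D + K + l * m with hE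
  have hH0 : H ≠ 0 := hm.ne_zero
  -- the auxiliary polynomials
  let P : (Fin e × Fin K → degreeLT F D) → ℕ → F[X] := fun a j =>
    ∑ ik : Fin e × Fin K, (u ^ (ik.1 : ℕ)) •
      (hasseQuot H (l + ik.1 * M) j (a ik : F[X]) * X ^ (ik.2 : ℕ))
  let Ψ : (Fin e × Fin K → degreeLT F D) →ₗ[F] (Fin l → Fin E → F) :=
    { toFun := fun a j i => (P a j).coeff i
      map_add' := by
        intro a b
        funext j i
        simp only [P, Pi.add_apply, Submodule.coe_add, hasseQuot_add hH0, add_mul, smul_add,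
          Finset.sum_add_distrib, coeff_add]
      map_smul' := by
        intro c a
        funext j i
        simp only [P, Pi.smul_apply, Submodule.coe_smul, hasseQuot_smul hH0, RingHom.id_apply,
          smul_mul_assoc]
        simp only [smul_comm _ c, ← Finset.smul_sum, coeff_smul] }
  have hker : LinearMap.ker Ψ ≠ ⊥ := by
    apply LinearMap.ker_ne_bot_of_finrank_lt
    have h1 : Module.finrank F (Fin e × Fin K → degreeLT F D) = e * K * D := by
      rw [Module.finrank_pi_fintype]
      simp [(degreeLTEquiv F D).finrank_eq]
    rw [h1]
    simpa [Module.finrank_pi_fintype] using hpar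
  obtain ⟨a, haker, ha0⟩ := (Submodule.ne_bot_iff _).1 hker
  have hadeg : ∀ ik, ((a ik : F[X])).natDegree ≤ D - 1 := by
    intro ik
    have h1 := mem_degreeLT.1 (a ik).2
    by_cases hz : (a ik : F[X]) = 0
    · rw [hz]; simp
    · have := (natDegree_lt_iff_degree_lt hz).2 h1
      omega
  have hP0 : ∀ j < l, P a j = 0 := by
    intro j hj
    have hdeg : (P a j).natDegree < E := by
      refine lt_of_le_of_lt (natDegree_sum_le_of_forall_le (n := D - 1 + j * m + (K - 1)) _ _ ?_) ?_
      · intro ik _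
        refine (natDegree_smul_le _ _).trans (natDegree_mul_le.trans ?_)
        rw [natDegree_X_pow]
        have h1 := natDegree_hasseQuot hm (show j ≤ l + ik.1 * M by omega) (a ik : F[X])
        have h2 := hadeg ik
        have h3 := ik.2.2
        rw [← hmdef] at h1
        omega
      · have h1 : j * m ≤ l * m := Nat.mul_le_mul_right _ hj.le
        omega
    ext i
    rw [coeff_zero]
    by_cases hi : i < E
    · have h1 : Ψ a = 0 := haker
      exact congrFun (congrFun h1 ⟨j, hj⟩) ⟨i, hi⟩
    · exact coeff_eq_zero_of_natDegree_lt (by omega)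
  -- the polynomial R
  let g : Fin K → F[X] := fun k => ∑ i : Fin e, (a (i, k) : F[X]) * H ^ (l + i * M)
  let R : F[X] := ∑ k : Fin K, X ^ ((k : ℕ) * q) * g k
  have hR0 : R ≠ 0 := by
    intro hR
    have hex : ∃ k : Fin K, ∃ i : Fin e, a (i, k) ≠ 0 := by
      by_contra hcon
      push Not at hcon
      exact ha0 (funext fun ik => hcon ik.2 ik.1)
    have hex' : ∃ n : ℕ, ∃ h : n < K, ∃ i : Fin e, a (i, ⟨n, h⟩) ≠ 0 := by
      obtain ⟨k, hk⟩ := hex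
      exact ⟨k, k.2, hk⟩
    obtain ⟨hk0, i0, hi0⟩ := Nat.find_spec hex'
    have hmin : ∀ k : Fin K, (k : ℕ) < Nat.find hex' → g k = 0 := by
      intro k hk
      have h1 := Nat.find_min hex' hk
      push Not at h1
      refine Finset.sum_eq_zero fun i _ => ?_
      rw [h1 k.2 i]; simp
    set k0 := Nat.find hex' with hk0def
    have hdvd : X ^ (k0 * q + q) ∣ X ^ (k0 * q) * g ⟨k0, hk0⟩ := by
      have h1 : X ^ (k0 * q) * g ⟨k0, hk0⟩ =
          R - ∑ k ∈ Finset.univ.erase (⟨k0, hk0⟩ : Fin K), X ^ ((k : ℕ) * q) * g k := by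
        rw [eq_sub_iff_add_eq]
        exact Finset.add_sum_erase Finset.univ (fun k : Fin K => X ^ ((k : ℕ) * q) * g k)
          (Finset.mem_univ _)
      rw [h1, hR, zero_sub, dvd_neg]
      refine Finset.dvd_sum fun k hk => ?_
      rcases lt_or_ge (k : ℕ) k0 with hlt | hge
      · rw [hmin k hlt, mul_zero]; exact dvd_zero _
      · have hne : (k : ℕ) ≠ k0 := by
          intro h; apply (Finset.mem_erase.1 hk).1; ext; exact h
        refine dvd_mul_of_dvd_left (pow_dvd_pow _ ?_) _
        calc k0 * q + q = (k0 + 1) * q := by ring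
          _ ≤ k * q := Nat.mul_le_mul_right _ (by omega)
    have hdvd2 : X ^ q ∣ g ⟨k0, hk0⟩ := by
      rw [pow_add] at hdvd
      exact (mul_dvd_mul_iff_left (pow_ne_zero _ X_ne_zero)).1 hdvd
    have hg : g ⟨k0, hk0⟩ = H ^ l * ∑ i : Fin e, (a (i, ⟨k0, hk0⟩) : F[X]) * H ^ ((i : ℕ) * M) := by
      simp only [g, Finset.mul_sum]
      refine Finset.sum_congr rfl fun i _ => ?_
      rw [pow_add]; ring
    have hcop : IsCoprime (X ^ q) (H ^ l) := by
      refine IsCoprime.pow ?_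
      refine (irreducible_X.coprime_iff_not_dvd).2 ?_
      rw [X_dvd_iff, coeff_zero_eq_eval_zero]
      exact h0
    rw [hg] at hdvd2
    have hdvd3 := hcop.dvd_of_dvd_mul_left hdvd2
    have h2 := stepanov_indep he hediv hm h0 hND (fun i => (a (i, ⟨k0, hk0⟩) : F[X])) (D - 1)
      (fun i => hadeg _) (by
        have h3 : e * (D - 1) + e = e * D := by
          rw [← Nat.mul_succ]; congr 1; omega
        rw [← hmdef, ← hqdef]
        omega) hdvd3 i0
    exact hi0 (by ext1; exact h2)
  -- vanishing
  have hvan : ∀ x : F, H.eval x ^ M = u → (X - C x) ^ l ∣ R := by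
    intro x hx
    rw [X_sub_C_pow_dvd_iff_taylor]
    have hxq : (X + C x : F[X]) ^ q = X ^ q + C x := by
      have h1 : (X + C x : F[X]) ^ q = expand F q (X + C x) := (FiniteField.expand_card _).symm
      rw [h1, map_add, expand_X, expand_C]
    have hRt : taylor x R = ∑ k : Fin K, (X ^ q + C x) ^ (k : ℕ) * taylor x (g k) := by
      simp only [R, map_sum]
      refine Finset.sum_congr rfl fun k _ => ?_
      rw [taylor_mul, taylor_pow, taylor_X, mul_comm (k : ℕ), pow_mul, hxq]
    have hQ : taylor x (∑ k : Fin K, C (x ^ (k : ℕ)) * g k) =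
        ∑ k : Fin K, (C x) ^ (k : ℕ) * taylor x (g k) := by
      simp only [map_sum]
      refine Finset.sum_congr rfl fun k _ => ?_
      rw [taylor_mul, taylor_C, C_pow]
    have hdiff : X ^ l ∣ taylor x R - taylor x (∑ k : Fin K, C (x ^ (k : ℕ)) * g k) := by
      rw [hRt, hQ, ← Finset.sum_sub_distrib]
      refine Finset.dvd_sum fun k _ => ?_
      rw [← sub_mul]
      refine dvd_mul_of_dvd_left ?_ _
      refine dvd_trans ?_ (sub_dvd_pow_sub_pow _ _ _)
      rw [add_sub_cancel_right]
      exact pow_dvd_pow _ hl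
    refine (dvd_iff_dvd_of_dvd_sub hdiff).2 ?_
    rw [X_pow_dvd_iff]
    intro j hj
    rw [taylor_coeff]
    have h1 : hasseDeriv j (∑ k : Fin K, C (x ^ (k : ℕ)) * g k) =
        ∑ k : Fin K, ∑ i : Fin e, (x ^ (k : ℕ)) •
          (H ^ (l + (i : ℕ) * M - j) * hasseQuot H (l + i * M) j (a (i, k) : F[X])) := by
      rw [map_sum]
      refine Finset.sum_congr rfl fun k _ => ?_
      rw [← smul_eq_C_mul, map_smul, ← Finset.smul_sum]
      congr 1
      simp only [g, map_sum]
      refine Finset.sum_congr rfl fun i _ => ?_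
      rw [hasseQuot_spec]
    have h2 : eval x (hasseDeriv j (∑ k : Fin K, C (x ^ (k : ℕ)) * g k)) =
        H.eval x ^ (l - j) * eval x (P a j) := by
      rw [h1]
      simp only [P, eval_finsetSum, Finset.mul_sum]
      rw [Fintype.sum_prod_type_right]
      refine Finset.sum_congr rfl fun k _ => Finset.sum_congr rfl fun i _ => ?_
      simp only [eval_smul, eval_mul, eval_pow, eval_X, smul_eq_mul]
      have h3 : l + (i : ℕ) * M - j = (l - j) + M * i := by
        rw [mul_comm M]; omega
      rw [h3, pow_add, pow_mul, hx]
      ring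
    rw [h2, hP0 j hj]
    simp
  have hprod : (∏ x ∈ Finset.univ.filter fun x : F => H.eval x ^ M = u, (X - C x) ^ l) ∣ R := by
    refine Finset.prod_dvd_of_coprime ?_ ?_
    · intro x _ y _ hxy
      exact (pairwise_coprime_X_sub_C Function.injective_id hxy).pow
    · intro x hx
      exact hvan x (Finset.mem_filter.1 hx).2
  have hdeg := natDegree_le_of_dvd hprod hR0
  rw [natDegree_prod_of_monic _ _ (fun x _ => (monic_X_sub_C x).pow l)] at hdeg
  simp only [natDegree_pow, natDegree_X_sub_C, mul_one, Finset.sum_const, smul_eq_mul] at hdeg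
  rw [mul_comm]
  refine hdeg.trans ?_
  refine natDegree_sum_le_of_forall_le _ _ ?_
  intro k _
  refine natDegree_mul_le.trans ?_
  rw [natDegree_X_pow]
  have h1 : (g k).natDegree ≤ D + (l + q) * m := by
    refine natDegree_sum_le_of_forall_le _ _ ?_
    intro i _
    refine natDegree_mul_le.trans ?_
    rw [hm.natDegree_pow, ← hmdef]
    have h2 := hadeg (i, k)
    have h3 : (i : ℕ) * M ≤ q := by
      calc (i : ℕ) * M ≤ e * M := Nat.mul_le_mul_right _ i.2.le
        _ ≤ q := by omega
    have h4 : (l + (i : ℕ) * M) * m ≤ (l + q) * m := Nat.mul_le_mul_right _ (by omega)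
    omega
  have h2 : (k : ℕ) * q ≤ K * q := Nat.mul_le_mul_right _ k.2.le
  have h3 : (l + q) * m = l * m + m * q := by ring
  omega


theorem NonDeg.shift {F : Type*} [Field F] {H : F[X]} {e : ℕ} (h : NonDeg H e) (z : F) :
    NonDeg (H.comp (X + C z)) e := by
  intro l hl hle
  obtain ⟨b, j, r, hj, hH, hr⟩ := h l hl hle
  refine ⟨b - algebraMap F _ z, j, r.comp (X + C (algebraMap F _ z)), hj, ?_, ?_⟩
  · rw [Polynomial.map_comp, hH, mul_comp, pow_comp]
    have h2 : map (algebraMap F (AlgebraicClosure F)) (X + C z) =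
      X + C (algebraMap F (AlgebraicClosure F) z) := by simp
    rw [h2]
    congr 2
    rw [sub_comp, X_comp, C_comp, C_sub]
    ring
  · rw [eval_comp]; simpa using hr

theorem stepanov_arith (l K D q m e : ℕ) (he : 0 < e) (hl1 : l * l ≤ q) (hKl : K ≤ l + (m + 4))
    (hlm : m + 4 ≤ l) (hbig2 : e * (m + 3) * (m + 1) * 4 ≤ q) (h5 : q < e * (D + m) + e) :
    l * K + l * (l * m) < e * (m + 3) * D := by
  have h3 : l * K ≤ q + q := by
    calc l * K ≤ l * (l + l) := Nat.mul_le_mul_left _ (by omega)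
      _ = l * l + l * l := by ring
      _ ≤ q + q := by omega
  have h4 : l * (l * m) ≤ q * m := by
    rw [← mul_assoc]; exact Nat.mul_le_mul_right _ hl1
  have h6 : (q + 1) * (m + 3) ≤ (e * (D + m) + e) * (m + 3) := Nat.mul_le_mul_right _ h5
  have h7 : (e * (D + m) + e) * (m + 3) = e * (m + 3) * D + e * (m + 3) * (m + 1) := by ring
  have h8 : (q + 1) * (m + 3) = q * m + 3 * q + m + 3 := by ring
  omega

theorem stepanov_nat {F : Type*} [Field F] [Fintype F] [DecidableEq F] {e m : ℕ} (he : 0 < e)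
    (hediv : e ∣ Fintype.card F - 1) {H : F[X]} (hm : H.Monic) (hmd : H.natDegree = m)
    (hND : NonDeg H e) (u : F)
    (hbig : (m + 4) ^ 2 + e * (m + 3) * (m + 1) * 4 ≤ Fintype.card F) :
    e * (Finset.univ.filter fun x : F => H.eval x ^ ((Fintype.card F - 1) / e) = u).card
      ≤ Fintype.card F + e * (m + 4 * (2 * m + 5) * Nat.sqrt (Fintype.card F)) := by
  classical
  have hbig1 : (m + 4) * (m + 4) ≤ Fintype.card F := by
    rw [← pow_two]; exact le_trans (Nat.le_add_right _ _) hbig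
  have hbig2 : e * (m + 3) * (m + 1) * 4 ≤ Fintype.card F :=
    le_trans (Nat.le_add_left _ _) hbig
  have hmq : m < Fintype.card F := by nlinarith
  obtain ⟨z, hz⟩ : ∃ z : F, H.eval z ≠ 0 := by
    by_contra hcon
    push Not at hcon
    have := card_le_degree_of_subset_roots (p := H) (Z := Finset.univ) (by
      intro x _
      rw [mem_roots hm.ne_zero]
      exact hcon x)
    rw [Finset.card_univ] at this
    omega
  have hcard : (Finset.univ.filter fun x : F => H.eval x ^ ((Fintype.card F - 1) / e) = u).card =
     (Finset.univ.filter fun x : F =>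
        (H.comp (X + C z)).eval x ^ ((Fintype.card F - 1) / e) = u).card := by
    refine Finset.card_bij' (fun x _ => x - z) (fun x _ => x + z) ?_ ?_ ?_ ?_ <;>
      simp [eval_comp]
  rw [hcard]
  have hm' : (H.comp (X + C z)).Monic := hm.comp_X_add_C z
  have hd' : (H.comp (X + C z)).natDegree = m := by rw [natDegree_comp, hmd]; simp
  set q := Fintype.card F with hq
  set l := Nat.sqrt q with hl
  have hl1 : l * l ≤ q := Nat.sqrt_le q
  have hl2 : q < (l + 1) * (l + 1) := Nat.lt_succ_sqrt q
  have hlm : m + 4 ≤ l := by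
    rw [hl, Nat.le_sqrt]; exact hbig1
  have hq4 : q ≤ 4 * l * l := by nlinarith
  set D := q / e - m with hD
  set K := l / e + (m + 4) with hK
  have hqe : e * (q / e) ≤ q := Nat.mul_div_le q e
  have hqe2 : q < e * (q / e) + e := by
    have := Nat.lt_mul_div_succ q he
    rwa [mul_add, mul_one] at this
  have hmD : m + 1 ≤ q / e := by
    rw [Nat.le_div_iff_mul_le he]
    calc (m + 1) * e ≤ (m + 1) * e * ((m + 3) * 4) := Nat.le_mul_of_pos_right _ (by omega)
      _ = e * (m + 3) * (m + 1) * 4 := by ring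
      _ ≤ q := hbig2
  have hDm : D + m = q / e := by omega
  have hle : e * (l / e) ≤ l := Nat.mul_div_le l e
  have hle2 : l < e * (l / e) + e := by
    have := Nat.lt_mul_div_succ l he
    rwa [mul_add, mul_one] at this
  have hKl : K ≤ l + (m + 4) := by
    have := Nat.div_le_self l e
    omega
  have hpar : l * (D + K + l * m) < e * K * D := by
    have h1 : l + e * (m + 3) ≤ e * K := by
      rw [hK]; nlinarith
    have h2 : l * K + l * (l * m) < e * (m + 3) * D := by
      exact stepanov_arith l K D q m e he hl1 hKl hlm hbig2 (by rw [← hDm] at hqe2; linarith)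
    calc l * (D + K + l * m) = l * D + (l * K + l * (l * m)) := by ring
      _ < l * D + e * (m + 3) * D := by omega
      _ = (l + e * (m + 3)) * D := by ring
      _ ≤ e * K * D := Nat.mul_le_mul_right _ h1
  have hcore := stepanov_core he hediv hm' (by simpa [eval_comp] using hz) (hND.shift z) u D K l
    (by omega) (by nlinarith) (by rw [hd', ← hq]; nlinarith) (by rw [hd']; exact hpar)
  rw [hd', ← hq] at hcore
  set N := (Finset.univ.filter fun x : F =>
        (H.comp (X + C z)).eval x ^ ((q - 1) / e) = u).card with hN
  have hlpos : 0 < l := by omega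
  refine Nat.le_of_mul_le_mul_left ?_ hlpos
  have hDq : D ≤ q := by
    have := Nat.div_le_self q e
    omega
  have h1 : e * (l * N) ≤ e * (l * m + D + m * q + K * q) := Nat.mul_le_mul_left _ hcore
  have h2 : e * K ≤ l + e * (m + 4) := by rw [hK, mul_add]; omega
  have h3 : e * (K * q) ≤ (l + e * (m + 4)) * q := by
    rw [← mul_assoc]; exact Nat.mul_le_mul_right _ h2
  have h4 : e * (1 + m + (m + 4)) * q ≤ e * (1 + m + (m + 4)) * (4 * l * l) :=
    Nat.mul_le_mul_left _ hq4
  have h5 : e * D ≤ e * q := Nat.mul_le_mul_left _ hDq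
  have h6 : e * (l * m + D + m * q + K * q) =
    e * (l * m) + e * D + e * m * q + e * (K * q) := by ring
  have h7 : l * (e * N) = e * (l * N) := by ring
  have h8 : l * (q + e * (m + 4 * (2 * m + 5) * l)) =
    l * q + e * (l * m) + e * (1 + m + (m + 4)) * (4 * l * l) := by ring
  have h9 : (l + e * (m + 4)) * q = l * q + e * (m + 4) * q := by ring
  have h10 : e * (1 + m + (m + 4)) * q = e * q + e * m * q + e * (m + 4) * q := by ring
  omega

theorem stepanov (m e : ℕ) (he : 0 < e) : ∃ B : ℝ, 0 ≤ B ∧ ∀ (F : Type) [Field F] [Fintype F]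
    [DecidableEq F] (H : F[X]), e ∣ Fintype.card F - 1 → H.Monic → H.natDegree = m → NonDeg H e →
    ∀ u : F, ((Finset.univ.filter fun x : F =>
      H.eval x ^ ((Fintype.card F - 1) / e) = u).card : ℝ) ≤
      (Fintype.card F : ℝ) / e + B * Real.sqrt (Fintype.card F) := by
  set q0 : ℕ := (m + 4) ^ 2 + e * (m + 3) * (m + 1) * 4 with hq0
  refine ⟨m + 4 * (2 * m + 5) + q0, by positivity, ?_⟩
  intro F _ _ _ H hdiv hm hmd hND u
  have hcpos : (1 : ℝ) ≤ Fintype.card F := by exact_mod_cast Fintype.card_pos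
  have hs1 : 1 ≤ Real.sqrt (Fintype.card F) := by rwa [Real.one_le_sqrt]
  have hs2 : Real.sqrt (Fintype.card F) * Real.sqrt (Fintype.card F) = Fintype.card F :=
    Real.mul_self_sqrt (by positivity)
  have hepos : (0 : ℝ) < e := by exact_mod_cast he
  by_cases hbig : q0 ≤ Fintype.card F
  · have h1 := stepanov_nat he hdiv hm hmd hND u hbig
    have h2 : ((Nat.sqrt (Fintype.card F) : ℕ) : ℝ) ≤ Real.sqrt (Fintype.card F) :=
      Real.nat_sqrt_le_real_sqrt
    have h3 : (e : ℝ) * ((Finset.univ.filter fun x : F =>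
      H.eval x ^ ((Fintype.card F - 1) / e) = u).card : ℝ) ≤ Fintype.card F + e * (m + 4 *
       (2 * m + 5) * (Nat.sqrt (Fintype.card F) : ℕ)) := by exact_mod_cast h1
    have h4 : (Fintype.card F : ℝ) / e + (m + 4 * (2 * m + 5) + q0) * Real.sqrt (Fintype.card F) =
       (Fintype.card F + e * ((m + 4 * (2 * m + 5) + q0) * Real.sqrt (Fintype.card F))) / e := by
      field_simp
    rw [h4, le_div_iff₀ hepos, mul_comm]
    refine h3.trans ?_
    gcongr
    have hmm : (0 : ℝ) ≤ m := by positivity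
    have hqq : (0 : ℝ) ≤ q0 := by positivity
    nlinarith
  · push Not at hbig
    have h1 : ((Finset.univ.filter fun x : F =>
      H.eval x ^ ((Fintype.card F - 1) / e) = u).card : ℝ) ≤ Fintype.card F := by
      exact_mod_cast Finset.card_le_univ _
    have h2 : (Fintype.card F : ℝ) ≤ q0 := by exact_mod_cast hbig.le
    have h3 : (0 : ℝ) ≤ (Fintype.card F : ℝ) / e := by positivity
    have h4 : (0 : ℝ) ≤ (m + 4 * (2 * m + 5) : ℝ) := by positivity
    have h5 : (q0 : ℝ) ≤ q0 * Real.sqrt (Fintype.card F) := by nlinarith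
    nlinarith


theorem nonDeg_comp {E : Type*} [Field E] {ι : Type*} [Fintype ι] [DecidableEq ι] (p : ι → E[X])
    (hsep : ∀ i, (p i).Separable) (hdeg : ∀ i, 0 < (p i).natDegree)
    (hcop : Pairwise fun i j => IsCoprime (p i) (p j)) (k : ι → ℕ) (e : ℕ)
    (hk : ∀ l : ℕ, l.Prime → l ∣ e → ∃ i, ¬ l ∣ k i) (A : E[X]) (hA : derivative A = -1)
    (hA2 : 0 < A.natDegree) :
    NonDeg ((∏ i, p i ^ k i).comp A) e := by
  intro l hl hle
  obtain ⟨i, hi⟩ := hk l hl hle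
  set φ := algebraMap E (AlgebraicClosure E) with hφ
  have hd : (((p i).comp A).map φ).degree ≠ 0 := by
    rw [degree_map]
    intro h
    have := natDegree_eq_of_degree_eq_some h
    rw [natDegree_comp] at this
    have := hdeg i
    rcases Nat.mul_eq_zero.1 ‹_› with h | h <;> omega
  obtain ⟨b, hb⟩ := IsAlgClosed.exists_root _ hd
  obtain ⟨r1, hr1⟩ := dvd_iff_isRoot.2 hb
  have hbeta : eval ((A.map φ).eval b) ((p i).map φ) = 0 := by
    rw [IsRoot.def, Polynomial.map_comp, eval_comp] at hb
    exact hb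
  have hr1b : r1.eval b ≠ 0 := by
    intro h0
    have h1 := congrArg (fun f => eval b (derivative f)) hr1
    simp only [derivative_mul, eval_add, eval_mul, h0] at h1
    simp only [derivative_sub, derivative_X, derivative_C, eval_sub, eval_X, eval_C, sub_self,
      zero_mul, mul_zero, add_zero] at h1
    rw [derivative_map, derivative_comp, hA, Polynomial.map_mul, Polynomial.map_comp, eval_mul,
      eval_comp] at h1
    simp at h1
    have h2 : ((p i).map φ).Separable := (hsep i).map
    rw [← derivative_map] at h1
    obtain ⟨u, v, huv⟩ := h2
    have h3 := congrArg (eval ((A.map φ).eval b)) huv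
    simp only [eval_add, eval_mul, hbeta, h1, eval_one, mul_zero, add_zero] at h3
    exact zero_ne_one h3
  refine ⟨b, k i, r1 ^ k i * ∏ j ∈ Finset.univ.erase i, (((p j).comp A).map φ) ^ k j, hi, ?_, ?_⟩
  · rw [prod_comp, Polynomial.map_prod, ← Finset.mul_prod_erase Finset.univ _ (Finset.mem_univ i)]
    simp only [pow_comp, Polynomial.map_pow]
    rw [hr1, mul_pow, mul_assoc]
  · rw [eval_mul, eval_pow, eval_prod]
    refine mul_ne_zero (pow_ne_zero _ hr1b) (Finset.prod_ne_zero_iff.2 ?_)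
    intro j hj
    rw [eval_pow]
    refine pow_ne_zero _ ?_
    rw [Polynomial.map_comp, eval_comp]
    intro h0
    have hij : j ≠ i := (Finset.mem_erase.1 hj).1
    obtain ⟨u, v, huv⟩ := (hcop hij).map (mapRingHom φ)
    have h3 := congrArg (eval ((A.map φ).eval b)) huv
    simp only [coe_mapRingHom, eval_add, eval_mul, hbeta, h0, eval_one, mul_zero, add_zero] at h3
    exact zero_ne_one h3

theorem mem_range_of_pow_card {L E : Type*} [Field L] [Field E] [Fintype L]
    [Algebra L E] {z : E} (h : z ^ Fintype.card L = z) : ∃ w : L, algebraMap L E w = z := by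
  classical
  have hp : (X ^ Fintype.card L - X : E[X]) ≠ 0 :=
    FiniteField.X_pow_card_sub_X_ne_zero _ Fintype.one_lt_card
  have h1 : (Finset.univ.image (algebraMap L E)) = (X ^ Fintype.card L - X : E[X]).roots.toFinset := by
    apply Finset.eq_of_subset_of_card_le
    · intro y hy
      obtain ⟨w, _, rfl⟩ := Finset.mem_image.1 hy
      rw [Multiset.mem_toFinset, mem_roots hp, IsRoot.def]
      simp [← map_pow, FiniteField.pow_card]
    · rw [Finset.card_image_of_injective _ (algebraMap L E).injective, Finset.card_univ]
      refine (Multiset.toFinset_card_le _).trans ((card_roots' _).trans ?_)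
      rw [FiniteField.X_pow_card_sub_X_natDegree_eq _ Fintype.one_lt_card]
  have h2 : z ∈ (X ^ Fintype.card L - X : E[X]).roots.toFinset := by
    rw [Multiset.mem_toFinset, mem_roots hp, IsRoot.def]
    simp [h]
  rw [← h1] at h2
  obtain ⟨w, _, hw⟩ := Finset.mem_image.1 h2
  exact ⟨w, hw⟩

/-- additive Hilbert 90 for finite fields -/
theorem exists_artin_schreier {L E : Type*} [Field L] [Field E] [Fintype L] [Finite E]
    [Algebra L E] (y : E) (hy : Algebra.trace L E y = 0) :
    ∃ z : E, z ^ Fintype.card L - z = y := by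
  classical
  let f : E →ₗ[L] E := (FiniteField.frobeniusAlgHom L E).toLinearMap - LinearMap.id
  have hf : ∀ z, f z = z ^ Fintype.card L - z := fun z => by simp [f]
  have hker : Module.finrank L (LinearMap.ker f) = 1 := by
    have h1 : LinearMap.ker f = LinearMap.range (Algebra.linearMap L E) := by
      ext z
      rw [LinearMap.mem_ker, hf, sub_eq_zero]
      constructor
      · intro h
        obtain ⟨w, hw⟩ := mem_range_of_pow_card (L := L) h
        exact ⟨w, hw⟩
      · rintro ⟨w, rfl⟩
        rw [Algebra.linearMap_apply, ← map_pow, FiniteField.pow_card]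
    rw [h1, LinearMap.finrank_range_of_inj (algebraMap L E).injective, Module.finrank_self]
  have hle : LinearMap.range f ≤ LinearMap.ker (Algebra.trace L E) := by
    rintro _ ⟨z, rfl⟩
    rw [LinearMap.mem_ker, hf, map_sub, sub_eq_zero]
    exact Algebra.trace_eq_of_algEquiv (FiniteField.frobeniusAlgEquivOfAlgebraic L E) z
  have htr : Module.finrank L (LinearMap.range (Algebra.trace L E)) = 1 := by
    rw [LinearMap.range_eq_top.2 (Algebra.trace_surjective L E), finrank_top, Module.finrank_self]
  have heq : LinearMap.range f = LinearMap.ker (Algebra.trace L E) := by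
    apply Submodule.eq_of_le_of_finrank_eq hle
    have h1 := LinearMap.finrank_range_add_finrank_ker f
    have h2 := LinearMap.finrank_range_add_finrank_ker (Algebra.trace L E)
    omega
  have : y ∈ LinearMap.range f := by rw [heq]; exact hy
  obtain ⟨z, hz⟩ := this
  exact ⟨z, by rw [← hf, hz]⟩


theorem card_sub_one_dvd (L E : Type*) [Field L] [Field E] [Fintype L] [Fintype E]
    [Algebra L E] : Fintype.card L - 1 ∣ Fintype.card E - 1 := by
  rw [Module.card_eq_pow_finrank (K := L) (V := E)]
  simpa using Nat.sub_dvd_pow_sub_pow (Fintype.card L) 1 (Module.finrank L E)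

theorem count_bound (L : Type) [Field L] [Fintype L] {ι : Type*} [Fintype ι] [DecidableEq ι]
    (p : ι → L[X]) (hirr : ∀ i, Irreducible (p i)) (hmon : ∀ i, (p i).Monic)
    (hinj : Function.Injective p) (k : ι → ℕ) (e : ℕ) (he : 0 < e)
    (hediv : e ∣ Fintype.card L - 1)
    (hk : ∀ l : ℕ, l.Prime → l ∣ e → ∃ i, ¬ l ∣ k i) :
    ∃ B : ℝ, 0 ≤ B ∧ ∀ (E : Type) [Field E] [Fintype E] [DecidableEq E] [DecidableEq L]
      [Algebra L E] (u : E) (v : L),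
      ((Finset.univ.filter fun x : E => (aeval x (∏ i, p i ^ k i)) ^ ((Fintype.card E - 1) / e) = u
        ∧ Algebra.trace L E x = v).card : ℝ) ≤
      (Fintype.card E : ℝ) / (Fintype.card L * e) + B * Real.sqrt (Fintype.card E) := by
  classical
  set Q := Fintype.card L with hQ
  set h0 := ∏ i, p i ^ k i with hh0
  have hh0m : h0.Monic := monic_prod_of_monic _ _ fun i _ => (hmon i).pow _
  obtain ⟨B, hB0, hB⟩ := stepanov (h0.natDegree * Q) e he
  refine ⟨B, hB0, ?_⟩
  intro E _ _ _ _ _ u v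
  have hQ1 : 1 < Q := Fintype.one_lt_card
  obtain ⟨c, hc⟩ := Algebra.trace_surjective L E v
  set A : E[X] := X ^ Q - X + C c with hA
  have hAd : derivative A = -1 := by
    have h1 : (Q : E) = 0 := by
      have : ((Q : L) : L) = 0 := Nat.cast_card_eq_zero L
      rw [← map_natCast (algebraMap L E), this, map_zero]
    rw [hA, derivative_add, derivative_sub, derivative_X_pow, h1]
    simp
  have hXQ : (X ^ Q - X : E[X]).natDegree = Q := FiniteField.X_pow_card_sub_X_natDegree_eq E hQ1
  have hAdeg : A.natDegree = Q := by rw [hA, natDegree_add_C, hXQ]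
  have hAm : A.Monic := by
    rw [hA, sub_add]
    refine monic_X_pow_sub ?_
    exact (degree_X_sub_C_le _).trans_lt (by exact_mod_cast hQ1)
  set H : E[X] := (∏ i, (p i).map (algebraMap L E) ^ k i).comp A with hH
  have hHeq : H = (h0.map (algebraMap L E)).comp A := by
    rw [hH, hh0, Polynomial.map_prod]; simp
  have hHm : H.Monic := by
    rw [hHeq]
    exact (hh0m.map _).comp hAm (by omega)
  have hHd : H.natDegree = h0.natDegree * Q := by
    rw [hHeq, natDegree_comp, natDegree_map, hAdeg]
  have hND : NonDeg H e := by
    refine nonDeg_comp _ ?_ ?_ ?_ k e hk A hAd (by omega)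
    · intro i
      exact (PerfectField.separable_of_irreducible (hirr i)).map
    · intro i
      rw [natDegree_map]
      exact (hirr i).natDegree_pos
    · intro i j hij
      refine IsCoprime.map ?_ (mapRingHom (algebraMap L E))
      refine ((hirr i).coprime_iff_not_dvd).2 fun hd => hij (hinj ?_)
      exact eq_of_monic_of_associated (hmon i) (hmon j) ((hirr i).associated_of_dvd (hirr j) hd)
  have hst := hB E H (hediv.trans (card_sub_one_dvd L E)) hHm hHd hND u
  set M := (Fintype.card E - 1) / e with hM
  set S := Finset.univ.filter fun x : E => (aeval x h0) ^ M = u ∧ Algebra.trace L E x = v with hS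
  set Z := Finset.univ.filter fun z : E => H.eval z ^ M = u with hZ
  have hcard : S.card * Q ≤ Z.card := by
    have hex : ∀ x : E, ∃ z : E, Algebra.trace L E x = v → z ^ Q - z + c = x := by
      intro x
      by_cases hx : Algebra.trace L E x = v
      · obtain ⟨z, hz⟩ := exists_artin_schreier (L := L) (x - c) (by rw [map_sub, hx, hc, sub_self])
        exact ⟨z, fun _ => by rw [hz]; ring⟩
      · exact ⟨0, fun h => absurd h hx⟩
    choose g hg using hex
    have hfib : ∀ (x : E) (w : L), Algebra.trace L E x = v →
        (g x + algebraMap L E w) ^ Q - (g x + algebraMap L E w) + c = x := by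
      intro x w hx
      have h1 : (g x + algebraMap L E w) ^ Q = g x ^ Q + algebraMap L E w := by
        have h2 := map_add (FiniteField.frobeniusAlgHom L E) (g x) (algebraMap L E w)
        simp only [FiniteField.coe_frobeniusAlgHom] at h2
        rw [h2, ← map_pow, FiniteField.pow_card]
      rw [h1]
      nth_rewrite 3 [← hg x hx]
      ring
    have h1 : S.card * Q = (S ×ˢ (Finset.univ : Finset L)).card := by
      rw [Finset.card_product, Finset.card_univ]
    rw [h1]
    refine Finset.card_le_card_of_injOn (fun xw => g xw.1 + algebraMap L E xw.2) ?_ ?_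
    · rintro ⟨x, w⟩ hxw
      rw [Finset.mem_coe, Finset.mem_product, hS, Finset.mem_filter] at hxw
      obtain ⟨⟨_, hx1, hx2⟩, _⟩ := hxw
      rw [Finset.mem_coe, hZ, Finset.mem_filter]
      refine ⟨Finset.mem_univ _, ?_⟩
      rw [hHeq, eval_comp, hA]
      simp only [eval_add, eval_sub, eval_pow, eval_X, eval_C]
      rw [hfib x w hx2, eval_map_algebraMap]
      exact hx1
    · rintro ⟨x, w⟩ hxw ⟨x', w'⟩ hxw' heq
      rw [Finset.mem_coe, Finset.mem_product, hS, Finset.mem_filter] at hxw hxw'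
      simp only at heq
      have e1 := hfib x w hxw.1.2.2
      have e2 := hfib x' w' hxw'.1.2.2
      rw [heq, e2] at e1
      subst e1
      have := (algebraMap L E).injective (add_left_cancel heq)
      rw [this]
  have hQpos : (0 : ℝ) < Q := by exact_mod_cast Fintype.card_pos
  have hepos : (0 : ℝ) < e := by exact_mod_cast he
  have h2 : (S.card : ℝ) * Q ≤ Fintype.card E / e + B * Real.sqrt (Fintype.card E) := by
    refine le_trans ?_ hst
    exact_mod_cast hcard
  have h3 : (S.card : ℝ) ≤ (Fintype.card E / e + B * Real.sqrt (Fintype.card E)) / Q := by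
    rwa [le_div_iff₀ hQpos]
  refine h3.trans ?_
  rw [add_div, div_div, mul_comm (e : ℝ)]
  gcongr
  apply div_le_self (by positivity)
  exact_mod_cast hQ1.le


theorem mulChar_norm_le_one {L : Type*} [Field L] [Fintype L] (χ : MulChar L ℂ) (x : L) :
    ‖χ x‖ ≤ 1 := by
  by_cases hx : x = 0
  · subst hx; rw [MulChar.map_zero]; simp
  · have h1 : (χ x) ^ (Fintype.card L - 1) = 1 := by
      rw [← map_pow, FiniteField.pow_card_sub_one_eq_one x hx, map_one]
    refine (Complex.norm_eq_one_of_pow_eq_one h1 ?_).le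
    have := Fintype.one_lt_card (α := L)
    omega

/-- The character sum over the extension field `E`. -/
noncomputable def charSum {L : Type} [Field L] [Fintype L] {ι : Type} [Fintype ι]
    (p : ι → L[X]) (χ : ι → MulChar L ℂ) (ψ : AddChar L ℂ) (E : Type) [Field E] [Fintype E]
    [Algebra L E] : ℂ :=
  ∑ x : E, (∏ i, χ i (Algebra.norm L (aeval x (p i)))) * ψ (Algebra.trace L E x)

theorem exists_generator (L : Type) [Field L] [Fintype L] {ι : Type} [Fintype ι]
    (χ : ι → MulChar L ℂ) : ∃ (ω : MulChar L ℂ) (j : ι → ℕ), ∀ i, 0 < j i ∧ χ i = ω ^ j i := by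
  classical
  obtain ⟨eqv⟩ := MulChar.mulEquiv_units L ℂ
  have : IsCyclic (MulChar L ℂ) := isCyclic_of_surjective eqv.symm eqv.symm.surjective
  obtain ⟨ω, hω⟩ := IsCyclic.exists_generator (α := MulChar L ℂ)
  have : ∀ i, ∃ j : ℕ, 0 < j ∧ χ i = ω ^ j := by
    intro i
    have h1 : χ i ∈ Submonoid.powers ω := by
      rw [mem_powers_iff_mem_zpowers]; exact hω _
    obtain ⟨j, hj⟩ := h1
    refine ⟨j + orderOf ω, ?_, ?_⟩
    · have := orderOf_pos ω
      omega
    · rw [pow_add, pow_orderOf_eq_one, mul_one]; exact hj.symm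
  choose j hj using this
  exact ⟨ω, j, hj⟩

theorem charSum_bound (L : Type) [Field L] [Fintype L] {ι : Type} [Fintype ι]
    (p : ι → L[X]) (hirr : ∀ i, Irreducible (p i)) (hmon : ∀ i, (p i).Monic)
    (hinj : Function.Injective p) (χ : ι → MulChar L ℂ) (ψ : AddChar L ℂ) (hχ : ∃ i, χ i ≠ 1) :
    ∃ B : ℝ, 0 ≤ B ∧ ∀ (E : Type) [Field E] [Fintype E] [Algebra L E],
      ‖charSum p χ ψ E‖ ≤ B * Real.sqrt (Fintype.card E) := by
  classical
  obtain ⟨ω, j, hj⟩ := exists_generator L χ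
  set Q := Fintype.card L with hQ
  have hQ1 : 1 < Q := Fintype.one_lt_card
  set G := Nat.gcd (Q - 1) (Finset.univ.gcd j) with hG
  have hGQ : G ∣ Q - 1 := Nat.gcd_dvd_left _ _
  have hGj : ∀ i, G ∣ j i := fun i =>
    (Nat.gcd_dvd_right _ _).trans (Finset.gcd_dvd (Finset.mem_univ i))
  have hGpos : 0 < G := Nat.gcd_pos_of_pos_left _ (by omega)
  set e := (Q - 1) / G with he
  have heG : e * G = Q - 1 := Nat.div_mul_cancel hGQ
  have hepos : 0 < e := Nat.pos_of_ne_zero (by rintro h; rw [h] at heG; omega)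
  set k : ι → ℕ := fun i => j i / G with hk
  have hkG : ∀ i, k i * G = j i := fun i => Nat.div_mul_cancel (hGj i)
  have hkl : ∀ l : ℕ, l.Prime → l ∣ e → ∃ i, ¬ l ∣ k i := by
    intro l hl hle
    by_contra hcon
    push Not at hcon
    have h1 : l * G ∣ G := by
      conv_rhs => rw [hG]
      refine Nat.dvd_gcd ?_ (Finset.dvd_gcd fun i _ => ?_)
      · rw [← heG]; exact mul_dvd_mul_right hle G
      · rw [← hkG]; exact mul_dvd_mul_right (hcon i) G
    have h2 := Nat.le_of_dvd hGpos h1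
    have h3 := hl.two_le
    nlinarith
  obtain ⟨B, hB0, hB⟩ := count_bound L p hirr hmon hinj k e hepos ⟨G, heG.symm⟩ hkl
  set h0 := ∏ i, p i ^ k i with hh0
  have hh0m : h0.Monic := monic_prod_of_monic _ _ fun i _ => (hmon i).pow _
  refine ⟨e * Q * B + h0.natDegree, by positivity, ?_⟩
  intro E _ _ _
  -- rewriting the summand
  have hterm : ∀ x : E, (∏ i, χ i (Algebra.norm L (aeval x (p i)))) =
      ω (Algebra.norm L (aeval x h0) ^ G) := by
    intro x
    rw [hh0, map_prod, map_prod, ← Finset.prod_pow, map_prod]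
    refine Finset.prod_congr rfl fun i _ => ?_
    rw [(hj i).2, MulChar.pow_apply' _ (hj i).1.ne', map_pow, map_pow, map_pow, map_pow,
      ← pow_mul, hkG]
  set t : E → L := fun x => Algebra.norm L (aeval x h0) ^ G with ht
  set U : Finset L := Finset.univ.filter fun u => u ^ e = 1 with hU
  have hUcard : U.card ≤ e := by
    have : U ⊆ (nthRoots e (1 : L)).toFinset := by
      intro u hu
      rw [Multiset.mem_toFinset, mem_nthRoots hepos]
      exact (Finset.mem_filter.1 hu).2
    exact (Finset.card_le_card this).trans ((Multiset.toFinset_card_le _).trans (card_nthRoots _ _))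
  have htU : ∀ x : E, aeval x h0 ≠ 0 → t x ∈ U := by
    intro x hx
    rw [hU, Finset.mem_filter]
    refine ⟨Finset.mem_univ _, ?_⟩
    rw [ht]; simp only
    rw [← pow_mul, mul_comm, heG]
    exact FiniteField.pow_card_sub_one_eq_one _ (Algebra.norm_ne_zero_iff.2 hx)
  have ht0 : ∀ x : E, t x ∉ U → t x = 0 := by
    intro x hx
    have : aeval x h0 = 0 := by
      by_contra h
      exact hx (htU x h)
    rw [ht]; simp only
    rw [this, Algebra.norm_zero, zero_pow hGpos.ne']
  have hωsum : ∑ u ∈ U, ω u = 0 := by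
    obtain ⟨i, hi⟩ := hχ
    obtain ⟨a, ha⟩ : ∃ a : Lˣ, χ i a ≠ 1 := by
      by_contra hcon
      push Not at hcon
      exact hi (MulChar.ext fun a => by rw [hcon a, MulChar.one_apply_coe])
    have ha2 : ω ((a : L) ^ G) ≠ 1 := by
      intro h
      apply ha
      rw [(hj i).2, MulChar.pow_apply' _ (hj i).1.ne', ← hkG, mul_comm, pow_mul, ← map_pow, h,
        one_pow]
    have hae : ((a : L) ^ G) ^ e = 1 := by
      rw [← pow_mul, mul_comm, heG]
      exact FiniteField.pow_card_sub_one_eq_one _ a.ne_zero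
    have hane : (a : L) ^ G ≠ 0 := pow_ne_zero _ a.ne_zero
    have h1 : ω ((a : L) ^ G) * ∑ u ∈ U, ω u = ∑ u ∈ U, ω u := by
      rw [Finset.mul_sum]
      refine Finset.sum_bij' (fun u _ => (a : L) ^ G * u) (fun u _ => ((a : L) ^ G)⁻¹ * u)
        ?_ ?_ ?_ ?_ ?_
      · intro u hu
        rw [hU, Finset.mem_filter] at hu ⊢
        exact ⟨Finset.mem_univ _, by rw [mul_pow, hae, hu.2, one_mul]⟩
      · intro u hu
        rw [hU, Finset.mem_filter] at hu ⊢
        exact ⟨Finset.mem_univ _, by rw [mul_pow, inv_pow, hae, hu.2]; simp⟩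
      · intro u _; field_simp
      · intro u _; field_simp
      · intro u _; rw [map_mul]
    have h2 : (ω ((a : L) ^ G) - 1) * ∑ u ∈ U, ω u = 0 := by rw [sub_mul, h1]; ring
    exact (mul_eq_zero.1 h2).resolve_left (sub_ne_zero.2 ha2)
  set N : L × L → ℕ := fun uv => (Finset.univ.filter fun x : E =>
    (t x, Algebra.trace L E x) = uv).card with hN
  have hS : charSum p χ ψ E = ∑ uv ∈ U ×ˢ (Finset.univ : Finset L),
      (N uv : ℂ) * (ω uv.1 * ψ uv.2) := by
    unfold charSum
    have h1 : ∀ x : E, (∏ i, χ i (Algebra.norm L (aeval x (p i)))) * ψ (Algebra.trace L E x) =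
       (fun uv : L × L => ω uv.1 * ψ uv.2) (t x, Algebra.trace L E x) := by
      intro x; simp only; rw [hterm]
    rw [Finset.sum_congr rfl fun x _ => h1 x]
    rw [← Finset.sum_filter_add_sum_filter_not Finset.univ (fun x : E => t x ∈ U)]
    rw [Finset.sum_eq_zero (s := Finset.univ.filter fun x : E => ¬ t x ∈ U), add_zero]
    · rw [← Finset.sum_fiberwise_of_maps_to (t := U ×ˢ (Finset.univ : Finset L))
        (g := fun x : E => (t x, Algebra.trace L E x))]
      · refine Finset.sum_congr rfl fun uv huv => ?_
        rw [Finset.sum_congr rfl (g := fun _ => ω uv.1 * ψ uv.2), Finset.sum_const, nsmul_eq_mul]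
        · congr 2
          rw [hN]; simp only
          congr 1
          ext x
          simp only [Finset.mem_filter, Finset.mem_univ, true_and]
          constructor
          · exact fun h => h.2
          · intro h
            refine ⟨?_, h⟩
            have := (Finset.mem_product.1 huv).1
            rw [← h] at this
            exact this
        · intro x hx
          rw [(Finset.mem_filter.1 hx).2]
      · intro x hx
        rw [Finset.mem_product]
        exact ⟨(Finset.mem_filter.1 hx).2, Finset.mem_univ _⟩
    · intro x hx
      simp only
      rw [ht0 x (Finset.mem_filter.1 hx).2, MulChar.map_zero, zero_mul]
  set A : ℝ := (Fintype.card E : ℝ) / (Q * e) + B * Real.sqrt (Fintype.card E) with hA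
  have hNA : ∀ uv, (N uv : ℝ) ≤ A := by
    rintro ⟨u, v⟩
    refine le_trans ?_ (hB E (algebraMap L E u) v)
    refine le_of_eq ?_
    rw [hN]; simp only
    congr 2
    ext x
    simp only [Finset.mem_filter, Finset.mem_univ, true_and, Prod.mk.injEq]
    refine and_congr_left fun _ => ?_
    rw [← (algebraMap L E).injective.eq_iff, ht]
    simp only
    rw [map_pow, FiniteField.algebraMap_norm_eq_pow, ← pow_mul]
    obtain ⟨r, hr⟩ := card_sub_one_dvd L E
    have h1 : (Nat.card E - 1) / (Nat.card L - 1) * G = (Fintype.card E - 1) / e := by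
      rw [Nat.card_eq_fintype_card, Nat.card_eq_fintype_card, hr, ← hQ,
        Nat.mul_div_cancel_left _ (by omega), ← heG]
      rw [mul_assoc, Nat.mul_div_cancel_left _ hepos, mul_comm]
    rw [h1]
  have hNsum : (Fintype.card E : ℝ) - h0.natDegree ≤
      ∑ uv ∈ U ×ˢ (Finset.univ : Finset L), (N uv : ℝ) := by
    have h1 : ∑ uv ∈ U ×ˢ (Finset.univ : Finset L), N uv =
        (Finset.univ.filter fun x : E => t x ∈ U).card := by
      rw [Finset.card_eq_sum_card_fiberwise (t := U ×ˢ (Finset.univ : Finset L))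
        (f := fun x : E => (t x, Algebra.trace L E x))]
      · refine Finset.sum_congr rfl fun uv huv => ?_
        rw [hN]; simp only
        congr 1
        ext x
        simp only [Finset.mem_filter, Finset.mem_univ, true_and]
        constructor
        · intro h
          refine ⟨?_, h⟩
          have := (Finset.mem_product.1 huv).1
          rw [← h] at this
          exact this
        · exact fun h => h.2
      · intro x hx
        rw [Finset.mem_coe, Finset.mem_product]
        exact ⟨(Finset.mem_filter.1 hx).2, Finset.mem_univ _⟩
    have h2 : (Finset.univ.filter fun x : E => ¬ t x ∈ U).card ≤ h0.natDegree := by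
      have : (Finset.univ.filter fun x : E => ¬ t x ∈ U) ⊆ (h0.aroots E).toFinset := by
        intro x hx
        rw [Multiset.mem_toFinset, mem_aroots]
        refine ⟨hh0m.ne_zero, ?_⟩
        by_contra h
        exact (Finset.mem_filter.1 hx).2 (htU x h)
      refine (Finset.card_le_card this).trans ((Multiset.toFinset_card_le _).trans ?_)
      refine (card_roots' _).trans ?_
      rw [natDegree_map]
    have h3 := Finset.card_filter_add_card_filter_not (s := (Finset.univ : Finset E)) (fun x : E => t x ∈ U)
    rw [Finset.card_univ] at h3
    rw [sub_le_iff_le_add]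
    rw [← h1] at h3
    rw [← h3]
    push_cast
    gcongr
  have hzero : ∑ uv ∈ U ×ˢ (Finset.univ : Finset L), (A : ℂ) * (ω uv.1 * ψ uv.2) = 0 := by
    rw [← Finset.mul_sum, Finset.sum_product]
    simp only [← Finset.mul_sum]
    rw [← Finset.sum_mul, hωsum]; simp
  have hS2 : charSum p χ ψ E = ∑ uv ∈ U ×ˢ (Finset.univ : Finset L),
      (((N uv : ℝ) - A : ℝ) : ℂ) * (ω uv.1 * ψ uv.2) := by
    rw [hS, ← sub_zero (∑ uv ∈ U ×ˢ (Finset.univ : Finset L), _), ← hzero, ← Finset.sum_sub_distrib]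
    refine Finset.sum_congr rfl fun uv _ => ?_
    push_cast; ring
  have hQpos : (0 : ℝ) < Q := by exact_mod_cast (by omega : 0 < Q)
  have heR : (0 : ℝ) < e := by exact_mod_cast hepos
  have hA0 : 0 ≤ A := by positivity
  have hs1 : 1 ≤ Real.sqrt (Fintype.card E) := by
    rw [Real.one_le_sqrt]; exact_mod_cast Fintype.card_pos
  calc ‖charSum p χ ψ E‖ ≤ ∑ uv ∈ U ×ˢ (Finset.univ : Finset L), (A - N uv) := by
        rw [hS2]
        refine norm_sum_le_of_le _ fun uv _ => ?_
        rw [norm_mul, norm_mul, AddChar.norm_apply, mul_one, Complex.norm_real, Real.norm_eq_abs,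
          abs_sub_comm, abs_of_nonneg (sub_nonneg.2 (hNA uv))]
        exact mul_le_of_le_one_right (sub_nonneg.2 (hNA uv)) (mulChar_norm_le_one _ _)
    _ = U.card * Q * A - ∑ uv ∈ U ×ˢ (Finset.univ : Finset L), (N uv : ℝ) := by
        rw [Finset.sum_sub_distrib, Finset.sum_const, Finset.card_product, Finset.card_univ,
          nsmul_eq_mul]
        push_cast; rfl
    _ ≤ e * Q * A - (Fintype.card E - h0.natDegree) := by
        gcongr
    _ = e * Q * B * Real.sqrt (Fintype.card E) + h0.natDegree := by
        rw [hA]; field_simp; ring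
    _ ≤ (e * Q * B + h0.natDegree) * Real.sqrt (Fintype.card E) := by
        rw [add_mul]
        gcongr
        exact le_mul_of_one_le_right (by positivity) hs1


theorem norm_aeval_gen {L S : Type} [Field L] [Finite L] [Field S] [Algebra L S]
    [FiniteDimensional L S] (pb : PowerBasis L S) (h : L[X]) :
    algebraMap L (AlgebraicClosure L) (Algebra.norm L (aeval pb.gen h)) =
      (((minpoly L pb.gen).aroots (AlgebraicClosure L)).map fun z => aeval z h).prod := by
  classical
  set Ω := AlgebraicClosure L
  have hsep : (minpoly L pb.gen).Separable :=
    PerfectField.separable_of_irreducible (minpoly.irreducible pb.isIntegral_gen)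
  rw [Algebra.norm_eq_prod_embeddings]
  have h1 : ∀ σ : S →ₐ[L] Ω, σ (aeval pb.gen h) = aeval (σ pb.gen) h := fun σ => by
    rw [aeval_algHom_apply]
  simp only [h1]
  rw [Fintype.prod_equiv pb.liftEquiv' _ fun x => aeval x.1 h]
  · rw [Finset.prod_mem_multiset _ (fun x => aeval x.1 h) (fun z => aeval z h) fun x => rfl]
    rw [Finset.prod_eq_multiset_prod, Multiset.toFinset_val, Multiset.dedup_eq_self.mpr]
    exact nodup_roots hsep.map
  · intro σ; simp

/-- the normalised resultant of `h` and `P`. -/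
noncomputable def resN {L : Type} [Field L] (P : L[X]) (h : L[X]) : L :=
  (-1) ^ (h.natDegree * P.natDegree) * Algebra.norm L (AdjoinRoot.mk P h)

theorem norm_mk {L : Type} [Field L] [Finite L] {P : L[X]} (hP : Irreducible P) (hm : P.Monic)
    (h : L[X]) : algebraMap L (AlgebraicClosure L) (Algebra.norm L (AdjoinRoot.mk P h)) =
      ((P.aroots (AlgebraicClosure L)).map fun z => aeval z h).prod := by
  have : Fact (Irreducible P) := ⟨hP⟩
  have : FiniteDimensional L (AdjoinRoot P) := (AdjoinRoot.powerBasis hP.ne_zero).finite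
  have h1 := norm_aeval_gen (AdjoinRoot.powerBasis hP.ne_zero) h
  rw [AdjoinRoot.powerBasis_gen, AdjoinRoot.aeval_eq, AdjoinRoot.minpoly_root hP.ne_zero,
    hm.leadingCoeff, inv_one, C_1, mul_one] at h1
  exact h1

theorem aeval_eq_prod_roots {L : Type} [Field L] {P : L[X]} (hm : P.Monic)
    (y : AlgebraicClosure L) :
    aeval y P = ((P.aroots (AlgebraicClosure L)).map fun z => y - z).prod := by
  have h1 := (IsAlgClosed.splits (P.map (algebraMap L (AlgebraicClosure L)))).eq_prod_roots
  rw [(hm.map _).leadingCoeff, C_1, one_mul] at h1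
  rw [← eval_map_algebraMap, h1, eval_multiset_prod, Multiset.map_map]
  congr 1
  simp [aroots_def]

theorem resN_eq {L : Type} [Field L] [Finite L] {P : L[X]} (hP : Irreducible P) (hm : P.Monic)
    {h : L[X]} (hh : h.Monic) :
    algebraMap L (AlgebraicClosure L) (resN P h) =
      ((h.aroots (AlgebraicClosure L)).map fun y => aeval y P).prod := by
  unfold resN
  rw [map_mul, norm_mk hP hm]
  simp only [aeval_eq_prod_roots hm, aeval_eq_prod_roots hh]
  rw [Multiset.prod_map_prod_map]
  have hc : ∀ f : L[X], Multiset.card (f.aroots (AlgebraicClosure L)) = f.natDegree := by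
    intro f
    rw [aroots_def, ← natDegree_map (algebraMap L (AlgebraicClosure L)) (p := f)]
    exact (IsAlgClosed.splits _).natDegree_eq_card_roots.symm
  have h2 : ∀ y : AlgebraicClosure L, (Multiset.map (fun z => y - z) (P.aroots (AlgebraicClosure L))).prod
     = (-1) ^ P.natDegree * (Multiset.map (fun z => z - y) (P.aroots (AlgebraicClosure L))).prod := by
    intro y
    rw [← hc P, ← Multiset.prod_replicate, ← Multiset.map_const', ← Multiset.prod_map_mul]
    simp
  simp only [h2]
  rw [Multiset.prod_map_mul, Multiset.map_const', Multiset.prod_replicate, hc, ← pow_mul]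
  simp [mul_comm]

theorem norm_aeval_eq {L E : Type} [Field L] [Fintype L] [Field E] [Fintype E] [Algebra L E]
    {P : L[X]} (hP : Irreducible P) (hm : P.Monic) (x : E) :
    Algebra.norm L (aeval x P) =
      (resN P (minpoly L x)) ^ (Module.finrank L E / (minpoly L x).natDegree) := by
  have hx : IsIntegral L x := .of_finite L x
  set K := IntermediateField.adjoin L {x} with hK
  set pb := IntermediateField.adjoin.powerBasis hx with hpb
  have h1 : aeval x P = algebraMap K E (aeval pb.gen P) := by
    rw [← aeval_algebraMap_apply]
    congr 1
  have hdeg : Module.finrank L K = (minpoly L x).natDegree :=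
    IntermediateField.adjoin.finrank hx
  have hpos : 0 < Module.finrank L K := Module.finrank_pos
  have h2 : Module.finrank L E / (minpoly L x).natDegree = Module.finrank K E := by
    rw [← Module.finrank_mul_finrank L K E, hdeg, Nat.mul_div_cancel_left]
    rw [← hdeg]; exact hpos
  rw [h1, ← Algebra.norm_norm (R := L) (S := K), Algebra.norm_algebraMap, map_pow, h2]
  congr 1
  apply (algebraMap L (AlgebraicClosure L)).injective
  rw [norm_aeval_gen, resN_eq hP hm (minpoly.monic hx)]
  rw [hpb, IntermediateField.adjoin.powerBasis_gen, IntermediateField.minpoly_gen]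

theorem trace_eq_nextCoeff {L E : Type} [Field L] [Fintype L] [Field E] [Fintype E] [Algebra L E]
    (x : E) : Algebra.trace L E x =
      (Module.finrank L E / (minpoly L x).natDegree) • (- (minpoly L x).nextCoeff) := by
  have hx : IsIntegral L x := .of_finite L x
  set K := IntermediateField.adjoin L {x} with hK
  have hdeg : Module.finrank L K = (minpoly L x).natDegree :=
    IntermediateField.adjoin.finrank hx
  have hpos : 0 < Module.finrank L K := Module.finrank_pos
  have h2 : Module.finrank L E / (minpoly L x).natDegree = Module.finrank K E := by
    rw [← Module.finrank_mul_finrank L K E, hdeg, Nat.mul_div_cancel_left]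
    rw [← hdeg]; exact hpos
  rw [h2, trace_eq_trace_adjoin]
  congr 1
  have h3 := (IntermediateField.adjoin.powerBasis hx).trace_gen_eq_nextCoeff_minpoly
  rw [IntermediateField.adjoin.powerBasis_gen, IntermediateField.minpoly_gen] at h3
  exact h3


noncomputable def Lam {L : Type} [Field L] {ι : Type} [Fintype ι]
    (p : ι → L[X]) (χ : ι → MulChar L ℂ) (ψ : AddChar L ℂ) (h : L[X]) : ℂ :=
  (∏ i, χ i (resN (p i) h)) * ψ (-h.nextCoeff)

theorem resN_mul {L : Type} [Field L] (P : L[X]) {h k : L[X]} (hh : h.Monic) (hk : k.Monic) :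
    resN P (h * k) = resN P h * resN P k := by
  unfold resN
  rw [hh.natDegree_mul hk, map_mul, map_mul, add_mul, pow_add]
  ring

theorem resN_one {L : Type} [Field L] (P : L[X]) : resN P 1 = 1 := by
  unfold resN
  simp

theorem Lam_mul {L : Type} [Field L] {ι : Type} [Fintype ι]
    (p : ι → L[X]) (χ : ι → MulChar L ℂ) (ψ : AddChar L ℂ) {h k : L[X]} (hh : h.Monic)
    (hk : k.Monic) : Lam p χ ψ (h * k) = Lam p χ ψ h * Lam p χ ψ k := by
  unfold Lam
  simp only [resN_mul _ hh hk, map_mul, Finset.prod_mul_distrib]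
  rw [hh.nextCoeff_mul hk, neg_add, AddChar.map_add_eq_mul]
  ring

theorem Lam_one {L : Type} [Field L] {ι : Type} [Fintype ι]
    (p : ι → L[X]) (χ : ι → MulChar L ℂ) (ψ : AddChar L ℂ) : Lam p χ ψ 1 = 1 := by
  unfold Lam
  simp [resN_one, nextCoeff]

theorem Lam_pow {L : Type} [Field L] {ι : Type} [Fintype ι]
    (p : ι → L[X]) (χ : ι → MulChar L ℂ) (ψ : AddChar L ℂ) {h : L[X]} (hh : h.Monic) (k : ℕ) :
    Lam p χ ψ (h ^ k) = Lam p χ ψ h ^ k := by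
  induction k with
  | zero => simp [Lam_one]
  | succ k ih => rw [pow_succ, Lam_mul _ _ _ (hh.pow k) hh, ih, pow_succ]

theorem charSum_eq {L : Type} [Field L] [Fintype L] {ι : Type} [Fintype ι]
    (p : ι → L[X]) (hirr : ∀ i, Irreducible (p i)) (hmon : ∀ i, (p i).Monic)
    (χ : ι → MulChar L ℂ) (ψ : AddChar L ℂ) (E : Type) [Field E] [Fintype E]
    [Algebra L E] : charSum p χ ψ E =
      ∑ x : E, Lam p χ ψ (minpoly L x) ^ (Module.finrank L E / (minpoly L x).natDegree) := by
  unfold charSum Lam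
  refine Finset.sum_congr rfl fun x _ => ?_
  rw [mul_pow, ← Finset.prod_pow, trace_eq_nextCoeff, AddChar.map_nsmul_eq_pow]
  congr 1
  refine Finset.prod_congr rfl fun i _ => ?_
  rw [norm_aeval_eq (hirr i) (hmon i), map_pow]

theorem finite_monics (L : Type) [Field L] [Finite L] (d : ℕ) :
    {h : L[X] | h.Monic ∧ h.natDegree = d}.Finite := by
  have h1 : Finite (degreeLT L (d + 1)) := Finite.of_equiv _ (degreeLTEquiv L (d + 1)).symm.toEquiv
  have h2 : (degreeLT L (d + 1) : Set L[X]).Finite := Set.toFinite _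
  refine h2.subset ?_
  rintro h ⟨hm, hd⟩
  rw [SetLike.mem_coe, mem_degreeLT, hm.ne_zero |> degree_eq_natDegree, hd]
  exact_mod_cast Nat.lt_succ_self d

noncomputable def monics (L : Type) [Field L] [Finite L] (d : ℕ) : Finset L[X] :=
  (finite_monics L d).toFinset

theorem mem_monics {L : Type} [Field L] [Finite L] {d : ℕ} {h : L[X]} :
    h ∈ monics L d ↔ h.Monic ∧ h.natDegree = d := by
  simp [monics]

open Classical in
/-- monic irreducible polynomials of degree at most `d` -/
noncomputable def irrs (L : Type) [Field L] [Finite L] (d : ℕ) : Finset L[X] :=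
  ((Finset.range (d + 1)).biUnion (monics L)).filter Irreducible

theorem mem_irrs {L : Type} [Field L] [Finite L] {d : ℕ} {h : L[X]} :
    h ∈ irrs L d ↔ h.Monic ∧ h.natDegree ≤ d ∧ Irreducible h := by
  simp [irrs, mem_monics]
  grind

noncomputable def Acoef {L : Type} [Field L] [Finite L] {ι : Type} [Fintype ι]
    (p : ι → L[X]) (χ : ι → MulChar L ℂ) (ψ : AddChar L ℂ) (d : ℕ) : ℂ :=
  ∑ h ∈ monics L d, Lam p χ ψ h

theorem Acoef_zero {L : Type} [Field L] [Finite L] {ι : Type} [Fintype ι]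
    (p : ι → L[X]) (χ : ι → MulChar L ℂ) (ψ : AddChar L ℂ) : Acoef p χ ψ 0 = 1 := by
  have : monics L 0 = {1} := by
    ext h
    rw [mem_monics, Finset.mem_singleton]
    constructor
    · rintro ⟨h1, h2⟩
      exact h1.natDegree_eq_zero.1 h2
    · rintro rfl; simp
  rw [Acoef, this, Finset.sum_singleton, Lam_one]

theorem Acoef_eq_zero {L : Type} [Field L] [Finite L] {ι : Type} [Fintype ι]
    (p : ι → L[X]) (hirr : ∀ i, Irreducible (p i)) (hmon : ∀ i, (p i).Monic)
    (hinj : Function.Injective p) (χ : ι → MulChar L ℂ) (ψ : AddChar L ℂ) (hχ : ∃ i, χ i ≠ 1)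
    (d : ℕ) (hd : ∑ i, (p i).natDegree < d) : Acoef p χ ψ d = 0 := by
  classical
  obtain ⟨i, hi⟩ := hχ
  set R := ∏ i, p i with hR
  have hRm : R.Monic := monic_prod_of_monic _ _ fun i _ => hmon i
  have hRd : R.natDegree = ∑ i, (p i).natDegree := natDegree_prod_of_monic _ _ fun i _ => hmon i
  have hcop : Pairwise fun i j => IsCoprime (p i) (p j) := by
    intro i j hij
    refine ((hirr i).coprime_iff_not_dvd).2 fun hd => hij (hinj ?_)
    exact eq_of_monic_of_associated (hmon i) (hmon j) ((hirr i).associated_of_dvd (hirr j) hd)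
  obtain ⟨a, ha⟩ : ∃ a : Lˣ, χ i a ≠ 1 := by
    by_contra hcon
    push Not at hcon
    exact hi (MulChar.ext fun a => by rw [hcon a, MulChar.one_apply_coe])
  have hfact : ∀ i, Fact (Irreducible (p i)) := fun i => ⟨hirr i⟩
  have hfd : ∀ i, FiniteDimensional L (AdjoinRoot (p i)) :=
    fun i => (AdjoinRoot.powerBasis (hirr i).ne_zero).finite
  have hfin : ∀ i, Finite (AdjoinRoot (p i)) := fun i => Module.finite_of_finite L
  obtain ⟨τ, hτ⟩ := FiniteField.norm_surjective L (AdjoinRoot (p i)) (a : L)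
  obtain ⟨t1, rfl⟩ := AdjoinRoot.mk_surjective τ
  obtain ⟨t0, ht0i, ht0j⟩ : ∃ t0 : L[X], p i ∣ t0 - t1 ∧ ∀ j, j ≠ i → p j ∣ t0 - 1 := by
    have hc : IsCoprime (p i) (∏ j ∈ Finset.univ.erase i, p j) :=
      IsCoprime.prod_right fun j hj => hcop (Finset.ne_of_mem_erase hj).symm
    obtain ⟨u, v, huv⟩ := hc
    refine ⟨1 + (t1 - 1) * (v * ∏ j ∈ Finset.univ.erase i, p j), ⟨(1 - t1) * u, ?_⟩, ?_⟩
    · linear_combination (t1 - 1) * huv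
    · intro j hj
      rw [add_sub_cancel_left]
      exact ((Finset.dvd_prod_of_mem p (Finset.mem_erase.2 ⟨hj, Finset.mem_univ _⟩)).mul_left
        _).mul_left _
  have hmk : ∀ j, AdjoinRoot.mk (p j) t0 = if j = i then AdjoinRoot.mk (p j) t1 else 1 := by
    intro j
    split_ifs with h
    · subst h
      exact AdjoinRoot.mk_eq_mk.2 ht0i
    · rw [← map_one (AdjoinRoot.mk (p j))]
      exact AdjoinRoot.mk_eq_mk.2 (ht0j j h)
  have hcopR : IsCoprime R t0 := by
    refine IsCoprime.prod_left fun j _ => ?_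
    refine ((hirr j).coprime_iff_not_dvd).2 fun hd => ?_
    have h1 := AdjoinRoot.mk_eq_zero.2 hd
    rw [hmk j] at h1
    split_ifs at h1 with h
    · subst h
      rw [h1, Algebra.norm_zero] at hτ
      exact a.ne_zero hτ.symm
    · exact one_ne_zero h1
  -- the permutation
  let Φ : L[X] → L[X] := fun h => R * (h /ₘ R) + (t0 * h) %ₘ R
  have hlt : ∀ f : L[X], (f %ₘ R).degree < R.degree := fun f => degree_modByMonic_lt _ hRm
  have hdiff : ∀ h, Φ h - h = (t0 * h) %ₘ R - h %ₘ R := by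
    intro h
    simp only [Φ]
    have := modByMonic_add_div h R
    linear_combination this
  have hdd : ∀ h, (Φ h - h).natDegree < R.natDegree ∨ R = 1 := by
    intro h
    by_cases hR1 : R = 1
    · right; exact hR1
    left
    rw [hdiff]
    refine (natDegree_sub_le _ _).trans_lt (max_lt ?_ ?_)
    · exact natDegree_modByMonic_lt _ hRm hR1
    · exact natDegree_modByMonic_lt _ hRm hR1
  have hR1 : R ≠ 1 := by
    intro h
    have h1 := hRd
    rw [h, natDegree_one] at h1
    have := Finset.single_le_sum (fun j _ => Nat.zero_le (p j).natDegree) (Finset.mem_univ i)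
    have := (hirr i).natDegree_pos
    omega
  have hdd : ∀ h, (Φ h - h).natDegree < R.natDegree := fun h => (hdd h).resolve_right hR1
  have hcoef : ∀ h j, R.natDegree ≤ j → (Φ h).coeff j = h.coeff j := by
    intro h j hj
    have : (Φ h - h).coeff j = 0 := coeff_eq_zero_of_natDegree_lt ((hdd h).trans_le hj)
    rw [coeff_sub] at this
    exact sub_eq_zero.1 this
  rw [← hRd] at hd
  have hΦmon : ∀ h ∈ monics L d, Φ h ∈ monics L d := by
    intro h hh
    rw [mem_monics] at hh ⊢
    obtain ⟨hm, hdeg⟩ := hh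
    have h1 : (Φ h).natDegree ≤ d := by
      rw [natDegree_le_iff_coeff_eq_zero]
      intro N hN
      rw [hcoef h N (by omega)]
      exact coeff_eq_zero_of_natDegree_lt (by omega)
    have h2 : (Φ h).coeff d = 1 := by
      rw [hcoef h d hd.le, ← hdeg]; exact hm
    exact ⟨monic_of_natDegree_le_of_coeff_eq_one d h1 h2,
      le_antisymm h1 (le_natDegree_of_ne_zero (by rw [h2]; exact one_ne_zero))⟩
  have hΦmod : ∀ h, R ∣ Φ h - t0 * h := by
    intro h
    refine ⟨h /ₘ R - (t0 * h) /ₘ R, ?_⟩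
    simp only [Φ]
    have := modByMonic_add_div (t0 * h) R
    linear_combination this
  have hΦinj : Set.InjOn Φ (monics L d) := by
    intro h1 hh1 h2 hh2 heq
    have e1 : R ∣ h1 - h2 := by
      have h3 : R ∣ t0 * (h1 - h2) := by
        have := dvd_sub (hΦmod h2) (hΦmod h1)
        rw [heq] at this
        convert this using 1
        ring
      exact hcopR.dvd_of_dvd_mul_left h3
    have e2 : h1 - h2 = 0 := by
      have h3 : (h1 - h2).natDegree < R.natDegree := by
        have : h1 - h2 = (Φ h2 - h2) - (Φ h1 - h1) := by rw [heq]; ring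
        rw [this]
        exact (natDegree_sub_le _ _).trans_lt (max_lt (hdd _) (hdd _))
      exact eq_zero_of_dvd_of_natDegree_lt e1 h3
    exact sub_eq_zero.1 e2
  have hΦsum : ∑ h ∈ monics L d, Lam p χ ψ (Φ h) = Acoef p χ ψ d := by
    have himg : (monics L d).image Φ = monics L d := by
      apply Finset.eq_of_subset_of_card_le
      · intro h hh
        obtain ⟨k, hk, rfl⟩ := Finset.mem_image.1 hh
        exact hΦmon k hk
      · rw [Finset.card_image_of_injOn hΦinj]
    rw [Acoef]
    conv_rhs => rw [← himg]
    rw [Finset.sum_image hΦinj]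
  have hLam : ∀ h ∈ monics L d, Lam p χ ψ (Φ h) = χ i a * Lam p χ ψ h := by
    intro h hh
    have h1 := mem_monics.1 (hΦmon h hh)
    have h2 := mem_monics.1 hh
    unfold Lam
    have hnc : (Φ h).nextCoeff = h.nextCoeff := by
      rw [nextCoeff_of_natDegree_pos (by omega), nextCoeff_of_natDegree_pos (by omega), h1.2, h2.2]
      exact hcoef h _ (by omega)
    rw [hnc, ← mul_assoc]
    congr 1
    have hres : ∀ j, χ j (resN (p j) (Φ h)) = (if j = i then χ i a else 1) * χ j (resN (p j) h) := by
      intro j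
      unfold resN
      have h3 : AdjoinRoot.mk (p j) (Φ h) = AdjoinRoot.mk (p j) t0 * AdjoinRoot.mk (p j) h := by
        rw [← map_mul]
        exact AdjoinRoot.mk_eq_mk.2 ((Finset.dvd_prod_of_mem p (Finset.mem_univ j)).trans (hΦmod h))
      rw [h3, hmk j, h1.2, h2.2]
      split_ifs with h4
      · subst h4
        rw [map_mul (Algebra.norm L), hτ, mul_left_comm, map_mul]
      · rw [one_mul, one_mul]
    simp only [hres, Finset.prod_mul_distrib]
    congr 1
    simp
  have hfinal : Acoef p χ ψ d = χ i a * Acoef p χ ψ d := by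
    conv_lhs => rw [← hΦsum, Finset.sum_congr rfl hLam, ← Finset.mul_sum]
    rfl
  have h2 : (χ i a - 1) * Acoef p χ ψ d = 0 := by
    rw [sub_mul, one_mul, ← hfinal, sub_self]
  exact (mul_eq_zero.1 h2).resolve_left (sub_ne_zero.2 ha)


open Classical in
theorem natDegree_eq_sum_irrs {L : Type} [Field L] [Finite L] {d : ℕ} {h : L[X]} (hm : h.Monic)
    (hd : h.natDegree = d) :
    d = ∑ P ∈ irrs L d, ∑ k ∈ Finset.Icc 1 d, if P ^ k ∣ h then P.natDegree else 0 := by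
  have h0 : h ≠ 0 := hm.ne_zero
  set s := UniqueFactorizationMonoid.normalizedFactors h with hs
  have hsm : ∀ P ∈ s, P.Monic := by
    intro P hP
    have h1 := UniqueFactorizationMonoid.normalize_normalized_factor P hP
    rw [← h1]
    exact monic_normalize (UniqueFactorizationMonoid.irreducible_of_normalized_factor P hP).ne_zero
  have hprod : s.prod = h := by
    refine eq_of_monic_of_associated ?_ hm (UniqueFactorizationMonoid.prod_normalizedFactors h0)
    have := monic_multiset_prod_of_monic s id (by simpa using hsm)
    simpa using this
  have hdeg : d = (s.map natDegree).sum := by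
    rw [← hd, ← hprod]
    have := natDegree_multiset_prod_of_monic s hsm
    exact this
  have hsub : s.toFinset ⊆ irrs L d := by
    intro P hP
    rw [Multiset.mem_toFinset] at hP
    rw [mem_irrs]
    refine ⟨hsm P hP, ?_, UniqueFactorizationMonoid.irreducible_of_normalized_factor P hP⟩
    rw [← hd]
    exact natDegree_le_of_dvd (UniqueFactorizationMonoid.dvd_of_mem_normalizedFactors hP) h0
  refine hdeg.trans ?_
  rw [Finset.sum_multiset_map_count, Finset.sum_subset hsub]
  · refine Finset.sum_congr rfl fun P hP => ?_
    obtain ⟨hPm, hPd, hPi⟩ := mem_irrs.1 hP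
    have key : ∀ k, P ^ k ∣ h ↔ k ≤ s.count P := by
      intro k
      rw [pow_dvd_iff_le_emultiplicity,
        UniqueFactorizationMonoid.emultiplicity_eq_count_normalizedFactors hPi h0,
        hPm.normalize_eq_self]
      exact_mod_cast Iff.rfl
    have hle : s.count P ≤ d := by
      have h1 := natDegree_le_of_dvd ((key _).2 le_rfl) h0
      rw [natDegree_pow, hd] at h1
      exact (Nat.le_mul_of_pos_right _ hPi.natDegree_pos).trans h1
    simp only [key]
    rw [← Finset.sum_filter, Finset.sum_const]
    congr 1
    have : (Finset.Icc 1 d).filter (· ≤ s.count P) = Finset.Icc 1 (s.count P) := by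
      ext; simp; omega
    rw [this]; simp
  · intro P _ hP
    rw [Multiset.mem_toFinset] at hP
    rw [Multiset.count_eq_zero_of_notMem hP, zero_smul]

open Classical in
theorem sum_pow_dvd {L : Type} [Field L] [Finite L] {ι : Type} [Fintype ι]
    (p : ι → L[X]) (χ : ι → MulChar L ℂ) (ψ : AddChar L ℂ) (d : ℕ) {P : L[X]} (hP : P.Monic)
    (k : ℕ) : (∑ h ∈ monics L d, if P ^ k ∣ h then Lam p χ ψ h else 0) =
      if k * P.natDegree ≤ d then Lam p χ ψ P ^ k * Acoef p χ ψ (d - k * P.natDegree) else 0 := by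
  rw [← Finset.sum_filter]
  split_ifs with hk
  · unfold Acoef
    rw [Finset.mul_sum]
    symm
    refine Finset.sum_nbij (fun h => P ^ k * h) ?_ ?_ ?_ ?_
    · intro h hh
      rw [mem_monics] at hh
      rw [Finset.mem_filter, mem_monics]
      refine ⟨⟨(hP.pow k).mul hh.1, ?_⟩, dvd_mul_right _ _⟩
      rw [(hP.pow k).natDegree_mul hh.1, hP.natDegree_pow, hh.2]
      omega
    · intro a _ b _ hab
      exact mul_left_cancel₀ (hP.pow k).ne_zero hab
    · intro h hh
      rw [Finset.mem_coe, Finset.mem_filter, mem_monics] at hh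
      obtain ⟨⟨hm, hd⟩, c, rfl⟩ := hh
      have hc : c.Monic := (hP.pow k).of_mul_monic_left hm
      refine ⟨c, ?_, rfl⟩
      rw [Finset.mem_coe, mem_monics]
      refine ⟨hc, ?_⟩
      rw [(hP.pow k).natDegree_mul hc, hP.natDegree_pow] at hd
      omega
    · intro h hh
      rw [mem_monics] at hh
      rw [Lam_mul _ _ _ (hP.pow k) hh.1, Lam_pow _ _ _ hP]
  · refine Finset.sum_eq_zero fun h hh => ?_
    exfalso
    rw [Finset.mem_filter, mem_monics] at hh
    have := natDegree_le_of_dvd hh.2 hh.1.1.ne_zero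
    rw [hP.natDegree_pow, hh.1.2] at this
    exact hk this

noncomputable def Scoef {L : Type} [Field L] [Finite L] {ι : Type} [Fintype ι]
    (p : ι → L[X]) (χ : ι → MulChar L ℂ) (ψ : AddChar L ℂ) (s : ℕ) : ℂ :=
  ∑ P ∈ irrs L s with P.natDegree ∣ s, (P.natDegree : ℂ) * Lam p χ ψ P ^ (s / P.natDegree)

theorem newton {L : Type} [Field L] [Finite L] {ι : Type} [Fintype ι]
    (p : ι → L[X]) (χ : ι → MulChar L ℂ) (ψ : AddChar L ℂ) (d : ℕ) :
    (d : ℂ) * Acoef p χ ψ d = ∑ s ∈ Finset.Icc 1 d, Scoef p χ ψ s * Acoef p χ ψ (d - s) := by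
  classical
  have e1 : (d : ℂ) * Acoef p χ ψ d = ∑ P ∈ irrs L d, ∑ k ∈ Finset.Icc 1 d,
      (P.natDegree : ℂ) * ∑ h ∈ monics L d, if P ^ k ∣ h then Lam p χ ψ h else 0 := by
    unfold Acoef
    rw [Finset.mul_sum]
    have : ∀ h ∈ monics L d, (d : ℂ) * Lam p χ ψ h = ∑ P ∈ irrs L d, ∑ k ∈ Finset.Icc 1 d,
        (P.natDegree : ℂ) * if P ^ k ∣ h then Lam p χ ψ h else 0 := by
      intro h hh
      rw [mem_monics] at hh
      conv_lhs => rw [natDegree_eq_sum_irrs hh.1 hh.2]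
      push_cast
      rw [Finset.sum_mul]
      refine Finset.sum_congr rfl fun P _ => ?_
      rw [Finset.sum_mul]
      refine Finset.sum_congr rfl fun k _ => ?_
      split_ifs <;> simp
    rw [Finset.sum_congr rfl this, Finset.sum_comm]
    refine Finset.sum_congr rfl fun P _ => ?_
    rw [Finset.sum_comm]
    refine Finset.sum_congr rfl fun k _ => ?_
    rw [Finset.mul_sum]
  have e2 : ∀ s ∈ Finset.Icc 1 d, Scoef p χ ψ s * Acoef p χ ψ (d - s) =
      ∑ P ∈ irrs L d, if P.natDegree ∣ s then
        (P.natDegree : ℂ) * Lam p χ ψ P ^ (s / P.natDegree) * Acoef p χ ψ (d - s) else 0 := by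
    intro s hs
    rw [Finset.mem_Icc] at hs
    rw [← Finset.sum_filter, Scoef, Finset.sum_mul]
    refine Finset.sum_congr ?_ fun _ _ => rfl
    ext P
    simp only [Finset.mem_filter, mem_irrs]
    constructor
    · rintro ⟨⟨a, b, c⟩, e⟩
      exact ⟨⟨a, b.trans hs.2, c⟩, e⟩
    · rintro ⟨⟨a, b, c⟩, e⟩
      exact ⟨⟨a, Nat.le_of_dvd (by omega) e, c⟩, e⟩
  rw [e1, Finset.sum_congr rfl e2, Finset.sum_comm (s := Finset.Icc 1 d)]
  refine Finset.sum_congr rfl fun P hP => ?_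
  obtain ⟨hPm, hPd, hPi⟩ := mem_irrs.1 hP
  have hpos := hPi.natDegree_pos
  simp only [sum_pow_dvd p χ ψ d hPm, mul_ite, mul_zero]
  rw [← Finset.sum_filter, ← Finset.sum_filter]
  refine Finset.sum_nbij' (fun k => k * P.natDegree) (fun s => s / P.natDegree) ?_ ?_ ?_ ?_ ?_
  · intro k hk
    simp only [Finset.mem_filter, Finset.mem_Icc] at hk ⊢
    exact ⟨⟨Nat.mul_pos hk.1.1 hpos, hk.2⟩, dvd_mul_left _ _⟩
  · intro s hs
    simp only [Finset.mem_filter, Finset.mem_Icc] at hs ⊢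
    obtain ⟨hs1, c, rfl⟩ := hs
    rw [Nat.mul_div_cancel_left _ hpos]
    refine ⟨⟨Nat.pos_of_mul_pos_left hs1.1, (Nat.le_mul_of_pos_left _ hpos).trans hs1.2⟩, ?_⟩
    rw [mul_comm]; exact hs1.2
  · intro k _
    exact Nat.mul_div_cancel _ hpos
  · intro s hs
    simp only [Finset.mem_filter] at hs
    exact Nat.div_mul_cancel hs.2
  · intro k _
    simp only [Nat.mul_div_cancel _ hpos]
    ring

theorem card_roots_minpoly {L E : Type} [Field L] [Fintype L] [Field E] [Fintype E] [Algebra L E]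
    [DecidableEq E] {P : L[X]} (hP : Irreducible P) (hdvd : P.natDegree ∣ Module.finrank L E) :
    (P.aroots E).toFinset.card = P.natDegree := by
  have hE : FiniteDimensional L E := Module.Finite.of_finite
  have h1 : P ∣ X ^ (Nat.card L) ^ (Module.finrank L E) - X :=
    (hP.natDegree_dvd_iff_dvd_X_pow_card_pow_sub_X).1 hdvd
  rw [Nat.card_eq_fintype_card, ← Module.card_eq_pow_finrank (K := L) (V := E)] at h1
  have h2 : (P.map (algebraMap L E)) ∣ (X ^ (Fintype.card E) - X : E[X]) := by
    have := Polynomial.map_dvd (algebraMap L E) h1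
    simpa using this
  have hne : (X ^ (Fintype.card E) - X : E[X]) ≠ 0 :=
    FiniteField.X_pow_card_sub_X_ne_zero E Fintype.one_lt_card
  have hsp : (X ^ (Fintype.card E) - X : E[X]).Splits := by
    rw [splits_iff_card_roots, FiniteField.roots_X_pow_card_sub_X,
      FiniteField.X_pow_card_sub_X_natDegree_eq E Fintype.one_lt_card]
    rfl
  have hsP : (P.map (algebraMap L E)).Splits := hsp.of_dvd hne h2
  have hsep : P.Separable := PerfectField.separable_of_irreducible hP
  have hnd : (P.aroots E).Nodup := nodup_roots hsep.map
  rw [Multiset.toFinset_card_of_nodup hnd, aroots, splits_iff_card_roots.1 hsP]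
  exact natDegree_map _

theorem charSum_eq_Scoef {L : Type} [Field L] [Fintype L] {ι : Type} [Fintype ι]
    (p : ι → L[X]) (hirr : ∀ i, Irreducible (p i)) (hmon : ∀ i, (p i).Monic)
    (χ : ι → MulChar L ℂ) (ψ : AddChar L ℂ) (E : Type) [Field E] [Fintype E]
    [Algebra L E] : charSum p χ ψ E = Scoef p χ ψ (Module.finrank L E) := by
  classical
  have hE : FiniteDimensional L E := Module.Finite.of_finite
  rw [charSum_eq p hirr hmon, Scoef]
  have hx : ∀ x : E, IsIntegral L x := fun x => .of_finite L x
  rw [← Finset.sum_fiberwise_of_maps_to (s := Finset.univ) (g := fun x : E => minpoly L x)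
    (t := (irrs L (Module.finrank L E)).filter (fun P => P.natDegree ∣ Module.finrank L E))]
  · refine Finset.sum_congr rfl fun P hP => ?_
    rw [Finset.mem_filter, mem_irrs] at hP
    obtain ⟨⟨hPm, hPd, hPi⟩, hdvd⟩ := hP
    have : (Finset.univ.filter fun x : E => minpoly L x = P) = (P.aroots E).toFinset := by
      ext x
      rw [Finset.mem_filter, Multiset.mem_toFinset, mem_aroots]
      constructor
      · rintro ⟨-, rfl⟩
        exact ⟨hPi.ne_zero, minpoly.aeval L x⟩
      · rintro ⟨-, h⟩
        exact ⟨Finset.mem_univ _, (minpoly.eq_of_irreducible_of_monic hPi h hPm).symm⟩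
    rw [Finset.sum_congr rfl (g := fun _ => Lam p χ ψ P ^ (Module.finrank L E / P.natDegree)),
      Finset.sum_const, this, card_roots_minpoly hPi hdvd, nsmul_eq_mul]
    intro x hx
    rw [(Finset.mem_filter.1 hx).2]
  · intro x _
    have h1 : (minpoly L x).natDegree ∣ Module.finrank L E := minpoly.degree_dvd (hx x)
    rw [Finset.mem_filter, mem_irrs]
    exact ⟨⟨minpoly.monic (hx x), Nat.le_of_dvd Module.finrank_pos h1,
      minpoly.irreducible (hx x)⟩, h1⟩

theorem Scoef_bound {L : Type} [Field L] [Fintype L] {ι : Type} [Fintype ι]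
    (p : ι → L[X]) (hirr : ∀ i, Irreducible (p i)) (hmon : ∀ i, (p i).Monic)
    (hinj : Function.Injective p) (χ : ι → MulChar L ℂ) (ψ : AddChar L ℂ) (hχ : ∃ i, χ i ≠ 1) :
    ∃ B : ℝ, 0 ≤ B ∧ ∀ s, 0 < s → ‖Scoef p χ ψ s‖ ≤ B * √(Fintype.card L) ^ s := by
  obtain ⟨B, hB, h⟩ := charSum_bound L p hirr hmon hinj χ ψ hχ
  refine ⟨B, hB, fun s hs => ?_⟩
  obtain ⟨q, hq⟩ := CharP.exists L
  have : Fact q.Prime := ⟨CharP.char_is_prime L q⟩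
  have : NeZero s := ⟨hs.ne'⟩
  let _ : Fintype (FiniteField.Extension L q s) := Fintype.ofFinite _
  have h1 := h (FiniteField.Extension L q s)
  have h2 : Module.finrank L (FiniteField.Extension L q s) = s := FiniteField.finrank_extension ..
  rw [charSum_eq_Scoef p hirr hmon, h2] at h1
  refine h1.trans_eq ?_
  rw [Module.card_eq_pow_finrank (K := L) (V := FiniteField.Extension L q s), h2]
  push_cast
  rw [Real.sqrt_eq_rpow, Real.sqrt_eq_rpow, ← Real.rpow_natCast, ← Real.rpow_natCast,
    ← Real.rpow_mul (by positivity), ← Real.rpow_mul (by positivity), mul_comm (s:ℝ)]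

theorem charSum_self {L : Type} [Field L] [Fintype L] {ι : Type} [Fintype ι]
    (p : ι → L[X]) (χ : ι → MulChar L ℂ) (ψ : AddChar L ℂ) : charSum p χ ψ L =
      ∑ x : L, (∏ i, χ i ((p i).eval x)) * ψ x := by
  unfold charSum
  simp [Algebra.norm_self, Algebra.trace_self]


theorem growth_lemma (A S : ℕ → ℂ) (D : ℕ) (B R : ℝ) (hR : 0 < R) (hB : 0 ≤ B) (hA0 : A 0 = 1)
    (hAD : ∀ d, D < d → A d = 0)
    (hN : ∀ d : ℕ, (d : ℂ) * A d = ∑ s ∈ Finset.Icc 1 d, S s * A (d - s))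
    (hS : ∀ s, 0 < s → ‖S s‖ ≤ B * R ^ s) : ‖S 1‖ ≤ D * R := by
  set P : ℂ[X] := ∑ j ∈ Finset.range (D + 1), C (A j) * X ^ j with hP
  have hcoeff : ∀ j, P.coeff j = A j := by
    intro j
    rw [hP, finsetSum_coeff]
    simp only [coeff_C_mul, coeff_X_pow, mul_ite, mul_one, mul_zero]
    rw [Finset.sum_ite_eq]
    split_ifs with h
    · rfl
    · rw [hAD]; simpa using h
  have hPe : ∀ t, P.eval t = ∑ j ∈ Finset.range (D + 1), A j * t ^ j := by
    intro t; simp [hP, eval_finsetSum]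
  have hP0 : P.eval 0 = 1 := by rw [← coeff_zero_eq_eval_zero, hcoeff, hA0]
  have hPne : P ≠ 0 := by rintro h; rw [h] at hP0; simp at hP0
  have hPd : P.natDegree ≤ D := natDegree_le_iff_coeff_eq_zero.2 fun N hN => by
    rw [hcoeff, hAD N hN]
  have hPD : P.derivative.eval 0 = A 1 := by
    rw [← coeff_zero_eq_eval_zero, coeff_derivative, hcoeff]; simp
  have hS1 : S 1 = A 1 := by
    have := hN 1
    simp [hA0] at this
    exact this.symm
  set S' : ℕ → ℂ := fun s => if s = 0 then 0 else S s with hS'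
  have hN' : ∀ d : ℕ, (d : ℂ) * A d = ∑ ij ∈ Finset.HasAntidiagonal.antidiagonal d, S' ij.1 * A ij.2 := by
    intro d
    rw [hN, Finset.Nat.sum_antidiagonal_eq_sum_range_succ (fun i j => S' i * A j)]
    have hsub : Finset.Icc 1 d ⊆ Finset.range d.succ := by
      intro x; simp; try omega
    rw [← Finset.sum_subset hsub]
    · refine Finset.sum_congr rfl fun s hs => ?_
      rw [Finset.mem_Icc] at hs
      simp only [hS']
      rw [if_neg (by omega)]
    · intro x hx hx'
      have : x = 0 := by simp at hx hx'; omega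
      simp [hS', this]
  have hS'b : ∀ s, ‖S' s‖ ≤ B * R ^ s := by
    intro s
    simp only [hS']
    split_ifs with h
    · simpa using by positivity
    · exact hS s (Nat.pos_of_ne_zero h)
  -- bounded logarithmic derivative
  have hlog : ∀ r : ℝ, 0 ≤ r → r * R < 1 → ∃ M : ℝ, ∀ t : ℂ, ‖t‖ ≤ r →
      ‖t * P.derivative.eval t‖ ≤ M * ‖P.eval t‖ := by
    intro r hr hrR
    refine ⟨∑' s : ℕ, B * (r * R) ^ s, fun t ht => ?_⟩
    have hsumm : Summable fun s : ℕ => B * (r * R) ^ s :=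
      (summable_geometric_of_lt_one (by positivity) hrR).mul_left B
    have hle : ∀ s, ‖S' s * t ^ s‖ ≤ B * (r * R) ^ s := by
      intro s
      rw [norm_mul, norm_pow, mul_pow]
      calc _ ≤ (B * R ^ s) * r ^ s := by
            gcongr
            exact hS'b s
        _ = _ := by ring
    have hs1 : Summable fun s : ℕ => ‖S' s * t ^ s‖ :=
      Summable.of_nonneg_of_le (fun _ => norm_nonneg _) hle hsumm
    have hs2 : Summable fun s : ℕ => ‖A s * t ^ s‖ := by
      refine summable_of_ne_finset_zero (s := Finset.range (D + 1)) fun b hb => ?_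
      rw [hAD b (by simpa using hb)]; simp
    have hA : ∑' s, A s * t ^ s = P.eval t := by
      rw [hPe]
      refine tsum_eq_sum fun b hb => ?_
      rw [hAD b (by simpa using hb)]; simp
    have hprod := tsum_mul_tsum_eq_tsum_sum_antidiagonal_of_summable_norm hs1 hs2
    have : ∑' n, ∑ kl ∈ Finset.HasAntidiagonal.antidiagonal n, S' kl.1 * t ^ kl.1 * (A kl.2 * t ^ kl.2) =
        t * P.derivative.eval t := by
      have e : ∀ n, ∑ kl ∈ Finset.HasAntidiagonal.antidiagonal n, S' kl.1 * t ^ kl.1 * (A kl.2 * t ^ kl.2) =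
          n * A n * t ^ n := by
        intro n
        rw [hN', Finset.sum_mul]
        refine Finset.sum_congr rfl fun kl hkl => ?_
        rw [← Finset.HasAntidiagonal.mem_antidiagonal.1 hkl, pow_add]; ring
      simp only [e]
      rw [tsum_eq_sum (s := Finset.range (D + 1))]
      · rw [hP, derivative_sum, eval_finsetSum, Finset.mul_sum]
        refine Finset.sum_congr rfl fun j _ => ?_
        rcases j with _ | j
        · simp
        · simp [derivative_mul]; ring
      · intro b hb
        rw [hAD b (by simpa using hb)]; simp
    rw [this, hA] at hprod
    rw [← hprod, norm_mul]
    gcongr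
    exact tsum_of_norm_bounded hsumm.hasSum hle
  have hroot : ∀ t0 ∈ P.roots, R⁻¹ ≤ ‖t0‖ := by
    intro t0 ht0
    by_contra hcon
    push Not at hcon
    have ht00 : t0 ≠ 0 := by
      rintro rfl
      rw [mem_roots hPne, IsRoot, hP0] at ht0
      exact one_ne_zero ht0
    obtain ⟨Q, hQ, hQr⟩ := exists_eq_pow_rootMultiplicity_mul_and_not_dvd P hPne t0
    set m := P.rootMultiplicity t0 with hm
    have hm0 : 0 < m := (rootMultiplicity_pos hPne).2 ((mem_roots hPne).1 ht0)
    obtain ⟨k, hk⟩ : ∃ k, m = k + 1 := ⟨m - 1, by omega⟩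
    rw [dvd_iff_isRoot, IsRoot] at hQr
    obtain ⟨r, hr1, hr2⟩ := exists_between hcon
    have hr0 : 0 ≤ r := (norm_nonneg _).trans hr1.le
    obtain ⟨M, hM⟩ := hlog r hr0 (by rwa [lt_inv_comm₀ (lt_of_le_of_lt (norm_nonneg _) hr1) hR, ← one_div, lt_div_iff₀ (lt_of_le_of_lt (norm_nonneg _) hr1), mul_comm] at hr2)
    have hder : P.derivative = (X - C t0) ^ k * ((k + 1 : ℂ[X]) * Q + (X - C t0) * Q.derivative) := by
      conv_lhs => rw [hQ, hk]
      simp only [derivative_mul, derivative_X_sub_C_pow]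
      push_cast
      simp
      ring
    have hev : ∀ᶠ t in nhdsWithin t0 {t0}ᶜ, ‖t * (((k : ℂ) + 1) * Q.eval t + (t - t0) * Q.derivative.eval t)‖
        ≤ M * (‖t - t0‖ * ‖Q.eval t‖) := by
      have h1 : ∀ᶠ t in nhds t0, ‖t‖ < r := (continuous_norm.continuousAt).eventually (gt_mem_nhds hr1 |> fun h => h)
      filter_upwards [self_mem_nhdsWithin, nhdsWithin_le_nhds h1] with t ht htr
      have h2 := hM t htr.le
      have h3 : 0 < ‖t - t0‖ := norm_pos_iff.2 (sub_ne_zero.2 ht)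
      rw [hder, hQ, hk] at h2
      simp only [eval_mul, eval_pow, eval_sub, eval_X, eval_C, eval_add, eval_natCast, eval_one] at h2
      rw [mul_left_comm, norm_mul, norm_pow, norm_mul ((t - t0) ^ (k + 1)), norm_pow, pow_succ] at h2
      have h4 : 0 < ‖t - t0‖ ^ k := by positivity
      refine le_of_mul_le_mul_left ?_ h4
      refine h2.trans_eq ?_
      ring
    have hlim := le_of_tendsto_of_tendsto
      (f := fun t => ‖t * (((k : ℂ) + 1) * Q.eval t + (t - t0) * Q.derivative.eval t)‖)
      (g := fun t => M * (‖t - t0‖ * ‖Q.eval t‖)) (b := nhdsWithin t0 {t0}ᶜ)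
      ((Continuous.tendsto (by fun_prop) t0).mono_left nhdsWithin_le_nhds)
      ((Continuous.tendsto (by fun_prop) t0).mono_left nhdsWithin_le_nhds) hev
    simp only [sub_self, zero_mul, add_zero, norm_zero, mul_zero] at hlim
    have := norm_le_zero_iff.1 hlim
    have hk1 : (k : ℂ) + 1 ≠ 0 := by exact_mod_cast Nat.succ_ne_zero k
    exact (mul_ne_zero ht00 (mul_ne_zero hk1 hQr)) this
  have hfin := (IsAlgClosed.splits P).eval_derivative_div_eval_of_ne_zero (x := 0) (by rw [hP0]; exact one_ne_zero)
  rw [hP0, hPD, div_one] at hfin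
  rw [hS1, hfin]
  refine (norm_multiset_sum_le _).trans ?_
  rw [Multiset.map_map]
  refine (Multiset.sum_le_card_nsmul _ R ?_).trans ?_
  · intro x hx
    obtain ⟨z, hz, rfl⟩ := Multiset.mem_map.1 hx
    have := hroot z hz
    simp only [Function.comp, zero_sub, one_div, norm_inv, norm_neg]
    exact inv_le_of_inv_le₀ hR this
  · rw [Multiset.card_map, nsmul_eq_mul]
    gcongr
    exact (card_roots' P).trans hPd

/-- The Weil bound for mixed character sums. -/
theorem weil_bound {L : Type} [Field L] [Fintype L] {ι : Type} [Fintype ι]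
    (p : ι → L[X]) (hirr : ∀ i, Irreducible (p i)) (hmon : ∀ i, (p i).Monic)
    (hinj : Function.Injective p) (χ : ι → MulChar L ℂ) (ψ : AddChar L ℂ) (hχ : ∃ i, χ i ≠ 1) :
    ‖∑ x : L, (∏ i, χ i ((p i).eval x)) * ψ x‖ ≤
      (∑ i, (p i).natDegree : ℕ) * √(Fintype.card L) := by
  obtain ⟨B, hB, hS⟩ := Scoef_bound p hirr hmon hinj χ ψ hχ
  have h := growth_lemma (Acoef p χ ψ) (Scoef p χ ψ) (∑ i, (p i).natDegree) B √(Fintype.card L)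
    (Real.sqrt_pos.2 (by exact_mod_cast Fintype.card_pos)) hB (Acoef_zero p χ ψ)
    (fun d hd => Acoef_eq_zero p hirr hmon hinj χ ψ hχ d hd) (newton p χ ψ) hS
  rw [← charSum_self, charSum_eq_Scoef p hirr hmon, Module.finrank_self]
  exact h


/-- `F` restricted to `X` is a combination of characters from `A`, with trivial coefficient `m`
and coefficient `ℓ¹`-norm at most `B`. -/
def CharRep {Γ : Type} [CommGroup Γ] [Fintype Γ] {T : Type} (e : Γ → T → ℂ) (X : Finset T)
    (A : Subgroup Γ) (m B : ℝ) (F : T → ℂ) : Prop :=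
  ∃ c : Γ → ℂ, (∀ γ, γ ∉ A → c γ = 0) ∧ c 1 = m ∧ ∑ γ, ‖c γ‖ ≤ B ∧
    ∀ t ∈ X, F t = ∑ γ, c γ * e γ t

theorem CharRep.mul {Γ : Type} [CommGroup Γ] [Fintype Γ] {T : Type} {e : Γ → T → ℂ}
    {X : Finset T} (he : ∀ t ∈ X, ∀ γ δ, e (γ * δ) t = e γ t * e δ t)
    {A A' : Subgroup Γ} (hd : Disjoint A A') {m B m' B' : ℝ} {F F' : T → ℂ}
    (h : CharRep e X A m B F) (h' : CharRep e X A' m' B' F') :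
    CharRep e X (A ⊔ A') (m * m') (B * B') (fun t => F t * F' t) := by
  obtain ⟨c, hc1, hc2, hc3, hc4⟩ := h
  obtain ⟨c', hc1', hc2', hc3', hc4'⟩ := h'
  refine ⟨fun γ => ∑ x, c x * c' (x⁻¹ * γ), ?_, ?_, ?_, ?_⟩
  · intro γ hγ
    refine Finset.sum_eq_zero fun x _ => ?_
    by_cases hx : x ∈ A
    · by_cases hy : x⁻¹ * γ ∈ A'
      · exfalso
        apply hγ
        have := Subgroup.mul_mem_sup hx hy
        simpa using this
      · rw [hc1' _ hy, mul_zero]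
    · rw [hc1 _ hx, zero_mul]
  · beta_reduce
    rw [Finset.sum_eq_single 1]
    · simp [hc2, hc2']
    · intro x _ hx1
      by_cases hx : x ∈ A
      · rw [hc1' _ _, mul_zero]
        intro hy
        rw [mul_one, inv_mem_iff] at hy
        exact hx1 (Subgroup.disjoint_def.1 hd hx hy)
      · rw [hc1 _ hx, zero_mul]
    · simp
  · calc ∑ γ, ‖∑ x, c x * c' (x⁻¹ * γ)‖ ≤ ∑ γ, ∑ x, ‖c x‖ * ‖c' (x⁻¹ * γ)‖ := by
          refine Finset.sum_le_sum fun γ _ => (norm_sum_le _ _).trans_eq ?_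
          simp
      _ = ∑ x, ‖c x‖ * ∑ γ, ‖c' γ‖ := by
          rw [Finset.sum_comm]
          refine Finset.sum_congr rfl fun x _ => ?_
          rw [← Finset.mul_sum]
          congr 1
          exact Fintype.sum_equiv (Equiv.mulLeft x⁻¹) _ _ fun γ => rfl
      _ = (∑ x, ‖c x‖) * ∑ γ, ‖c' γ‖ := by rw [Finset.sum_mul]
      _ ≤ B * B' := by
          refine mul_le_mul hc3 hc3' (Finset.sum_nonneg fun _ _ => norm_nonneg _) ?_
          exact (Finset.sum_nonneg fun _ _ => norm_nonneg _).trans hc3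
  · intro t ht
    simp only
    rw [hc4 t ht, hc4' t ht, Finset.sum_mul]
    simp only [Finset.sum_mul]
    rw [Finset.sum_comm (s := Finset.univ (α := Γ))]
    refine Finset.sum_congr rfl fun x _ => ?_
    rw [Finset.mul_sum]
    refine Fintype.sum_equiv (Equiv.mulLeft x) _ _ fun γ => ?_
    simp only [Equiv.coe_mulLeft, inv_mul_cancel_left]
    rw [he t ht]
    ring

theorem CharRep.sum_bound {Γ : Type} [CommGroup Γ] [Fintype Γ] {T : Type} {e : Γ → T → ℂ}
    {X : Finset T} (he1 : ∀ t ∈ X, e 1 t = 1) {M : ℝ}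
    (hM : ∀ γ, γ ≠ 1 → ‖∑ t ∈ X, e γ t‖ ≤ M)
    {A : Subgroup Γ} {m B : ℝ} {F : T → ℂ} (hM0 : 0 ≤ M)
    (h : CharRep e X A m B F) : ‖∑ t ∈ X, F t - m * X.card‖ ≤ M * (B - |m|) := by
  classical
  obtain ⟨c, hc1, hc2, hc3, hc4⟩ := h
  rw [Finset.sum_congr rfl hc4, Finset.sum_comm]
  simp only [← Finset.mul_sum]
  rw [← Finset.add_sum_erase _ _ (Finset.mem_univ (1 : Γ)), Finset.sum_congr rfl he1, hc2]
  simp only [Finset.sum_const, nsmul_eq_mul, mul_one, add_sub_cancel_left]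
  rw [← Finset.add_sum_erase _ _ (Finset.mem_univ (1 : Γ)), hc2, Complex.norm_real,
    Real.norm_eq_abs] at hc3
  calc _ ≤ ∑ γ ∈ Finset.univ.erase 1, ‖c γ‖ * M := by
        refine (norm_sum_le _ _).trans (Finset.sum_le_sum fun γ hγ => ?_)
        rw [norm_mul]
        gcongr
        exact hM γ (Finset.ne_of_mem_erase hγ)
    _ = M * ∑ γ ∈ Finset.univ.erase 1, ‖c γ‖ := by rw [← Finset.sum_mul, mul_comm]
    _ ≤ _ := by gcongr; linarith

/-- normalised indicator of all characters of `A` being trivial at `t`. -/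
noncomputable def badInd {Γ : Type} [CommGroup Γ] [Fintype Γ] {T : Type} (e : Γ → T → ℂ)
    (A : Subgroup Γ) (t : T) : ℂ := by
  classical exact (Nat.card A : ℂ)⁻¹ * ∑ γ : Γ, if γ ∈ A then e γ t else 0

theorem badInd_eq_zero {Γ : Type} [CommGroup Γ] [Fintype Γ] {T : Type} {e : Γ → T → ℂ}
    {A : Subgroup Γ} {t : T} (he : ∀ γ δ, e (γ * δ) t = e γ t * e δ t)
    (h : ∃ γ ∈ A, e γ t ≠ 1) : badInd e A t = 0 := by
  classical
  obtain ⟨γ, hγ, hne⟩ := h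
  unfold badInd
  have : e γ t * ∑ x : Γ, (if x ∈ A then e x t else 0) = ∑ x : Γ, if x ∈ A then e x t else 0 := by
    rw [Finset.mul_sum]
    refine Fintype.sum_equiv (Equiv.mulLeft γ) _ _ fun x => ?_
    simp only [Equiv.coe_mulLeft, A.mul_mem_cancel_left hγ, he, mul_ite, mul_zero]
  have h2 : (e γ t - 1) * ∑ x : Γ, (if x ∈ A then e x t else 0) = 0 := by
    rw [sub_mul, this, one_mul, sub_self]
  rcases mul_eq_zero.1 h2 with h3 | h3
  · exact absurd (sub_eq_zero.1 h3) hne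
  · rw [h3, mul_zero]

theorem card_filter_mem {Γ : Type} [CommGroup Γ] [Fintype Γ] (A : Subgroup Γ)
    [DecidablePred (· ∈ A)] : (Finset.univ.filter (· ∈ A)).card = Nat.card A := by
  rw [Nat.card_eq_fintype_card, Fintype.card_subtype]

theorem badInd_eq_one {Γ : Type} [CommGroup Γ] [Fintype Γ] {T : Type} {e : Γ → T → ℂ}
    {A : Subgroup Γ} {t : T}
    (h : ¬ ∃ γ ∈ A, e γ t ≠ 1) : badInd e A t = 1 := by
  classical
  push Not at h
  unfold badInd
  have : ∑ x : Γ, (if x ∈ A then e x t else 0) = Nat.card A := by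
    rw [← Finset.sum_filter, Finset.sum_congr rfl (g := fun _ => (1 : ℂ))]
    · rw [Finset.sum_const, card_filter_mem]; simp
    · intro x hx; exact h x (Finset.mem_filter.1 hx).2
  rw [this]
  have : (Nat.card A : ℂ) ≠ 0 := by exact_mod_cast Nat.card_pos.ne'
  field_simp

theorem rep_one_sub_badInd {Γ : Type} [CommGroup Γ] [Fintype Γ] {T : Type} {e : Γ → T → ℂ}
    {X : Finset T} (he1 : ∀ t ∈ X, e 1 t = 1) (A : Subgroup Γ) :
    CharRep e X A (1 - (Nat.card A : ℝ)⁻¹) (2 * (1 - (Nat.card A : ℝ)⁻¹))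
      (fun t => 1 - badInd e A t) := by
  classical
  have hpos : 0 < Nat.card A := Nat.card_pos
  have hN : (1 : ℝ) ≤ Nat.card A := by exact_mod_cast hpos
  refine ⟨fun γ => (if γ = 1 then 1 else 0) - (if γ ∈ A then (Nat.card A : ℂ)⁻¹ else 0),
    ?_, ?_, ?_, ?_⟩
  · intro γ hγ
    have : γ ≠ 1 := by rintro rfl; exact hγ A.one_mem
    simp [hγ, this]
  · simp [A.one_mem]
  · rw [← Finset.add_sum_erase _ _ (Finset.mem_univ (1 : Γ))]
    have h1 : ‖((if (1 : Γ) = 1 then 1 else 0) - (if (1 : Γ) ∈ A then (Nat.card A : ℂ)⁻¹ else 0) : ℂ)‖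
        = 1 - (Nat.card A : ℝ)⁻¹ := by
      simp only [if_true, A.one_mem]
      rw [show (1 - (Nat.card A : ℂ)⁻¹) = ((1 - (Nat.card A : ℝ)⁻¹ : ℝ) : ℂ) by push_cast; rfl,
        Complex.norm_real, Real.norm_of_nonneg]
      have := inv_le_one_of_one_le₀ hN
      linarith
    rw [h1]
    have h2 : ∑ γ ∈ Finset.univ.erase (1 : Γ), ‖((if γ = 1 then 1 else 0) -
        (if γ ∈ A then (Nat.card A : ℂ)⁻¹ else 0) : ℂ)‖ = 1 - (Nat.card A : ℝ)⁻¹ := by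
      rw [Finset.sum_congr rfl (g := fun γ => if γ ∈ A then (Nat.card A : ℝ)⁻¹ else 0)]
      · rw [Finset.sum_erase_eq_sub (Finset.mem_univ _), ← Finset.sum_filter, Finset.sum_const,
          card_filter_mem, if_pos A.one_mem, nsmul_eq_mul, mul_inv_cancel₀ (by positivity)]
      · intro γ hγ
        rw [if_neg (Finset.ne_of_mem_erase hγ)]
        split_ifs <;> simp
    rw [h2]; linarith
  · intro t ht
    simp only [sub_mul, Finset.sum_sub_distrib, ite_mul, one_mul, zero_mul]
    rw [Finset.sum_ite_eq' Finset.univ (1 : Γ)]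
    simp only [Finset.mem_univ, if_true, he1 t ht]
    congr 1
    unfold badInd
    rw [Finset.mul_sum]
    refine Finset.sum_congr rfl fun x _ => ?_
    split_ifs <;> simp

theorem rep_badInd_sub {Γ : Type} [CommGroup Γ] [Fintype Γ] {T : Type} {e : Γ → T → ℂ}
    {X : Finset T} (he1 : ∀ t ∈ X, e 1 t = 1) (A : Subgroup Γ) :
    CharRep e X A 0 (1 - (Nat.card A : ℝ)⁻¹)
      (fun t => badInd e A t - (Nat.card A : ℂ)⁻¹) := by
  classical
  have hpos : 0 < Nat.card A := Nat.card_pos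
  refine ⟨fun γ => if γ = 1 then 0 else (if γ ∈ A then (Nat.card A : ℂ)⁻¹ else 0),
    ?_, ?_, ?_, ?_⟩
  · intro γ hγ
    simp [hγ]
  · simp
  · rw [← Finset.add_sum_erase _ _ (Finset.mem_univ (1 : Γ))]
    rw [Finset.sum_congr rfl (g := fun γ => if γ ∈ A then (Nat.card A : ℝ)⁻¹ else 0)]
    · rw [Finset.sum_erase_eq_sub (Finset.mem_univ _), ← Finset.sum_filter, Finset.sum_const,
          card_filter_mem, if_pos A.one_mem, nsmul_eq_mul, mul_inv_cancel₀ (by positivity)]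
      simp
    · intro γ hγ
      beta_reduce
      rw [if_neg (Finset.ne_of_mem_erase hγ)]
      split_ifs <;> simp
  · intro t ht
    unfold badInd
    beta_reduce
    rw [← Finset.add_sum_erase _ (fun γ => if γ ∈ A then e γ t else 0) (Finset.mem_univ (1 : Γ)),
      ← Finset.add_sum_erase _ (fun γ => (if γ = 1 then 0 else
        (if γ ∈ A then (Nat.card A : ℂ)⁻¹ else 0)) * e γ t) (Finset.mem_univ (1 : Γ))]
    simp only [A.one_mem, if_true, he1 t ht, mul_add, mul_one, zero_mul, zero_add,
      add_sub_cancel_left]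
    rw [Finset.mul_sum]
    refine Finset.sum_congr rfl fun x hx => ?_
    rw [if_neg (Finset.ne_of_mem_erase hx)]
    split_ifs <;> simp

/-- The prime sieve in abstract form. -/
theorem abstract_sieve {Γ : Type} [CommGroup Γ] [Fintype Γ] {T I : Type} [DecidableEq I]
    (e : Γ → T → ℂ) (X : Finset T)
    (he1 : ∀ t ∈ X, e 1 t = 1) (he : ∀ t ∈ X, ∀ γ δ, e (γ * δ) t = e γ t * e δ t)
    (M : ℝ) (hM0 : 0 ≤ M) (hM : ∀ γ, γ ≠ 1 → ‖∑ t ∈ X, e γ t‖ ≤ M)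
    (A : I → Subgroup Γ) (hA1 : ∀ i, 2 ≤ Nat.card (A i))
    (hind : ∀ i, ∃ S : Γ →* Γ, (∀ γ ∈ A i, S γ = γ) ∧ ∀ j, j ≠ i → ∀ γ ∈ A j, S γ = 1)
    (C S : Finset I) (hCS : Disjoint C S) (δ : ℝ)
    (hδ : δ = 1 - ∑ i ∈ S, (Nat.card (A i) : ℝ)⁻¹)
    (hδ0 : 0 < δ)
    (hX : M * (δ * (2 ^ C.card - 1) + 2 ^ C.card * (S.card - 1 + δ)) < δ * X.card) :
    ∃ t ∈ X, ∀ i ∈ C ∪ S, ∃ γ ∈ A i, e γ t ≠ 1 := by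
  by_contra hcon
  push Not at hcon
  have hdisj : ∀ (s : Finset I) (i : I), i ∉ s → Disjoint (A i) (s.sup A) := by
    intro s i hi
    obtain ⟨S, hS1, hS2⟩ := hind i
    rw [Subgroup.disjoint_def]
    intro x hx hx'
    have : s.sup A ≤ S.ker := by
      refine Finset.sup_le fun j hj γ hγ => ?_
      exact hS2 j (by rintro rfl; exact hi hj) γ hγ
    rw [← hS1 x hx]
    exact this hx'
  set θ : ℝ := ∏ i ∈ C, (1 - (Nat.card (A i) : ℝ)⁻¹) with hθ
  have hNi : ∀ i, (Nat.card (A i) : ℝ)⁻¹ ≤ 1 / 2 := by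
    intro i
    rw [inv_eq_one_div]
    apply one_div_le_one_div_of_le (by norm_num)
    exact_mod_cast hA1 i
  have hθ0 : 0 < θ := Finset.prod_pos fun i _ => by linarith [hNi i]
  have hcore : ∀ C : Finset I, CharRep e X (C.sup A) (∏ i ∈ C, (1 - (Nat.card (A i) : ℝ)⁻¹))
      (2 ^ C.card * ∏ i ∈ C, (1 - (Nat.card (A i) : ℝ)⁻¹))
      (fun t => ∏ i ∈ C, (1 - badInd e (A i) t)) := by
    intro C
    induction C using Finset.induction_on with
    | empty =>
      classical
      refine ⟨fun γ => if γ = 1 then 1 else 0, ?_, ?_, ?_, ?_⟩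
      · intro γ hγ
        beta_reduce
        rw [if_neg]
        rintro rfl; exact hγ (Subgroup.one_mem _)
      · simp
      · simp [apply_ite]
      · intro t ht
        simp [he1 t ht]
    | insert i s hi ih =>
      have := (rep_one_sub_badInd he1 (A i)).mul he (hdisj s i hi) ih
      rw [Finset.sup_insert, Finset.prod_insert hi, Finset.card_insert_of_notMem hi]
      convert this using 1
      · ring
      · funext t
        rw [Finset.prod_insert hi]
  have hb := (hcore C).sum_bound he1 hM hM0
  rw [← hθ] at hb
  have hs : ∀ i ∈ S, ‖∑ t ∈ X, (badInd e (A i) t - (Nat.card (A i) : ℂ)⁻¹) *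
      ∏ j ∈ C, (1 - badInd e (A j) t)‖ ≤
        M * ((1 - (Nat.card (A i) : ℝ)⁻¹) * (2 ^ C.card * θ)) := by
    intro i hi
    have hiC : i ∉ C := fun h => Finset.disjoint_left.1 hCS h hi
    have := ((rep_badInd_sub he1 (A i)).mul he (hdisj C i hiC) (hcore C)).sum_bound he1 hM hM0
    simpa using this
  -- the sum is non-positive
  have h01 : ∀ t ∈ X, ∀ i, badInd e (A i) t = 0 ∨ badInd e (A i) t = 1 := by
    intro t ht i
    by_cases h : ∃ γ ∈ A i, e γ t ≠ 1
    · left; exact badInd_eq_zero (he t ht) h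
    · right; exact badInd_eq_one h
  have hneg : ∀ t ∈ X, ((∏ j ∈ C, (1 - badInd e (A j) t)) *
      (1 - ∑ i ∈ S, badInd e (A i) t)).re ≤ 0 := by
    intro t ht
    have hp : (∏ j ∈ C, (1 - badInd e (A j) t)) = 0 ∨ (∏ j ∈ C, (1 - badInd e (A j) t)) = 1 := by
      by_cases h : ∃ j ∈ C, badInd e (A j) t = 1
      · left
        obtain ⟨j, hj, hj1⟩ := h
        exact Finset.prod_eq_zero hj (by rw [hj1, sub_self])
      · right
        push Not at h
        refine Finset.prod_eq_one fun j hj => ?_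
        rw [(h01 t ht j).resolve_right (h j hj), sub_zero]
    rcases hp with hp | hp
    · rw [hp]; simp
    · rw [hp, one_mul, Complex.sub_re, Complex.one_re, Complex.re_sum]
      obtain ⟨i, hi, hbad⟩ := hcon t ht
      have hi1 : badInd e (A i) t = 1 := badInd_eq_one (by push Not; exact hbad)
      have hiS : i ∈ S := by
        rcases Finset.mem_union.1 hi with h | h
        · exfalso
          have : (∏ j ∈ C, (1 - badInd e (A j) t)) = 0 :=
            Finset.prod_eq_zero h (by rw [hi1, sub_self])
          rw [hp] at this
          exact one_ne_zero this
        · exact h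
      have : (1 : ℝ) ≤ ∑ i ∈ S, (badInd e (A i) t).re := by
        have h2 := Finset.single_le_sum (f := fun i => (badInd e (A i) t).re) (s := S)
          (fun j _ => by rcases h01 t ht j with h | h <;> simp [h]) hiS
        simpa [hi1] using h2
      linarith
  have hsplit : ∑ t ∈ X, ((∏ j ∈ C, (1 - badInd e (A j) t)) *
      (1 - ∑ i ∈ S, badInd e (A i) t)) = δ * ∑ t ∈ X, ∏ j ∈ C, (1 - badInd e (A j) t) -
      ∑ i ∈ S, ∑ t ∈ X, (badInd e (A i) t - (Nat.card (A i) : ℂ)⁻¹) *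
      ∏ j ∈ C, (1 - badInd e (A j) t) := by
    rw [Finset.sum_comm, Finset.mul_sum, ← Finset.sum_sub_distrib]
    refine Finset.sum_congr rfl fun t _ => ?_
    rw [← Finset.sum_mul, Finset.sum_sub_distrib, hδ]
    push_cast
    ring
  have hre : (∑ t ∈ X, ((∏ j ∈ C, (1 - badInd e (A j) t)) *
      (1 - ∑ i ∈ S, badInd e (A i) t))).re ≤ 0 := by
    rw [Complex.re_sum]; exact Finset.sum_nonpos hneg
  rw [hsplit, Complex.sub_re, Complex.re_ofReal_mul] at hre
  have h1 : θ * X.card - M * (2 ^ C.card * θ - θ) ≤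
      (∑ t ∈ X, ∏ j ∈ C, (1 - badInd e (A j) t)).re := by
    rw [abs_of_pos hθ0] at hb
    have := (abs_le.1 ((Complex.abs_re_le_norm _).trans hb)).1
    rw [Complex.sub_re] at this
    have e1 : ((θ : ℂ) * (X.card : ℂ)).re = θ * X.card := by
      rw [Complex.re_ofReal_mul, Complex.natCast_re]
    rw [e1] at this
    linarith
  have h2 : (∑ i ∈ S, ∑ t ∈ X, (badInd e (A i) t - (Nat.card (A i) : ℂ)⁻¹) *
      ∏ j ∈ C, (1 - badInd e (A j) t)).re ≤ M * (2 ^ C.card * θ) * (S.card - 1 + δ) := by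
    refine (Complex.re_le_norm _).trans ((norm_sum_le _ _).trans ((Finset.sum_le_sum hs).trans_eq ?_))
    rw [← Finset.mul_sum, ← Finset.sum_mul, Finset.sum_sub_distrib, hδ]
    simp
    ring
  have h3 := mul_le_mul_of_nonneg_left h1 hδ0.le
  have h4 : θ * (δ * X.card) ≤ θ * (M * (δ * (2 ^ C.card - 1) + 2 ^ C.card * (S.card - 1 + δ))) := by
    nlinarith
  exact absurd (le_of_mul_le_mul_left h4 hθ0) (not_le.2 hX)


open Classical in
/-- the points where everything is defined and non-zero -/
noncomputable def goodPts {L : Type} [Field L] [Fintype L] (f₁ f₂ : L[X]) : Finset L :=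
  Finset.univ.filter fun x => (X * f₁ * f₂).eval x ≠ 0

theorem mem_goodPts {L : Type} [Field L] [Fintype L] {f₁ f₂ : L[X]} {x : L} :
    x ∈ goodPts f₁ f₂ ↔ x ≠ 0 ∧ f₁.eval x ≠ 0 ∧ f₂.eval x ≠ 0 := by
  simp [goodPts]; tauto

open Classical in
theorem card_bad_le {L : Type} [Field L] [Fintype L] {f₁ f₂ : L[X]} (h1 : f₁ ≠ 0) (h2 : f₂ ≠ 0)
    (hd1 : f₁.natDegree ≤ 3) (hd2 : f₂.natDegree ≤ 2) :
    (Finset.univ.filter fun x : L => ¬ (X * f₁ * f₂).eval x ≠ 0).card ≤ 6 := by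
  have hne : X * f₁ * f₂ ≠ 0 := mul_ne_zero (mul_ne_zero X_ne_zero h1) h2
  have : (Finset.univ.filter fun x : L => ¬ (X * f₁ * f₂).eval x ≠ 0) ⊆
      (X * f₁ * f₂).roots.toFinset := by
    intro x hx
    rw [Multiset.mem_toFinset, mem_roots hne]
    exact not_not.1 (Finset.mem_filter.1 hx).2
  refine (Finset.card_le_card this).trans ((Multiset.toFinset_card_le _).trans
    ((card_roots' _).trans ?_))
  rw [natDegree_mul (mul_ne_zero X_ne_zero h1) h2, natDegree_mul X_ne_zero h1, natDegree_X]
  omega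

theorem card_goodPts {L : Type} [Field L] [Fintype L] {f₁ f₂ : L[X]} (h1 : f₁ ≠ 0) (h2 : f₂ ≠ 0)
    (hd1 : f₁.natDegree ≤ 3) (hd2 : f₂.natDegree ≤ 2) :
    Fintype.card L ≤ (goodPts f₁ f₂).card + 6 := by
  classical
  have := Finset.card_filter_add_card_filter_not (s := (Finset.univ : Finset L))
    (fun x => (X * f₁ * f₂).eval x ≠ 0)
  have h3 := card_bad_le h1 h2 hd1 hd2
  rw [Finset.card_univ] at this
  unfold goodPts
  omega

open Classical in
theorem eval_eq_prod_factors {L : Type} [Field L] {h : L[X]} (h0 : h ≠ 0) (S : Finset L[X])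
    (hS : (UniqueFactorizationMonoid.normalizedFactors h).toFinset ⊆ S) (x : L) :
    h.eval x = h.leadingCoeff *
      ∏ P ∈ S, (P.eval x) ^ ((UniqueFactorizationMonoid.normalizedFactors h).count P) := by
  have h1 := UniqueFactorizationMonoid.prod_normalizedFactors h0
  have hsm : ∀ P ∈ UniqueFactorizationMonoid.normalizedFactors h, P.Monic := by
    intro P hP
    have h1 := UniqueFactorizationMonoid.normalize_normalized_factor P hP
    rw [← h1]
    exact monic_normalize (UniqueFactorizationMonoid.irreducible_of_normalized_factor P hP).ne_zero
  have hm : ((UniqueFactorizationMonoid.normalizedFactors h).prod).Monic := by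
    have := monic_multiset_prod_of_monic (UniqueFactorizationMonoid.normalizedFactors h) id
      (by simpa using hsm)
    simpa using this
  have h2 : h = C h.leadingCoeff * (UniqueFactorizationMonoid.normalizedFactors h).prod := by
    obtain ⟨u, hu⟩ := h1
    obtain ⟨r, hr, hru⟩ := Polynomial.isUnit_iff.1 u.isUnit
    rw [← hru] at hu
    have : h.leadingCoeff = r := by
      rw [← hu, leadingCoeff_mul, hm.leadingCoeff, one_mul, leadingCoeff_C]
    rw [this, mul_comm]
    exact hu.symm
  conv_lhs => rw [h2]
  rw [eval_mul, eval_C, Finset.prod_multiset_count, Finset.prod_subset hS]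
  · simp [eval_prod]
  · intro P _ hP
    rw [Multiset.mem_toFinset] at hP
    rw [Multiset.count_eq_zero_of_notMem hP, pow_zero]

theorem mixed_char_bound {L : Type} [Field L] [Fintype L] {f₁ f₂ : L[X]}
    (h1 : f₁ ≠ 0) (h2 : f₂ ≠ 0) (hd1 : f₁.natDegree ≤ 3) (hd2 : f₂.natDegree ≤ 2)
    (hcop : IsCoprime f₁ f₂) {k : ℕ} {g : L[X]} (hk : 0 < k) (hgm : g.Monic) (hgi : Irreducible g)
    (hgX : g ≠ X) (hgcd : Nat.gcd k (Fintype.card L - 1) = 1) (hg1 : g ^ k ∣ f₁ * f₂)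
    (hg2 : ¬ g ^ (k + 1) ∣ f₁ * f₂) (χ₁ χ₂ : MulChar L ℂ) (ψ : AddChar L ℂ)
    (hne : ¬ (χ₁ = 1 ∧ χ₂ = 1 ∧ ψ = 1)) :
    ‖∑ x ∈ goodPts f₁ f₂, χ₁ x * χ₂ (f₁.eval x * (f₂.eval x)⁻¹) * ψ x‖ ≤
      6 * √(Fintype.card L) := by
  classical
  set Y := X * f₁ * f₂ with hY
  have hXf : X * f₁ ≠ 0 := mul_ne_zero X_ne_zero h1
  have hY0 : Y ≠ 0 := mul_ne_zero hXf h2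
  have hYd : Y.natDegree ≤ 6 := by
    rw [hY, natDegree_mul hXf h2, natDegree_mul X_ne_zero h1, natDegree_X]
    omega
  by_cases hchi : χ₁ = 1 ∧ χ₂ = 1
  · -- purely additive
    obtain ⟨rfl, rfl⟩ := hchi
    have hψ : ψ ≠ 1 := fun h => hne ⟨rfl, rfl, h⟩
    have e1 : ∑ x ∈ goodPts f₁ f₂, (1 : MulChar L ℂ) x *
        (1 : MulChar L ℂ) (f₁.eval x * (f₂.eval x)⁻¹) * ψ x = ∑ x ∈ goodPts f₁ f₂, ψ x := by
      refine Finset.sum_congr rfl fun x hx => ?_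
      obtain ⟨a, b, c⟩ := mem_goodPts.1 hx
      rw [MulChar.one_apply (IsUnit.mk0 _ a),
        MulChar.one_apply (IsUnit.mk0 _ (mul_ne_zero b (inv_ne_zero c))), one_mul, one_mul]
    have e2 : ∑ x ∈ goodPts f₁ f₂, ψ x =
        - ∑ x ∈ Finset.univ.filter (fun x : L => ¬ (X * f₁ * f₂).eval x ≠ 0), ψ x := by
      have := Finset.sum_filter_add_sum_filter_not (Finset.univ : Finset L)
        (fun x => (X * f₁ * f₂).eval x ≠ 0) (fun x => ψ x)
      rw [AddChar.sum_eq_zero_of_ne_one hψ] at this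
      exact eq_neg_of_add_eq_zero_left this
    rw [e1, e2, norm_neg]
    refine (norm_sum_le _ _).trans ?_
    simp only [AddChar.norm_apply]
    rw [Finset.sum_const, nsmul_eq_mul, mul_one]
    have h3 : ((Finset.univ.filter fun x : L => ¬ (X * f₁ * f₂).eval x ≠ 0).card : ℝ) ≤ 6 := by
      exact_mod_cast card_bad_le h1 h2 hd1 hd2
    have h4 : (1 : ℝ) ≤ √(Fintype.card L) := by
      rw [Real.one_le_sqrt]
      exact_mod_cast Fintype.card_pos
    linarith
  · set nf := fun h : L[X] => UniqueFactorizationMonoid.normalizedFactors h with hnf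
    set S := (nf Y).toFinset with hS
    have hYs : nf Y = nf X + nf f₁ + nf f₂ := by
      simp only [hnf, hY]
      rw [UniqueFactorizationMonoid.normalizedFactors_mul hXf h2,
        UniqueFactorizationMonoid.normalizedFactors_mul X_ne_zero h1]
    have hsX : (nf X).toFinset ⊆ S := by
      intro P; simp only [hS, hYs, Multiset.mem_toFinset, Multiset.mem_add]; tauto
    have hs1 : (nf f₁).toFinset ⊆ S := by
      intro P; simp only [hS, hYs, Multiset.mem_toFinset, Multiset.mem_add]; tauto
    have hs2 : (nf f₂).toFinset ⊆ S := by
      intro P; simp only [hS, hYs, Multiset.mem_toFinset, Multiset.mem_add]; tauto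
    have hSirr : ∀ P ∈ S, Irreducible P := fun P hP =>
      UniqueFactorizationMonoid.irreducible_of_normalized_factor P (Multiset.mem_toFinset.1 hP)
    have hSmon : ∀ P ∈ S, P.Monic := by
      intro P hP
      rw [← UniqueFactorizationMonoid.normalize_normalized_factor P (Multiset.mem_toFinset.1 hP)]
      exact monic_normalize (hSirr P hP).ne_zero
    let χ : S → MulChar L ℂ := fun P => χ₁ ^ (nf X).count P.1 * χ₂ ^ (nf f₁).count P.1 *
      (χ₂⁻¹) ^ (nf f₂).count P.1
    have hXS : X ∈ nf X := by
      have : nf X = {X} := by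
        simp only [hnf]
        rw [UniqueFactorizationMonoid.normalizedFactors_irreducible irreducible_X,
          monic_X.normalize_eq_self]
      rw [this]; simp
    have hcnt : ∀ P h : L[X], P.Monic → Irreducible P → h ≠ 0 → ∀ k,
        (P ^ k ∣ h ↔ k ≤ (nf h).count P) := by
      intro P h hPm hPi h0 k
      rw [pow_dvd_iff_le_emultiplicity,
        UniqueFactorizationMonoid.emultiplicity_eq_count_normalizedFactors hPi h0,
        hPm.normalize_eq_self]
      exact_mod_cast Iff.rfl
    have hcX : ∀ P : L[X], P ≠ X → (nf X).count P = 0 := by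
      intro P hP
      have : nf X = {X} := by
        simp only [hnf]
        rw [UniqueFactorizationMonoid.normalizedFactors_irreducible irreducible_X,
          monic_X.normalize_eq_self]
      rw [this, Multiset.count_singleton, if_neg hP]
    have hχ : ∃ P, χ P ≠ 1 := by
      by_cases hχ2 : χ₂ = 1
      · have hχ1 : χ₁ ≠ 1 := fun h => hchi ⟨h, hχ2⟩
        refine ⟨⟨X, hsX (Multiset.mem_toFinset.2 hXS)⟩, ?_⟩
        have : (nf X).count X = 1 := by
          have : nf X = {X} := by
            simp only [hnf]
            rw [UniqueFactorizationMonoid.normalizedFactors_irreducible irreducible_X,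
              monic_X.normalize_eq_self]
          rw [this]; simp
        simp only [χ, this, hχ2]
        simpa using hχ1
      · have hkne : χ₂ ^ k ≠ 1 := by
          intro h
          have ho1 : orderOf χ₂ ∣ k := orderOf_dvd_of_pow_eq_one h
          have ho2 : orderOf χ₂ ∣ Fintype.card L - 1 := by
            have := MulChar.orderOf_dvd_card_sub_one L χ₂
            simpa using this
          have := Nat.dvd_gcd ho1 ho2
          rw [hgcd, Nat.dvd_one, orderOf_eq_one_iff] at this
          exact hχ2 this
        have hck : (nf f₁).count g + (nf f₂).count g = k := by
          have e : nf (f₁ * f₂) = nf f₁ + nf f₂ :=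
            UniqueFactorizationMonoid.normalizedFactors_mul h1 h2
          have a := (hcnt g _ hgm hgi (mul_ne_zero h1 h2) k).1 hg1
          have b := (hcnt g _ hgm hgi (mul_ne_zero h1 h2) (k + 1)).not.1 hg2
          rw [e, Multiset.count_add] at a b
          omega
        have hz : (nf f₁).count g = 0 ∨ (nf f₂).count g = 0 := by
          by_contra hcon
          push Not at hcon
          have a := (hcnt g _ hgm hgi h1 1).2 (by omega)
          have b := (hcnt g _ hgm hgi h2 1).2 (by omega)
          rw [pow_one] at a b
          exact hgi.not_isUnit (hcop.isUnit_of_dvd' a b)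
        have hgS : g ∈ S := by
          rcases Nat.eq_zero_or_pos ((nf f₁).count g) with h | h
          · exact hs2 (Multiset.mem_toFinset.2 (Multiset.count_pos.1 (by omega)))
          · exact hs1 (Multiset.mem_toFinset.2 (Multiset.count_pos.1 h))
        refine ⟨⟨g, hgS⟩, ?_⟩
        simp only [χ, hcX g hgX, pow_zero, one_mul]
        rcases hz with h | h
        · rw [h] at hck ⊢
          rw [zero_add] at hck
          rw [hck, pow_zero, one_mul, inv_pow]
          simpa using hkne
        · rw [h] at hck ⊢
          rw [add_zero] at hck
          rw [hck, pow_zero, mul_one]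
          exact hkne
    have hw := weil_bound (fun P : S => (P.1 : L[X])) (fun P => hSirr P.1 P.2)
      (fun P => hSmon P.1 P.2) Subtype.val_injective χ ψ hχ
    have hdeg : ∑ P : S, (P.1 : L[X]).natDegree ≤ 6 := by
      refine le_trans ?_ hYd
      rw [Finset.sum_coe_sort S natDegree]
      have hd : ∏ P ∈ S, P ∣ Y := by
        have a : ∏ P ∈ S, P ∣ (nf Y).prod := by
          rw [Finset.prod_multiset_count]
          refine Finset.prod_dvd_prod_of_dvd _ _ fun P hP => dvd_pow_self _ ?_
          exact (Multiset.count_pos.2 (Multiset.mem_toFinset.1 hP)).ne'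
        exact a.trans (UniqueFactorizationMonoid.prod_normalizedFactors hY0).dvd
      rw [← natDegree_prod_of_monic _ _ hSmon]
      exact natDegree_le_of_dvd hd hY0
    set c : ℂ := χ₂ (f₁.leadingCoeff * f₂.leadingCoeff⁻¹) with hc
    have hsum : ∑ x ∈ goodPts f₁ f₂, χ₁ x * χ₂ (f₁.eval x * (f₂.eval x)⁻¹) * ψ x =
        c * ∑ x : L, (∏ P : S, χ P ((P.1 : L[X]).eval x)) * ψ x := by
      rw [Finset.mul_sum, ← Finset.sum_subset (Finset.subset_univ (goodPts f₁ f₂))]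
      · refine Finset.sum_congr rfl fun x hx => ?_
        obtain ⟨a, b, d⟩ := mem_goodPts.1 hx
        have hPx : ∀ P ∈ S, P.eval x ≠ 0 := by
          intro P hP h
          have : P ∣ Y := UniqueFactorizationMonoid.dvd_of_mem_normalizedFactors
            (Multiset.mem_toFinset.1 hP)
          obtain ⟨w, hw⟩ := this
          have h5 : Y.eval x = 0 := by rw [hw, eval_mul, h, zero_mul]
          rw [hY] at h5
          simp only [eval_mul, eval_X] at h5
          exact mul_ne_zero (mul_ne_zero a b) d h5
        have hprod : ∏ P : S, χ P ((P.1 : L[X]).eval x) =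
            χ₁ (∏ P ∈ S, P.eval x ^ (nf X).count P) * χ₂ (∏ P ∈ S, P.eval x ^ (nf f₁).count P) *
              (χ₂⁻¹) (∏ P ∈ S, P.eval x ^ (nf f₂).count P) := by
          rw [Finset.prod_coe_sort S (fun P => (χ₁ ^ (nf X).count P * χ₂ ^ (nf f₁).count P *
            (χ₂⁻¹) ^ (nf f₂).count P) (P.eval x))]
          rw [map_prod, map_prod, map_prod, ← Finset.prod_mul_distrib, ← Finset.prod_mul_distrib]
          refine Finset.prod_congr rfl fun P hP => ?_
          have hu : IsUnit (P.eval x) := IsUnit.mk0 _ (hPx P hP)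
          rw [MulChar.mul_apply, MulChar.mul_apply]
          have hpw : ∀ (η : MulChar L ℂ) (m : ℕ), (η ^ m) (P.eval x) = η (P.eval x ^ m) := by
            intro η m
            obtain ⟨u, hu⟩ := hu
            rw [← hu, MulChar.pow_apply_coe, map_pow]
          rw [hpw, hpw, hpw]
        rw [hprod]
        have ex := eval_eq_prod_factors X_ne_zero S hsX x
        have e1 := eval_eq_prod_factors h1 S hs1 x
        have e2 := eval_eq_prod_factors h2 S hs2 x
        rw [eval_X, leadingCoeff_X, one_mul] at ex
        rw [← ex, e1, e2, MulChar.inv_apply', hc, mul_inv]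
        simp only [map_mul]
        ring
      · intro x _ hx
        have hYx : Y.eval x = 0 := by
          by_contra h
          exact hx (Finset.mem_filter.2 ⟨Finset.mem_univ _, h⟩)
        have eY := eval_eq_prod_factors hY0 S subset_rfl x
        rw [hYx] at eY
        have h6 := (mul_eq_zero.1 eY.symm).resolve_left (leadingCoeff_ne_zero.2 hY0)
        obtain ⟨P, hP, hP0⟩ := Finset.prod_eq_zero_iff.1 h6
        have hP1 : P.eval x = 0 := pow_eq_zero_iff (Multiset.count_pos.2 (Multiset.mem_toFinset.1 hP)).ne' |>.1 hP0
        rw [Finset.prod_eq_zero (Finset.mem_univ (⟨P, hP⟩ : S))]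
        · ring
        · simp only [hP1]
          exact MulChar.map_zero _
    rw [hsum, norm_mul]
    have hcn : ‖c‖ ≤ 1 := mulChar_norm_le_one _ _
    calc ‖c‖ * _ ≤ 1 * _ := by gcongr
      _ ≤ _ := by
        rw [one_mul]
        refine hw.trans ?_
        gcongr
        exact_mod_cast hdeg


open Classical in
/-- the monic irreducible factors of `x^n - 1` -/
noncomputable def facs (K : Type) [Field K] (n : ℕ) : Finset K[X] :=
  (UniqueFactorizationMonoid.normalizedFactors (X ^ n - 1 : K[X])).toFinset

theorem xn_ne_zero (K : Type) [Field K] {n : ℕ} (hn : 0 < n) : (X ^ n - 1 : K[X]) ≠ 0 :=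
  (monic_X_pow_sub_C (1 : K) hn.ne').ne_zero

theorem mem_facs {K : Type} [Field K] {n : ℕ} (hn : 0 < n) {P : K[X]} :
    P ∈ facs K n ↔ P.Monic ∧ Irreducible P ∧ P ∣ X ^ n - 1 := by
  classical
  unfold facs
  rw [Multiset.mem_toFinset]
  constructor
  · intro h
    have hi := UniqueFactorizationMonoid.irreducible_of_normalized_factor P h
    refine ⟨?_, hi, UniqueFactorizationMonoid.dvd_of_mem_normalizedFactors h⟩
    rw [← UniqueFactorizationMonoid.normalize_normalized_factor P h]
    exact monic_normalize hi.ne_zero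
  · rintro ⟨h1, h2, h3⟩
    obtain ⟨P', hP', ha⟩ := UniqueFactorizationMonoid.exists_mem_normalizedFactors_of_dvd
      (xn_ne_zero K hn) h2 h3
    have hi := UniqueFactorizationMonoid.irreducible_of_normalized_factor P' hP'
    have hm : P'.Monic := by
      rw [← UniqueFactorizationMonoid.normalize_normalized_factor P' hP']
      exact monic_normalize hi.ne_zero
    rwa [eq_of_monic_of_associated h1 hm ha]

/-- Frobenius as a linear map -/
noncomputable def frob (K L : Type) [Field K] [Fintype K] [Field L] [Algebra K L] :
    Module.End K L := (FiniteField.frobeniusAlgHom K L).toLinearMap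

theorem frob_pow_apply {K L : Type} [Field K] [Fintype K] [Field L] [Algebra K L] (i : ℕ) (x : L) :
    (frob K L ^ i) x = x ^ Fintype.card K ^ i := by
  induction i with
  | zero => simp
  | succ i ih =>
    rw [pow_succ', Module.End.mul_apply, ih]
    simp [frob, pow_succ, pow_mul]

theorem minpoly_frob (K L : Type) [Field K] [Fintype K] [Field L] [Fintype L] [Algebra K L] {n : ℕ}
    (hn : Module.finrank K L = n) : minpoly K (frob K L) = X ^ n - 1 := by
  rw [frob, FiniteField.minpoly_frobeniusAlgHom, hn]

theorem aeval_frob_xn (K L : Type) [Field K] [Fintype K] [Field L] [Fintype L] [Algebra K L] {n : ℕ}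
    (hn : Module.finrank K L = n) : aeval (frob K L) (X ^ n - 1 : K[X]) = 0 := by
  rw [← minpoly_frob K L hn, minpoly.aeval]

/-- the cofactor `(x^n-1)/P` -/
noncomputable def cof {K : Type} [Field K] (n : ℕ) (P : K[X]) : K[X] := (X ^ n - 1) /ₘ P

theorem cof_mul {K : Type} [Field K] {n : ℕ} {P : K[X]} (hm : P.Monic) (hd : P ∣ X ^ n - 1) :
    P * cof n P = X ^ n - 1 := by
  have h1 := modByMonic_add_div (X ^ n - 1 : K[X]) P
  rw [(modByMonic_eq_zero_iff_dvd hm).2 hd, zero_add] at h1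
  exact h1

theorem normal_of_cof {K L : Type} [Field K] [Fintype K] [Field L] [Fintype L] [Algebra K L]
    {n : ℕ} (hn : Module.finrank K L = n) (hn0 : 0 < n) {α : L}
    (h : ∀ P ∈ facs K n, aeval (frob K L) (cof n P) α ≠ 0) : IsNormalElem K n α := by
  classical
  have hE : FiniteDimensional K L := Module.Finite.of_finite
  have hli : LinearIndependent K (fun i : Fin n => α ^ Fintype.card K ^ (i : ℕ)) := by
    rw [Fintype.linearIndependent_iff]
    intro c hc
    set g : K[X] := ∑ i : Fin n, C (c i) * X ^ (i : ℕ) with hg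
    have hgc : ∀ i : Fin n, g.coeff i = c i := by
      intro i
      rw [hg, finsetSum_coeff]
      simp only [coeff_C_mul, coeff_X_pow, mul_ite, mul_one, mul_zero]
      rw [Finset.sum_eq_single i]
      · simp
      · intro b _ hb
        rw [if_neg]
        exact fun hh => hb (Fin.ext hh.symm)
      · simp
    have hgα : aeval (frob K L) g α = 0 := by
      rw [hg, map_sum, LinearMap.sum_apply, ← hc]
      refine Finset.sum_congr rfl fun i _ => ?_
      rw [map_mul, map_pow, aeval_X, aeval_C, Module.End.mul_apply, frob_pow_apply,
        Module.algebraMap_end_apply]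
    by_cases hg0 : g = 0
    · intro i; rw [← hgc, hg0, coeff_zero]
    exfalso
    have hgd : g.natDegree < n := by
      rw [natDegree_lt_iff_degree_lt hg0]
      rw [hg]
      refine (degree_sum_le _ _).trans_lt ?_
      refine (Finset.sup_lt_iff (WithBot.bot_lt_coe n)).2 fun i _ => ?_
      refine (degree_C_mul_X_pow_le _ _).trans_lt ?_
      exact WithBot.coe_lt_coe.2 i.2
    set d := EuclideanDomain.gcd g (X ^ n - 1) with hd
    have hdα : aeval (frob K L) d α = 0 := by
      rw [hd, EuclideanDomain.gcd_eq_gcd_ab, map_add, map_mul _ (X ^ n - 1) _, aeval_frob_xn K L hn,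
        zero_mul, add_zero, mul_comm g, map_mul, Module.End.mul_apply, hgα, map_zero]
    obtain ⟨e, he⟩ := EuclideanDomain.gcd_dvd_right g (X ^ n - 1 : K[X])
    rw [← hd] at he
    have hdd : d.natDegree < n :=
      (natDegree_le_of_dvd (EuclideanDomain.gcd_dvd_left g (X ^ n - 1 : K[X])) hg0).trans_lt hgd
    have heu : ¬ IsUnit e := by
      intro hu
      have h1 : (X ^ n - 1 : K[X]).natDegree = d.natDegree := by
        have hde : d * e ≠ 0 := by rw [← he]; exact xn_ne_zero K hn0
        rw [he, natDegree_mul (left_ne_zero_of_mul hde) (right_ne_zero_of_mul hde),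
          natDegree_eq_zero_of_isUnit hu, add_zero]
      have h2 : (X ^ n - 1 : K[X]).natDegree = n := natDegree_X_pow_sub_C (r := (1 : K))
      omega
    have he0 : e ≠ 0 := by
      rintro rfl
      exact xn_ne_zero K hn0 (by rw [he, mul_zero])
    obtain ⟨P, hPm, hPi, hPe⟩ := exists_monic_irreducible_factor e heu
    have hPf : P ∈ facs K n := (mem_facs hn0).2 ⟨hPm, hPi, by rw [he]; exact hPe.mul_left d⟩
    obtain ⟨w, hw⟩ := hPe
    have h1 := cof_mul hPm ((mem_facs hn0).1 hPf).2.2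
    have h2 : cof n P = w * d := by
      refine mul_left_cancel₀ hPm.ne_zero ?_
      rw [h1, he, hw]; ring
    refine h P hPf ?_
    rw [h2, map_mul, Module.End.mul_apply, hdα, map_zero]
  refine ⟨hli, ?_⟩
  have : Nonempty (Fin n) := ⟨⟨0, hn0⟩⟩
  exact hli.span_eq_top_of_card_eq_finrank (by rw [Fintype.card_fin, hn])

theorem card_range_cof {K L : Type} [Field K] [Fintype K] [Field L] [Fintype L] [Algebra K L]
    {n : ℕ} (hn : Module.finrank K L = n) (hn0 : 0 < n) {P : K[X]} (hP : P ∈ facs K n) :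
    Fintype.card K ^ P.natDegree ≤ Nat.card (LinearMap.range (aeval (frob K L) (cof n P))) := by
  obtain ⟨hPm, hPi, hPd⟩ := (mem_facs hn0).1 hP
  have hcm := cof_mul hPm hPd
  have hc0 : cof n P ≠ 0 := by
    intro h; rw [h, mul_zero] at hcm; exact xn_ne_zero K hn0 hcm.symm
  have hne : aeval (frob K L) (cof n P) ≠ 0 := by
    intro h
    have h1 := minpoly.dvd K _ h
    rw [minpoly_frob K L hn] at h1
    have h2 := natDegree_le_of_dvd h1 hc0
    rw [← hcm, natDegree_mul hPm.ne_zero hc0] at h2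
    have := hPi.natDegree_pos
    omega
  obtain ⟨v, hv⟩ : ∃ v, aeval (frob K L) (cof n P) v ≠ 0 := by
    by_contra hcon
    push Not at hcon
    exact hne (LinearMap.ext hcon)
  set w := aeval (frob K L) (cof n P) v with hw
  have hPw : aeval (frob K L) P w = 0 := by
    rw [hw, ← Module.End.mul_apply, ← map_mul, hcm, aeval_frob_xn K L hn, LinearMap.zero_apply]
  have hcard : Nat.card (degreeLT K P.natDegree) = Fintype.card K ^ P.natDegree := by
    rw [Nat.card_congr (degreeLTEquiv K P.natDegree).toEquiv, Nat.card_eq_fintype_card,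
      Fintype.card_fun, Fintype.card_fin]
  rw [← hcard]
  refine Nat.card_le_card_of_injective (fun g : degreeLT K P.natDegree =>
    (⟨aeval (frob K L) g.1 w, ⟨aeval (frob K L) g.1 v, ?_⟩⟩ :
      LinearMap.range (aeval (frob K L) (cof n P)))) ?_
  · rw [hw, ← Module.End.mul_apply, ← Module.End.mul_apply, ← map_mul, ← map_mul, mul_comm]
  · intro a b hab
    replace hab : aeval (frob K L) a.1 w = aeval (frob K L) b.1 w := congrArg Subtype.val hab
    have h1 : aeval (frob K L) (a.1 - b.1) w = 0 := by
      rw [map_sub, LinearMap.sub_apply, hab, sub_self]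
    by_contra hne
    have h2 : a.1 - b.1 ≠ 0 := fun h => hne (Subtype.ext (sub_eq_zero.1 h))
    have h3 : (a.1 - b.1).natDegree < P.natDegree := by
      have := (degreeLT K P.natDegree).sub_mem a.2 b.2
      rw [mem_degreeLT] at this
      exact (natDegree_lt_iff_degree_lt h2).2 this
    have h4 : IsCoprime P (a.1 - b.1) := by
      rw [hPi.coprime_iff_not_dvd]
      intro h
      have := natDegree_le_of_dvd h h2
      omega
    obtain ⟨r, s, hrs⟩ := h4
    apply hv
    calc w = aeval (frob K L) (1 : K[X]) w := by simp
      _ = 0 := by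
        rw [← hrs, map_add, map_mul, map_mul, LinearMap.add_apply, Module.End.mul_apply,
          Module.End.mul_apply, hPw, h1, map_zero, map_zero, add_zero]


/-- triples of characters -/
abbrev Gam (L : Type) [Field L] : Type := MulChar L ℂ × MulChar L ℂ × AddChar L ℂ

/-- embeddings of the three factors -/
noncomputable def iot1 (L : Type) [Field L] : MulChar L ℂ →* Gam L := MonoidHom.inl _ _
/-- second embedding -/
noncomputable def iot2 (L : Type) [Field L] : MulChar L ℂ →* Gam L :=
  (MonoidHom.inr _ _).comp (MonoidHom.inl _ _)
/-- third embedding -/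
noncomputable def iot3 (L : Type) [Field L] : AddChar L ℂ →* Gam L :=
  (MonoidHom.inr _ _).comp (MonoidHom.inr _ _)

theorem iot1_apply {L : Type} [Field L] (χ : MulChar L ℂ) : iot1 L χ = (χ, 1, 1) := rfl
theorem iot2_apply {L : Type} [Field L] (χ : MulChar L ℂ) : iot2 L χ = (1, χ, 1) := rfl
theorem iot3_apply {L : Type} [Field L] (ψ : AddChar L ℂ) : iot3 L ψ = (1, 1, ψ) := rfl

/-- pull back of additive characters along an endomorphism -/
noncomputable def pullB {L M : Type} [AddCommGroup L] [AddCommGroup M] (u : L →+ M) :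
    AddChar M ℂ →* AddChar L ℂ where
  toFun ρ := ρ.compAddMonoidHom u
  map_one' := by ext x; simp
  map_mul' a b := by ext x; simp

theorem pullB_apply {L M : Type} [AddCommGroup L] [AddCommGroup M] (u : L →+ M)
    (ρ : AddChar M ℂ) (x : L) : pullB u ρ x = ρ (u x) := rfl

/-- characters that factor through the cofactor of `P` -/
noncomputable def subP (K L : Type) [Field K] [Fintype K] [Field L] [Algebra K L] (n : ℕ)
    (P : K[X]) : Subgroup (AddChar L ℂ) :=
  (pullB ((aeval (frob K L) (cof n P)).rangeRestrict.toAddMonoidHom)).range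

theorem card_subP {K L : Type} [Field K] [Fintype K] [Field L] [Fintype L] [Algebra K L]
    {n : ℕ} (hn : Module.finrank K L = n) (hn0 : 0 < n) {P : K[X]} (hP : P ∈ facs K n) :
    Fintype.card K ^ P.natDegree ≤ Nat.card (subP K L n P) := by
  refine (card_range_cof hn hn0 hP).trans ?_
  set R := LinearMap.range (aeval (frob K L) (cof n P)) with hR
  have h1 : Nat.card (AddChar R ℂ) = Nat.card R := by
    have : Fintype R := Fintype.ofFinite _
    rw [Nat.card_eq_fintype_card, Nat.card_eq_fintype_card, AddChar.card_eq]
  rw [← h1]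
  have hinj : Function.Injective
      (pullB ((aeval (frob K L) (cof n P)).rangeRestrict.toAddMonoidHom)) := by
    intro a b hab
    ext ⟨x, y, rfl⟩
    exact DFunLike.congr_fun hab y
  exact (Nat.card_congr (MonoidHom.ofInjective hinj).toEquiv).le

theorem exists_subP_ne {K L : Type} [Field K] [Fintype K] [Field L] [Fintype L] [Algebra K L]
    {n : ℕ} {P : K[X]} {x : L} (h : ∃ ψ ∈ subP K L n P, ψ x ≠ 1) :
    aeval (frob K L) (cof n P) x ≠ 0 := by
  rintro h0
  obtain ⟨ψ, ⟨ρ, rfl⟩, hψ⟩ := h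
  apply hψ
  rw [pullB_apply]
  have : (aeval (frob K L) (cof n P)).rangeRestrict.toAddMonoidHom x = 0 := Subtype.ext h0
  rw [this, AddChar.map_zero_eq_one]

theorem subP_proj {K L : Type} [Field K] [Fintype K] [Field L] [Fintype L] [Algebra K L]
    {n : ℕ} (hn : Module.finrank K L = n) (hn0 : 0 < n) {P : K[X]} (hP : P ∈ facs K n) :
    ∃ S : AddChar L ℂ →* AddChar L ℂ, (∀ ψ ∈ subP K L n P, S ψ = ψ) ∧
      ∀ P' ∈ facs K n, P' ≠ P → ∀ ψ ∈ subP K L n P', S ψ = 1 := by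
  classical
  obtain ⟨hPm, hPi, hPd⟩ := (mem_facs hn0).1 hP
  have hcop : IsCoprime P (∏ P' ∈ (facs K n).erase P, P') := by
    refine IsCoprime.prod_right fun P' hP' => ?_
    obtain ⟨hne, hP'⟩ := Finset.mem_erase.1 hP'
    obtain ⟨hPm', hPi', hPd'⟩ := (mem_facs hn0).1 hP'
    rw [hPi.coprime_iff_not_dvd]
    intro hd
    exact hne (eq_of_monic_of_associated hPm' hPm ((hPi.associated_of_dvd hPi' hd).symm))
  obtain ⟨a, b, hab⟩ := hcop
  set u := b * ∏ P' ∈ (facs K n).erase P, P' with hu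
  refine ⟨pullB (aeval (frob K L) u).toAddMonoidHom, ?_, ?_⟩
  · rintro ψ ⟨ρ, rfl⟩
    ext x
    rw [pullB_apply, pullB_apply, pullB_apply]
    congr 1
    refine Subtype.ext ?_
    change aeval (frob K L) (cof n P) (aeval (frob K L) u x) = aeval (frob K L) (cof n P) x
    have h1 : cof n P = a * (X ^ n - 1) + cof n P * u := by
      rw [← cof_mul hPm hPd]
      linear_combination (- cof n P) * hab
    conv_rhs => rw [h1]
    rw [map_add, map_mul _ a, map_mul _ (cof n P), aeval_frob_xn K L hn, mul_zero, zero_add,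
      Module.End.mul_apply]
  · rintro P' hP' hne ψ ⟨ρ, rfl⟩
    obtain ⟨hPm', hPi', hPd'⟩ := (mem_facs hn0).1 hP'
    ext x
    rw [pullB_apply, pullB_apply, AddChar.one_apply]
    have : (aeval (frob K L) (cof n P')).rangeRestrict.toAddMonoidHom
        ((aeval (frob K L) u).toAddMonoidHom x) = 0 := by
      refine Subtype.ext ?_
      change aeval (frob K L) (cof n P') (aeval (frob K L) u x) = 0
      obtain ⟨w, hw⟩ : P' ∣ u :=
        (Finset.dvd_prod_of_mem (fun y => y) (Finset.mem_erase.2 ⟨hne, hP'⟩)).mul_left b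
      rw [← Module.End.mul_apply, ← map_mul, hw, ← mul_assoc, mul_comm (cof n P') P',
        cof_mul hPm' hPd', map_mul, aeval_frob_xn K L hn, zero_mul, LinearMap.zero_apply]
    rw [this, AddChar.map_zero_eq_one]

theorem mul_proj {G : Type} [CommGroup G] (N : Finset ℕ) (hN : ∀ p ∈ N, p.Prime) (χ : ℕ → G)
    (hχ : ∀ p ∈ N, orderOf (χ p) = p) {p : ℕ} (hp : p ∈ N) :
    ∃ S : G →* G, (∀ γ ∈ Subgroup.zpowers (χ p), S γ = γ) ∧
      ∀ p' ∈ N, p' ≠ p → ∀ γ ∈ Subgroup.zpowers (χ p'), S γ = 1 := by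
  classical
  have hcop : Nat.Coprime p (∏ p' ∈ N.erase p, p') := by
    refine Nat.Coprime.prod_right fun p' hp' => ?_
    obtain ⟨hne, hp'⟩ := Finset.mem_erase.1 hp'
    exact (Nat.coprime_primes (hN p hp) (hN p' hp')).2 hne.symm
  obtain ⟨u, hu1, hu2⟩ := Nat.chineseRemainder hcop 1 0
  have key : ∀ g : G, g ^ u = g → ∀ γ ∈ Subgroup.zpowers g, powMonoidHom u γ = γ := by
    rintro g hg γ ⟨k, rfl⟩
    change (g ^ k) ^ u = g ^ k
    rw [← zpow_natCast, ← zpow_mul, mul_comm, zpow_mul, zpow_natCast, hg]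
  refine ⟨powMonoidHom u, key _ ?_, ?_⟩
  · have : χ p ^ u = χ p ^ 1 := by
      rw [pow_eq_pow_iff_modEq, hχ p hp]; exact hu1
    rwa [pow_one] at this
  · rintro p' hp' hne γ ⟨k, rfl⟩
    have hd : p' ∣ u := (Finset.dvd_prod_of_mem (fun y => y) (Finset.mem_erase.2 ⟨hne, hp'⟩)).trans
      ((Nat.modEq_zero_iff_dvd).1 hu2)
    have h1 : χ p' ^ u = 1 := by
      rw [← orderOf_dvd_iff_pow_eq_one, hχ p' hp']; exact hd
    change (χ p' ^ k) ^ u = 1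
    rw [← zpow_natCast, ← zpow_mul, mul_comm, zpow_mul, zpow_natCast, h1, one_zpow]

theorem primitive_of_chars {L : Type} [Field L] [Fintype L] {x : L} (hx : x ≠ 0)
    (χ : ℕ → MulChar L ℂ) (hχ : ∀ p ∈ (Fintype.card L - 1).primeFactors, orderOf (χ p) = p)
    (h : ∀ p ∈ (Fintype.card L - 1).primeFactors, ∃ γ ∈ Subgroup.zpowers (χ p), γ x ≠ 1) :
    IsPrimitiveElem x := by
  classical
  unfold IsPrimitiveElem
  have hQ : 0 < Fintype.card L - 1 := by
    have := Fintype.one_lt_card (α := L); omega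
  have hdvd : orderOf x ∣ Fintype.card L - 1 :=
    orderOf_dvd_of_pow_eq_one (FiniteField.pow_card_sub_one_eq_one x hx)
  by_contra hne
  obtain ⟨m, hm⟩ := hdvd
  have hm1 : m ≠ 1 := by rintro rfl; exact hne (by omega)
  obtain ⟨p, hp, hpm⟩ := Nat.exists_prime_and_dvd hm1
  have hpQ : p ∣ Fintype.card L - 1 := hm ▸ hpm.mul_left _
  have hpN : p ∈ (Fintype.card L - 1).primeFactors := Nat.mem_primeFactors.2 ⟨hp, hpQ, hQ.ne'⟩
  obtain ⟨γ, ⟨k, rfl⟩, hγ⟩ := h p hpN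
  -- `x` is a `p`-th power
  obtain ⟨ζ, hζ⟩ := IsCyclic.exists_generator (α := Lˣ)
  obtain ⟨j, hj⟩ := (Submonoid.mem_powers_iff _ _).1 (mem_powers_iff_mem_zpowers.2 (hζ (Units.mk0 x hx)))
  have hoζ : orderOf ζ = Fintype.card L - 1 := by
    rw [orderOf_eq_card_of_forall_mem_zpowers hζ, Nat.card_eq_fintype_card, Fintype.card_units]
  have hpj : p ∣ j := by
    obtain ⟨t, ht⟩ := hpm
    have h1 : ζ ^ (j * orderOf x) = 1 := by
      rw [pow_mul, hj, Units.ext_iff, Units.val_pow_eq_pow_val, Units.val_mk0, pow_orderOf_eq_one]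
      rfl
    have h2 := orderOf_dvd_of_pow_eq_one h1
    rw [hoζ, hm, mul_comm j] at h2
    have h3 : m ∣ j := Nat.dvd_of_mul_dvd_mul_left (by
      rcases Nat.eq_zero_or_pos (orderOf x) with h0 | h0
      · rw [h0, zero_mul] at hm; omega
      · exact h0) h2
    exact (ht ▸ Dvd.intro t rfl : p ∣ m).trans h3
  obtain ⟨i, rfl⟩ := hpj
  apply hγ
  have hx' : x = (ζ : L) ^ (p * i) := by
    rw [← Units.val_pow_eq_pow_val, hj, Units.val_mk0]
  have h4 : (χ p ^ k) ^ p = 1 := by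
    rw [← zpow_natCast, ← zpow_mul, mul_comm, zpow_mul, zpow_natCast,
      orderOf_dvd_iff_pow_eq_one.1 (hχ p hpN).dvd, one_zpow]
  change (χ p ^ k) x = 1
  rw [hx', mul_comm, pow_mul, map_pow, ← MulChar.pow_apply' _ hp.ne_zero, h4, ← Units.val_pow_eq_pow_val,
    MulChar.one_apply_coe]


theorem criterion {K L : Type} [Field K] [Field L] [Fintype K] [Fintype L] [Algebra K L]
    {n : ℕ} (hn0 : 0 < n) (hL : Fintype.card L = Fintype.card K ^ n)
    {f : RatFunc L} (hf : f ∈ Upsilon L 3 2)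
    (C1 S1 C2 S2 : Finset ℕ) (C3 S3 : Finset K[X])
    (hd1 : Disjoint C1 S1) (hd2 : Disjoint C2 S2) (hd3 : Disjoint C3 S3)
    (hu1 : ∀ p, p ∈ (Fintype.card L - 1).primeFactors ↔ p ∈ C1 ∨ p ∈ S1)
    (hu2 : ∀ p, p ∈ (Fintype.card L - 1).primeFactors ↔ p ∈ C2 ∨ p ∈ S2)
    (hu3 : ∀ P, P ∈ facs K n ↔ P ∈ C3 ∨ P ∈ S3)
    (c s : ℕ) (hs : 1 ≤ s) (δ : ℝ) (hδ0 : 0 < δ)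
    (hc : C1.card + C2.card + C3.card ≤ c) (hs' : S1.card + S2.card + S3.card ≤ s)
    (hδ : δ ≤ 1 - (∑ p ∈ S1, (p : ℝ)⁻¹ + ∑ p ∈ S2, (p : ℝ)⁻¹ +
      ∑ P ∈ S3, ((Fintype.card K : ℝ) ^ P.natDegree)⁻¹))
    (hmain : 6 * √(Fintype.card L) * (2 ^ c * (s - 1) + δ * (2 ^ (c + 1) - 1)) <
      δ * (Fintype.card L - 6)) :
    ∃ α : L, IsPrimitiveElem α ∧ IsNormalElem K n α ∧ IsPrimitiveElem (ratEval f α) := by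
  classical
  obtain ⟨f₁, f₂, hf2, hff, hdeg1, hdeg2, hcop, k, g, hk, hgm, hgi, hgX, hgcd, hg1, hg2⟩ := hf
  have hf1 : f₁ ≠ 0 := by
    rintro rfl
    rw [zero_mul] at hg2
    exact hg2 (dvd_zero _)
  have hfin : Module.finrank K L = n := by
    have h1 := Module.card_eq_pow_finrank (K := K) (V := L)
    rw [hL] at h1
    exact (Nat.pow_right_injective Fintype.one_lt_card h1).symm
  set N := (Fintype.card L - 1).primeFactors with hN
  have hNp : ∀ p ∈ N, p.Prime := fun p hp => (Nat.mem_primeFactors.1 hp).1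
  have hχ : ∀ p : ℕ, ∃ χ : MulChar L ℂ, p ∈ N → orderOf χ = p := by
    intro p
    by_cases hp : p ∈ N
    · obtain ⟨χ, h⟩ := MulChar.exists_mulChar_orderOf L (n := p) (Nat.mem_primeFactors.1 hp).2.1
        (Complex.isPrimitiveRoot_exp p (hNp p hp).ne_zero)
      exact ⟨χ, fun _ => h⟩
    · exact ⟨1, fun h => absurd h hp⟩
  choose χ hχ using hχ
  have : Fintype (Gam L) := Fintype.ofFinite _
  let e : Gam L → L → ℂ := fun γ x =>
    γ.1 x * γ.2.1 (f₁.eval x * (f₂.eval x)⁻¹) * γ.2.2 x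
  let I := ({p // p ∈ N} ⊕ {p // p ∈ N}) ⊕ {P // P ∈ facs K n}
  let A : I → Subgroup (Gam L) := Sum.elim (Sum.elim
    (fun p => (Subgroup.zpowers (χ p.1)).map (iot1 L))
    (fun p => (Subgroup.zpowers (χ p.1)).map (iot2 L)))
    (fun P => (subP K L n P.1).map (iot3 L))
  have hi1 : Function.Injective (iot1 L) := fun a b h => (Prod.ext_iff.1 h).1
  have hi2 : Function.Injective (iot2 L) := fun a b h => (Prod.ext_iff.1 (Prod.ext_iff.1 h).2).1
  have hi3 : Function.Injective (iot3 L) := fun a b h => (Prod.ext_iff.1 (Prod.ext_iff.1 h).2).2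
  have hcA1 : ∀ p : {p // p ∈ N}, Nat.card (A (Sum.inl (Sum.inl p))) = p.1 := by
    intro p
    change Nat.card ((Subgroup.zpowers (χ p.1)).map (iot1 L)) = _
    rw [← Nat.card_congr ((Subgroup.zpowers (χ p.1)).equivMapOfInjective _ hi1).toEquiv,
      Nat.card_zpowers, hχ p.1 p.2]
  have hcA2 : ∀ p : {p // p ∈ N}, Nat.card (A (Sum.inl (Sum.inr p))) = p.1 := by
    intro p
    change Nat.card ((Subgroup.zpowers (χ p.1)).map (iot2 L)) = _
    rw [← Nat.card_congr ((Subgroup.zpowers (χ p.1)).equivMapOfInjective _ hi2).toEquiv,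
      Nat.card_zpowers, hχ p.1 p.2]
  have hcA3 : ∀ P : {P // P ∈ facs K n},
      Fintype.card K ^ P.1.natDegree ≤ Nat.card (A (Sum.inr P)) := by
    intro P
    change _ ≤ Nat.card ((subP K L n P.1).map (iot3 L))
    rw [← Nat.card_congr ((subP K L n P.1).equivMapOfInjective _ hi3).toEquiv]
    exact card_subP hfin hn0 P.2
  have hK1 : 1 < Fintype.card K := Fintype.one_lt_card
  set C : Finset I := Finset.disjSum (Finset.disjSum (C1.subtype (· ∈ N)) (C2.subtype (· ∈ N)))
    (C3.subtype (· ∈ facs K n)) with hC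
  set S : Finset I := Finset.disjSum (Finset.disjSum (S1.subtype (· ∈ N)) (S2.subtype (· ∈ N)))
    (S3.subtype (· ∈ facs K n)) with hS
  have hsub : ∀ {α : Type} (T : Finset α) (p : α → Prop) [DecidablePred p], (∀ x ∈ T, p x) →
      (T.subtype p).card = T.card := by
    intro α T p _ h
    rw [Finset.card_subtype, Finset.filter_true_of_mem h]
  have hCc : C.card ≤ c := by
    rw [hC, Finset.card_disjSum, Finset.card_disjSum, hsub, hsub, hsub]
    · exact hc
    · exact fun P h => (hu3 P).2 (Or.inl h)
    · exact fun P h => (hu2 P).2 (Or.inl h)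
    · exact fun P h => (hu1 P).2 (Or.inl h)
  have hSc : S.card ≤ s := by
    rw [hS, Finset.card_disjSum, Finset.card_disjSum, hsub, hsub, hsub]
    · exact hs'
    · exact fun P h => (hu3 P).2 (Or.inr h)
    · exact fun P h => (hu2 P).2 (Or.inr h)
    · exact fun P h => (hu1 P).2 (Or.inr h)
  have hm1 : ∀ (T1 T2 : Finset ℕ) (T3 : Finset K[X]) (p : {p // p ∈ N}),
      (Sum.inl (Sum.inl p) : I) ∈ Finset.disjSum (Finset.disjSum (T1.subtype (· ∈ N))
        (T2.subtype (· ∈ N))) (T3.subtype (· ∈ facs K n)) ↔ p.1 ∈ T1 := fun T1 T2 T3 p =>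
    Finset.inl_mem_disjSum.trans (Finset.inl_mem_disjSum.trans Finset.mem_subtype)
  have hm2 : ∀ (T1 T2 : Finset ℕ) (T3 : Finset K[X]) (p : {p // p ∈ N}),
      (Sum.inl (Sum.inr p) : I) ∈ Finset.disjSum (Finset.disjSum (T1.subtype (· ∈ N))
        (T2.subtype (· ∈ N))) (T3.subtype (· ∈ facs K n)) ↔ p.1 ∈ T2 := fun T1 T2 T3 p =>
    Finset.inl_mem_disjSum.trans (Finset.inr_mem_disjSum.trans Finset.mem_subtype)
  have hm3 : ∀ (T1 T2 : Finset ℕ) (T3 : Finset K[X]) (P : {P // P ∈ facs K n}),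
      (Sum.inr P : I) ∈ Finset.disjSum (Finset.disjSum (T1.subtype (· ∈ N))
        (T2.subtype (· ∈ N))) (T3.subtype (· ∈ facs K n)) ↔ P.1 ∈ T3 := fun T1 T2 T3 p =>
    Finset.inr_mem_disjSum.trans Finset.mem_subtype
  have hdCS : Disjoint C S := by
    rw [Finset.disjoint_left]
    rintro ((p | p) | P) h1 h2
    · exact Finset.disjoint_left.1 hd1 ((hm1 _ _ _ _).1 h1) ((hm1 _ _ _ _).1 h2)
    · exact Finset.disjoint_left.1 hd2 ((hm2 _ _ _ _).1 h1) ((hm2 _ _ _ _).1 h2)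
    · exact Finset.disjoint_left.1 hd3 ((hm3 _ _ _ _).1 h1) ((hm3 _ _ _ _).1 h2)
  have hCSu : ∀ i, i ∈ C ∪ S := by
    rintro ((p | p) | P)
    · exact Finset.mem_union.2 (((hu1 p.1).1 p.2).imp (hm1 _ _ _ _).2 (hm1 _ _ _ _).2)
    · exact Finset.mem_union.2 (((hu2 p.1).1 p.2).imp (hm2 _ _ _ _).2 (hm2 _ _ _ _).2)
    · exact Finset.mem_union.2 (((hu3 P.1).1 P.2).imp (hm3 _ _ _ _).2 (hm3 _ _ _ _).2)
  set δ' : ℝ := 1 - ∑ i ∈ S, (Nat.card (A i) : ℝ)⁻¹ with hδ'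
  have hδδ : δ ≤ δ' := by
    refine hδ.trans ?_
    rw [hδ']
    refine sub_le_sub_left ?_ _
    rw [hS, Finset.sum_disjSum, Finset.sum_disjSum]
    refine add_le_add (add_le_add ?_ ?_) ?_
    · simp only [hcA1]
      rw [Finset.sum_subtype_of_mem (fun p : ℕ => (p : ℝ)⁻¹) (fun P h => (hu1 P).2 (Or.inr h))]
    · simp only [hcA2]
      rw [Finset.sum_subtype_of_mem (fun p : ℕ => (p : ℝ)⁻¹) (fun P h => (hu2 P).2 (Or.inr h))]
    · rw [← Finset.sum_subtype_of_mem (fun P : K[X] => ((Fintype.card K : ℝ) ^ P.natDegree)⁻¹)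
        (fun P h => (hu3 P).2 (Or.inr h))]
      refine Finset.sum_le_sum fun P _ => ?_
      refine inv_anti₀ (by positivity) ?_
      exact_mod_cast hcA3 P
  have hM : ∀ γ : Gam L, γ ≠ 1 → ‖∑ t ∈ goodPts f₁ f₂, e γ t‖ ≤ 6 * √(Fintype.card L) := by
    rintro ⟨χ₁, χ₂, ψ⟩ hγ
    refine mixed_char_bound hf1 hf2 hdeg1 hdeg2 hcop hk hgm hgi hgX hgcd hg1 hg2 χ₁ χ₂ ψ ?_
    rintro ⟨rfl, rfl, rfl⟩
    exact hγ rfl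
  have key : ∃ x ∈ goodPts f₁ f₂, ∀ i ∈ C ∪ S, ∃ γ ∈ A i, e γ x ≠ 1 := by
    refine abstract_sieve e (goodPts f₁ f₂) ?_ ?_ (6 * √(Fintype.card L))
      (by positivity) hM A ?_ ?_ C S hdCS δ' rfl (hδ0.trans_le hδδ) ?_
    · intro t ht
      obtain ⟨hx0, hx1, hx2⟩ := mem_goodPts.1 ht
      change (1 : MulChar L ℂ) t * (1 : MulChar L ℂ) _ * (1 : AddChar L ℂ) t = 1
      rw [MulChar.one_apply (isUnit_iff_ne_zero.2 hx0), MulChar.one_apply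
        (isUnit_iff_ne_zero.2 (mul_ne_zero hx1 (inv_ne_zero hx2))), AddChar.one_apply]
      norm_num
    · rintro t - ⟨a1, a2, a3⟩ ⟨b1, b2, b3⟩
      change (a1 * b1) t * (a2 * b2) _ * (a3 * b3) t = a1 t * a2 _ * a3 t * (b1 t * b2 _ * b3 t)
      rw [MulChar.mul_apply, MulChar.mul_apply, AddChar.mul_apply]
      ring
    · rintro ((p | p) | P)
      · rw [hcA1]; exact (hNp p.1 p.2).two_le
      · rw [hcA2]; exact (hNp p.1 p.2).two_le
      · refine le_trans ?_ (hcA3 P)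
        have hd := ((mem_facs hn0).1 P.2).2.1.natDegree_pos
        calc 2 ≤ Fintype.card K := hK1
          _ = Fintype.card K ^ 1 := (pow_one _).symm
          _ ≤ _ := Nat.pow_le_pow_right (by omega) hd
    · rintro ((p | p) | P)
      · obtain ⟨T, hT1, hT2⟩ := mul_proj N hNp χ (fun p hp => hχ p hp) p.2
        refine ⟨(iot1 L).comp (T.comp (MonoidHom.fst _ _)), ?_, ?_⟩
        · rintro γ ⟨γ', h, rfl⟩
          change iot1 L (T γ') = _
          rw [hT1 _ h]
        · rintro ((p' | p') | P') hne γ ⟨γ', h, rfl⟩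
          · change iot1 L (T γ') = _
            rw [hT2 p'.1 p'.2 (fun h => hne (by rw [Subtype.ext h])) _ h, map_one]
          · change iot1 L (T 1) = _
            rw [map_one, map_one]
          · change iot1 L (T 1) = _
            rw [map_one, map_one]
      · obtain ⟨T, hT1, hT2⟩ := mul_proj N hNp χ (fun p hp => hχ p hp) p.2
        refine ⟨(iot2 L).comp (T.comp ((MonoidHom.fst _ _).comp (MonoidHom.snd _ _))), ?_, ?_⟩
        · rintro γ ⟨γ', h, rfl⟩
          change iot2 L (T γ') = _
          rw [hT1 _ h]
        · rintro ((p' | p') | P') hne γ ⟨γ', h, rfl⟩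
          · change iot2 L (T 1) = _
            rw [map_one, map_one]
          · change iot2 L (T γ') = _
            rw [hT2 p'.1 p'.2 (fun h => hne (by rw [Subtype.ext h])) _ h, map_one]
          · change iot2 L (T 1) = _
            rw [map_one, map_one]
      · obtain ⟨T, hT1, hT2⟩ := subP_proj hfin hn0 P.2
        refine ⟨(iot3 L).comp (T.comp ((MonoidHom.snd _ _).comp (MonoidHom.snd _ _))), ?_, ?_⟩
        · rintro γ ⟨γ', h, rfl⟩
          change iot3 L (T γ') = _
          rw [hT1 _ h]
        · rintro ((p' | p') | P') hne γ ⟨γ', h, rfl⟩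
          · change iot3 L (T 1) = _
            rw [map_one, map_one]
          · change iot3 L (T 1) = _
            rw [map_one, map_one]
          · change iot3 L (T γ') = _
            rw [hT2 P'.1 P'.2 (fun h => hne (by rw [Subtype.ext h])) _ h, map_one]
    · have hcg := card_goodPts hf1 hf2 hdeg1 hdeg2
      have hcg' : (Fintype.card L : ℝ) - 6 ≤ (goodPts f₁ f₂).card := by
        rw [sub_le_iff_le_add]; exact_mod_cast hcg
      have hδp : 0 < δ' := hδ0.trans_le hδδ
      set M := 6 * √(Fintype.card L : ℝ) with hMdef
      have hM0 : 0 ≤ M := by positivity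
      have h2c : (2 : ℝ) ^ C.card ≤ 2 ^ c := pow_le_pow_right₀ (by norm_num) hCc
      have h2c1 : (1 : ℝ) ≤ 2 ^ C.card := one_le_pow₀ (by norm_num)
      have hsr : (S.card : ℝ) ≤ s := by exact_mod_cast hSc
      have hs1 : (1 : ℝ) ≤ s := by exact_mod_cast hs
      have e1 : 2 ^ C.card * ((S.card : ℝ) - 1) ≤ 2 ^ c * ((s : ℝ) - 1) :=
        (mul_le_mul_of_nonneg_left (sub_le_sub_right hsr 1) (by positivity)).trans
          (mul_le_mul_of_nonneg_right h2c (by linarith))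
      have e2 : δ' * (2 ^ C.card - 1) + 2 ^ C.card * (S.card - 1 + δ') ≤
          2 ^ c * ((s : ℝ) - 1) + δ' * (2 ^ (c + 1) - 1) := by
        rw [pow_succ]
        nlinarith
      refine (mul_le_mul_of_nonneg_left e2 hM0).trans_lt (lt_of_lt_of_le ?_
        (mul_le_mul_of_nonneg_left hcg' hδp.le))
      have e3 : 0 ≤ 2 ^ c * ((s : ℝ) - 1) := mul_nonneg (by positivity) (by linarith)
      -- scale
      set D : ℝ := Fintype.card L - 6 with hD
      set B : ℝ := 2 ^ c * ((s : ℝ) - 1) with hB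
      set E : ℝ := 2 ^ (c + 1) - 1 with hE
      have h5 : M * B < δ * (D - M * E) := by linarith
      have h6 : 0 < D - M * E := by
        by_contra hcon
        have : δ * (D - M * E) ≤ 0 := mul_nonpos_of_nonneg_of_nonpos hδ0.le (not_lt.1 hcon)
        have : 0 ≤ M * B := mul_nonneg hM0 e3
        linarith
      have h7 : δ * (D - M * E) ≤ δ' * (D - M * E) := mul_le_mul_of_nonneg_right hδδ h6.le
      linarith
  obtain ⟨x, hx, hgood⟩ := key
  obtain ⟨hx0, hx1, hx2⟩ := mem_goodPts.1 hx
  have hev : ratEval f x = f₁.eval x * (f₂.eval x)⁻¹ := by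
    rw [eq_mul_inv_iff_mul_eq₀ hx2, ratEval]
    have hm : f * algebraMap L[X] (RatFunc L) f₂ = algebraMap L[X] (RatFunc L) f₁ := by
      rw [hff]
      exact div_mul_cancel₀ _ (RatFunc.algebraMap_ne_zero hf2)
    have hden : f.denom.eval₂ (RingHom.id L) x ≠ 0 := by
      obtain ⟨w, hw⟩ : f.denom ∣ f₂ := hff ▸ RatFunc.denom_div_dvd f₁ f₂
      intro h0
      change f.denom.eval x = 0 at h0
      apply hx2
      rw [hw, eval_mul, h0, zero_mul]
    have h1 := congrArg (RatFunc.eval (RingHom.id L) x) hm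
    rw [RatFunc.eval_mul _ _ hden (by rw [RatFunc.denom_algebraMap]; simp),
      RatFunc.eval_algebraMap, RatFunc.eval_algebraMap] at h1
    exact h1
  have hy0 : f₁.eval x * (f₂.eval x)⁻¹ ≠ 0 := mul_ne_zero hx1 (inv_ne_zero hx2)
  have one_app : ∀ {y : L}, y ≠ 0 → (1 : MulChar L ℂ) y = 1 := fun {y} hy =>
    MulChar.one_apply (isUnit_iff_ne_zero.2 hy)
  refine ⟨x, primitive_of_chars hx0 χ (fun p hp => hχ p hp) ?_, normal_of_cof hfin hn0 ?_,
    hev ▸ primitive_of_chars hy0 χ (fun p hp => hχ p hp) ?_⟩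
  · intro p hp
    obtain ⟨γ, ⟨γ', hγ', rfl⟩, hne⟩ := hgood (Sum.inl (Sum.inl ⟨p, hp⟩)) (hCSu _)
    refine ⟨γ', hγ', ?_⟩
    have : e (iot1 L γ') x = γ' x := by
      change γ' x * (1 : MulChar L ℂ) _ * (1 : AddChar L ℂ) x = _
      rw [one_app hy0, AddChar.one_apply, mul_one, mul_one]
    rwa [this] at hne
  · intro P hP
    obtain ⟨γ, ⟨γ', hγ', rfl⟩, hne⟩ := hgood (Sum.inr ⟨P, hP⟩) (hCSu _)
    refine exists_subP_ne ⟨γ', hγ', ?_⟩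
    have : e (iot3 L γ') x = γ' x := by
      change (1 : MulChar L ℂ) x * (1 : MulChar L ℂ) _ * γ' x = _
      rw [one_app hy0, one_app hx0, one_mul, one_mul]
    rwa [this] at hne
  · intro p hp
    obtain ⟨γ, ⟨γ', hγ', rfl⟩, hne⟩ := hgood (Sum.inl (Sum.inr ⟨p, hp⟩)) (hCSu _)
    refine ⟨γ', hγ', ?_⟩
    have : e (iot2 L γ') x = γ' (f₁.eval x * (f₂.eval x)⁻¹) := by
      change (1 : MulChar L ℂ) x * γ' _ * (1 : AddChar L ℂ) x = _
      rw [one_app hx0, AddChar.one_apply, mul_one, one_mul]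
    rwa [this] at hne


theorem dvd_xm_of_dvd_xn {K : Type} [Field K] (p a m : ℕ) [Fact p.Prime] [CharP K p]
    {P : K[X]} (hi : Irreducible P) (h : P ∣ X ^ (m * p ^ a) - 1) : P ∣ X ^ m - 1 := by
  have h1 : (X ^ (m * p ^ a) - 1 : K[X]) = (X ^ m - 1) ^ p ^ a := by
    rw [sub_pow_char_pow, one_pow, pow_mul]
  rw [h1] at h
  exact hi.prime.dvd_of_dvd_pow h

theorem dvd_x_gcd {K : Type} [Field K] [Fintype K] {m d k : ℕ}
    {P : K[X]} (hi : Irreducible P) (hm : 0 < m) (h : P ∣ X ^ m - 1) (hd : P.natDegree = d)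
    (hk : Fintype.card K ^ d - 1 ∣ k) : P ∣ X ^ (m.gcd k) - 1 := by
  haveI : Fact (Irreducible P) := ⟨hi⟩
  have h0 : P ≠ 0 := hi.ne_zero
  haveI : Module.Finite K (AdjoinRoot P) := (AdjoinRoot.powerBasis h0).finite
  haveI : Finite (AdjoinRoot P) := Module.finite_of_finite K
  letI : Fintype (AdjoinRoot P) := Fintype.ofFinite _
  have hc : Fintype.card (AdjoinRoot P) = Fintype.card K ^ d := by
    rw [Module.card_eq_pow_finrank (K := K) (V := AdjoinRoot P),
      (AdjoinRoot.powerBasis h0).finrank, AdjoinRoot.powerBasis_dim, hd]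
  have h1 : (AdjoinRoot.root P) ^ m = 1 := by
    have := AdjoinRoot.mk_eq_zero.2 h
    rw [map_sub, map_pow, map_one, AdjoinRoot.mk_X, sub_eq_zero] at this
    exact this
  have hr : AdjoinRoot.root P ≠ 0 := by
    intro h2
    rw [h2, zero_pow hm.ne'] at h1
    exact zero_ne_one h1
  have h2 : (AdjoinRoot.root P) ^ k = 1 := by
    obtain ⟨j, rfl⟩ := hk
    rw [pow_mul, ← hc, FiniteField.pow_card_sub_one_eq_one _ hr, one_pow]
  have h3 : (AdjoinRoot.root P) ^ (m.gcd k) = 1 := by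
    rw [← orderOf_dvd_iff_pow_eq_one] at *
    exact Nat.dvd_gcd h1 h2
  apply AdjoinRoot.mk_eq_zero.1
  rw [map_sub, map_pow, map_one, AdjoinRoot.mk_X, h3, sub_self]

theorem sum_deg_le {K : Type} [Field K] {g : ℕ} (hg : 0 < g) (T : Finset K[X])
    (hT : ∀ P ∈ T, P.Monic ∧ Irreducible P ∧ P ∣ X ^ g - 1) :
    ∑ P ∈ T, P.natDegree ≤ g := by
  have h1 : ∏ P ∈ T, P ∣ (X ^ g - 1 : K[X]) := by
    refine Finset.prod_dvd_of_coprime ?_ fun P hP => (hT P hP).2.2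
    intro P hP P' hP' hne
    have hP := hT P hP
    have hP' := hT P' hP'
    refine (hP.2.1.coprime_iff_not_dvd).2 fun hd => hne ?_
    exact eq_of_monic_of_associated hP.1 hP'.1 (hP.2.1.associated_of_dvd hP'.2.1 hd)
  have h2 := natDegree_le_of_dvd h1 (xn_ne_zero K hg)
  rw [natDegree_prod _ _ fun P hP => (hT P hP).2.1.ne_zero] at h2
  refine h2.trans ?_
  have := natDegree_X_pow_sub_C (n := g) (r := (1 : K))
  rw [map_one] at this
  exact this.le

/-- counts of linear, quadratic and other factors -/
theorem facs_counts {K : Type} [Field K] [Fintype K] {q n p a m : ℕ} [Fact p.Prime] [CharP K p]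
    (hq : Fintype.card K = q) (hm : 0 < m) (hn : n = m * p ^ a) :
    ∃ l₁ l₂ l₃ : ℕ, l₁ ≤ m.gcd (q - 1) ∧ l₁ + 2 * l₂ ≤ m.gcd (q ^ 2 - 1) ∧
      l₁ + 2 * l₂ + 3 * l₃ ≤ m ∧ (facs K n).card = l₁ + l₂ + l₃ ∧
      ∑ P ∈ facs K n, ((q : ℝ) ^ P.natDegree)⁻¹ ≤
        l₁ * (q : ℝ)⁻¹ + l₂ * ((q : ℝ) ^ 2)⁻¹ + l₃ * ((q : ℝ) ^ 3)⁻¹ := by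
  classical
  have hq1 : 1 < q := hq ▸ Fintype.one_lt_card
  have hp0 : 0 < p := (Fact.out : p.Prime).pos
  have hn0 : 0 < n := by rw [hn]; positivity
  have hF : ∀ P ∈ facs K n, P.Monic ∧ Irreducible P ∧ P ∣ X ^ m - 1 := by
    intro P hP
    obtain ⟨h1, h2, h3⟩ := (mem_facs hn0).1 hP
    rw [hn] at h3
    exact ⟨h1, h2, dvd_xm_of_dvd_xn p a m h2 h3⟩
  have hpos : ∀ P ∈ facs K n, 0 < P.natDegree := fun P hP => (hF P hP).2.1.natDegree_pos
  set A := (facs K n).filter (fun P => P.natDegree = 1) with hA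
  set R := (facs K n).filter (fun P => ¬ P.natDegree = 1) with hR
  set B := R.filter (fun P => P.natDegree = 2) with hB
  set C := R.filter (fun P => ¬ P.natDegree = 2) with hC
  have eqsum : ∀ {M : Type} [AddCommMonoid M] (φ : K[X] → M),
      ∑ P ∈ facs K n, φ P = ∑ P ∈ A, φ P + (∑ P ∈ B, φ P + ∑ P ∈ C, φ P) := by
    intro M _ φ
    rw [hB, hC, Finset.sum_filter_add_sum_filter_not, hA, hR, Finset.sum_filter_add_sum_filter_not]
  have mA : ∀ P ∈ A, P ∈ facs K n ∧ P.natDegree = 1 := fun P hP => Finset.mem_filter.1 hP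
  have mB : ∀ P ∈ B, P ∈ facs K n ∧ P.natDegree = 2 := fun P hP =>
    ⟨(Finset.mem_filter.1 (Finset.mem_filter.1 hP).1).1, (Finset.mem_filter.1 hP).2⟩
  have mC : ∀ P ∈ C, P ∈ facs K n ∧ 3 ≤ P.natDegree := by
    intro P hP
    have h1 := Finset.mem_filter.1 hP
    have h2 := Finset.mem_filter.1 h1.1
    have h3 := hpos P h2.1
    exact ⟨h2.1, by omega⟩
  have g1 : 0 < m.gcd (q - 1) := Nat.gcd_pos_of_pos_left _ hm
  have g2 : 0 < m.gcd (q ^ 2 - 1) := Nat.gcd_pos_of_pos_left _ hm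
  have sA : ∑ P ∈ A, P.natDegree = A.card := by
    rw [Finset.sum_congr rfl fun P hP => (mA P hP).2]; simp
  have sB : ∑ P ∈ B, P.natDegree = 2 * B.card := by
    rw [Finset.sum_congr rfl fun P hP => (mB P hP).2]; simp [mul_comm]
  have sC : 3 * C.card ≤ ∑ P ∈ C, P.natDegree := by
    have := Finset.card_nsmul_le_sum C (fun P => P.natDegree) 3 fun P hP => (mC P hP).2
    simpa [mul_comm] using this
  have hdAB : Disjoint A B := by
    rw [Finset.disjoint_left]
    intro P h1 h2
    have := (mA P h1).2
    have := (mB P h2).2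
    omega
  have hdv : q - 1 ∣ q ^ 2 - 1 := by
    have := Nat.sub_dvd_pow_sub_pow q 1 2
    simpa using this
  refine ⟨A.card, B.card, C.card, ?_, ?_, ?_, ?_, ?_⟩
  · rw [← sA]
    refine sum_deg_le g1 A fun P hP => ?_
    obtain ⟨h1, h2⟩ := mA P hP
    obtain ⟨h3, h4, h5⟩ := hF P h1
    exact ⟨h3, h4, dvd_x_gcd h4 hm h5 h2 (by rw [hq, pow_one])⟩
  · rw [← sA, ← sB, ← Finset.sum_union hdAB]
    refine sum_deg_le g2 (A ∪ B) fun P hP => ?_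
    rcases Finset.mem_union.1 hP with hP | hP
    · obtain ⟨h1, h2⟩ := mA P hP
      obtain ⟨h3, h4, h5⟩ := hF P h1
      exact ⟨h3, h4, dvd_x_gcd h4 hm h5 h2 (by rw [hq, pow_one]; exact hdv)⟩
    · obtain ⟨h1, h2⟩ := mB P hP
      obtain ⟨h3, h4, h5⟩ := hF P h1
      exact ⟨h3, h4, dvd_x_gcd h4 hm h5 h2 (by rw [hq])⟩
  · have h1 := sum_deg_le hm (facs K n) hF
    rw [eqsum, sA, sB] at h1
    omega
  · have := eqsum (M := ℕ) (fun _ => 1)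
    simp only [Finset.sum_const, smul_eq_mul, mul_one] at this
    omega
  · rw [eqsum]
    have hq0 : (0 : ℝ) < q := by positivity
    have hqr : (1 : ℝ) ≤ q := by exact_mod_cast hq1.le
    have e1 : ∑ P ∈ A, ((q : ℝ) ^ P.natDegree)⁻¹ = A.card * (q : ℝ)⁻¹ := by
      rw [Finset.sum_congr rfl fun P hP => by rw [(mA P hP).2]]; simp
    have e2 : ∑ P ∈ B, ((q : ℝ) ^ P.natDegree)⁻¹ = B.card * ((q : ℝ) ^ 2)⁻¹ := by
      rw [Finset.sum_congr rfl fun P hP => by rw [(mB P hP).2]]; simp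
    have e3 : ∑ P ∈ C, ((q : ℝ) ^ P.natDegree)⁻¹ ≤ C.card * ((q : ℝ) ^ 3)⁻¹ := by
      rw [← nsmul_eq_mul]
      refine Finset.sum_le_card_nsmul _ _ _ fun P hP => ?_
      exact inv_anti₀ (by positivity) (pow_le_pow_right₀ hqr (mC P hP).2)
    linarith


def dD : ℕ := 1000000000

def tst (Q c s loss : ℕ) : Bool :=
  Nat.blt 0 (dD - loss) &&
  Nat.blt (36 * Q * (dD * 2 ^ c * (s - 1) + (dD - loss) * (2 ^ (c + 1) - 1)) ^ 2)
    (((dD - loss) * (Q - 6)) ^ 2)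

theorem tst_real {Q c s loss : ℕ} (h : tst Q c s loss = true) :
    loss < dD ∧ ∀ δ : ℝ, δ = ((dD - loss : ℕ) : ℝ) / dD →
      6 * √(Q : ℝ) * (2 ^ c * (((max s 1 : ℕ) : ℝ) - 1) + δ * (2 ^ (c + 1) - 1)) < δ * (Q - 6) := by
  unfold tst at h
  rw [Bool.and_eq_true, Nat.blt_eq, Nat.blt_eq] at h
  obtain ⟨h1, h2⟩ := h
  refine ⟨by omega, ?_⟩
  rintro δ hδ
  generalize hag : dD - loss = a at *
  have hQ6 : 6 ≤ Q := by
    by_contra hh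
    have : Q - 6 = 0 := by omega
    rw [this] at h2
    simp at h2
  have hD : (0 : ℝ) < dD := by norm_num [dD]
  have es : (((max s 1 : ℕ) : ℝ) - 1) = ((s - 1 : ℕ) : ℝ) := by
    rcases Nat.eq_zero_or_pos s with rfl | hs
    · simp
    · rw [max_eq_left (by omega), Nat.cast_sub hs]; simp
  rw [es]
  set Y : ℕ := dD * 2 ^ c * (s - 1) + a * (2 ^ (c + 1) - 1) with hY
  have hYr : (Y : ℝ) = dD * (2 ^ c * ((s - 1 : ℕ) : ℝ) + δ * (2 ^ (c + 1) - 1)) := by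
    rw [hY, hδ]
    have : 1 ≤ 2 ^ (c + 1) := Nat.one_le_two_pow
    push_cast [Nat.cast_sub this]
    field_simp
  have key : 6 * √(Q : ℝ) * Y < a * ((Q : ℝ) - 6) := by
    refine lt_of_pow_lt_pow_left₀ 2 ?_ ?_
    · have : (6 : ℝ) ≤ Q := by exact_mod_cast hQ6
      exact mul_nonneg (by positivity) (by linarith)
    · rw [mul_pow, mul_pow, Real.sq_sqrt (by positivity)]
      have h3 : ((36 * Q * Y ^ 2 : ℕ) : ℝ) < (((a * (Q - 6)) ^ 2 : ℕ) : ℝ) := by exact_mod_cast h2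
      push_cast [Nat.cast_sub hQ6] at h3
      calc _ = 36 * (Q : ℝ) * (Y : ℝ) ^ 2 := by ring
        _ < _ := h3
  have ha : (a : ℝ) = dD * δ := by rw [hδ]; field_simp
  rw [hYr, ha] at key
  refine lt_of_mul_lt_mul_left (a := (dD : ℝ)) ?_ hD.le
  calc _ = _ := by ring
    _ < _ := key
    _ = _ := by ring

theorem crit_nat {K L : Type} [Field K] [Field L] [Fintype K] [Fintype L] [Algebra K L] {n : ℕ}
    (hn0 : 0 < n)
    (hL : Fintype.card L = Fintype.card K ^ n) {f : RatFunc L} (hf : f ∈ Upsilon L 3 2)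
    (C S : Finset ℕ) (C3 S3 : Finset K[X]) (hd : Disjoint C S) (hd3 : Disjoint C3 S3)
    (hu : ∀ p, p ∈ (Fintype.card L - 1).primeFactors ↔ p ∈ C ∨ p ∈ S)
    (hu3 : ∀ P, P ∈ facs K n ↔ P ∈ C3 ∨ P ∈ S3) (c s loss : ℕ)
    (hc : 2 * C.card + C3.card ≤ c) (hs : 2 * S.card + S3.card ≤ s)
    (hl : (dD : ℝ) * (2 * ∑ p ∈ S, (p : ℝ)⁻¹ +
      ∑ P ∈ S3, ((Fintype.card K : ℝ) ^ P.natDegree)⁻¹) ≤ loss)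
    (ht : tst (Fintype.card L) c s loss = true) :
    ∃ α : L, IsPrimitiveElem α ∧ IsNormalElem K n α ∧ IsPrimitiveElem (ratEval f α) := by
  obtain ⟨h1, h2⟩ := tst_real ht
  have hD : (0 : ℝ) < dD := by norm_num [dD]
  refine criterion hn0 hL hf C S C S C3 S3 hd hd hd3 hu hu hu3 c (max s 1) (le_max_right _ _)
    (((dD - loss : ℕ) : ℝ) / dD) ?_ (by omega) (le_trans (by omega) (le_max_left _ _)) ?_ (h2 _ rfl)
  · have : 0 < dD - loss := by omega
    positivity
  · rw [Nat.cast_sub h1.le, div_le_iff₀ hD]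
    linarith

/-- ceiling of `dD / k` -/
def invc (k : ℕ) : ℕ := (dD + k - 1) / k

theorem le_invc {a k : ℕ} (hk : 0 < k) : (a : ℝ) * (k : ℝ)⁻¹ ≤ (((a + k - 1) / k : ℕ) : ℝ) := by
  rw [← div_eq_mul_inv, div_le_iff₀ (by positivity)]
  have h1 : a ≤ ((a + k - 1) / k) * k := by
    have := Nat.div_add_mod (a + k - 1) k
    have h2 := Nat.mod_lt (a + k - 1) hk
    rw [mul_comm] at this
    omega
  exact_mod_cast h1

def sumInv : List ℕ → ℕ
  | [] => 0
  | p :: t => invc p + sumInv t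

theorem le_sumInv (l : List ℕ) (hpos : ∀ p ∈ l, 0 < p) (hnd : l.Nodup) :
    (dD : ℝ) * ∑ p ∈ l.toFinset, (p : ℝ)⁻¹ ≤ sumInv l := by
  induction l with
  | nil => simp [sumInv]
  | cons p t ih =>
    rw [List.nodup_cons] at hnd
    have ih' := ih (fun p hp => hpos p (List.mem_cons_of_mem _ hp)) hnd.2
    rw [List.toFinset_cons, Finset.sum_insert (by simpa using hnd.1), mul_add, sumInv]
    have h1 : (dD : ℝ) * (p : ℝ)⁻¹ ≤ invc p := le_invc (hpos p List.mem_cons_self)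
    push_cast
    linarith

/-- search for a sieving core, `E` bounds the number of polynomial factors and
`pl` the corresponding sieve loss, `r` the number of large primes -/
def chkCore (Q E pl r : ℕ) : List ℕ → ℕ → Bool
  | [], u => tst Q (2 * u) (2 * (0 + r) + E) (2 * (0 + r * invc 301) + pl) ||
      tst Q (2 * u + E) (2 * (0 + r)) (2 * (0 + r * invc 301))
  | p :: t, u => tst Q (2 * u) (2 * ((p :: t).length + r) + E)
        (2 * (sumInv (p :: t) + r * invc 301) + pl) ||
      (tst Q (2 * u + E) (2 * ((p :: t).length + r)) (2 * (sumInv (p :: t) + r * invc 301)) ||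
      chkCore Q E pl r t (u + 1))

theorem tst_sound {K L : Type} [Field K] [Field L] [Fintype K] [Fintype L] [Algebra K L] {n : ℕ}
    (hn0 : 0 < n)
    (hL : Fintype.card L = Fintype.card K ^ n) {f : RatFunc L} (hf : f ∈ Upsilon L 3 2)
    (big : Finset ℕ) (hbig : ∀ p ∈ big, 301 ≤ p) (r E pl : ℕ) (hr : big.card ≤ r)
    (hE : (facs K n).card ≤ E)
    (hpl : (dD : ℝ) * ∑ P ∈ facs K n, ((Fintype.card K : ℝ) ^ P.natDegree)⁻¹ ≤ pl)
    (sm : List ℕ) (u : ℕ) (C : Finset ℕ) (hC : C.card ≤ u) (hnd : sm.Nodup)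
    (hpos : ∀ p ∈ sm, 0 < p ∧ p ≤ 300 ∧ p ∉ C) (hCb : ∀ p ∈ C, p ≤ 300)
    (hu : ∀ p, p ∈ (Fintype.card L - 1).primeFactors ↔ p ∈ C ∨ p ∈ sm ∨ p ∈ big)
    (ht : tst (Fintype.card L) (2 * u) (2 * (sm.length + r) + E)
        (2 * (sumInv sm + r * invc 301) + pl) = true ∨
      tst (Fintype.card L) (2 * u + E) (2 * (sm.length + r))
        (2 * (sumInv sm + r * invc 301)) = true) :
    ∃ α : L, IsPrimitiveElem α ∧ IsNormalElem K n α ∧ IsPrimitiveElem (ratEval f α) := by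
  classical
  have hD : (0 : ℝ) < dD := by norm_num [dD]
  have hdS : Disjoint sm.toFinset big := by
    rw [Finset.disjoint_left]
    intro p h1 h2
    have := hpos p (by simpa using h1)
    have := hbig p h2
    omega
  have hdC : Disjoint C (sm.toFinset ∪ big) := by
    rw [Finset.disjoint_left]
    intro p h1 h2
    rcases Finset.mem_union.1 h2 with h2 | h2
    · exact (hpos p (by simpa using h2)).2.2 h1
    · have := hCb p h1
      have := hbig p h2
      omega
  have hScard : (sm.toFinset ∪ big).card ≤ sm.length + r :=
    (Finset.card_union_le _ _).trans (add_le_add (List.toFinset_card_le _) hr)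
  have hu' : ∀ p, p ∈ (Fintype.card L - 1).primeFactors ↔ p ∈ C ∨ p ∈ sm.toFinset ∪ big := by
    intro p
    rw [hu, Finset.mem_union, List.mem_toFinset]
  have hl : (dD : ℝ) * ∑ p ∈ sm.toFinset ∪ big, (p : ℝ)⁻¹ ≤ sumInv sm + r * invc 301 := by
    rw [Finset.sum_union hdS, mul_add]
    have h1 := le_sumInv sm (fun p hp => (hpos p hp).1) hnd
    have h2 : ∑ p ∈ big, (p : ℝ)⁻¹ ≤ big.card * ((301 : ℕ) : ℝ)⁻¹ := by
      rw [← nsmul_eq_mul]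
      refine Finset.sum_le_card_nsmul _ _ _ fun p hp => ?_
      refine inv_anti₀ (by norm_num) ?_
      exact_mod_cast hbig p hp
    have h3 : (dD : ℝ) * ((301 : ℕ) : ℝ)⁻¹ ≤ invc 301 := le_invc (by norm_num)
    have h4 : (big.card : ℝ) ≤ r := by exact_mod_cast hr
    have h5 : (dD : ℝ) * ∑ p ∈ big, (p : ℝ)⁻¹ ≤ r * invc 301 := by
      calc (dD : ℝ) * ∑ p ∈ big, (p : ℝ)⁻¹ ≤ dD * (big.card * ((301 : ℕ) : ℝ)⁻¹) := by gcongr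
        _ = big.card * (dD * ((301 : ℕ) : ℝ)⁻¹) := by ring
        _ ≤ r * invc 301 := by gcongr
    linarith
  rcases ht with ht | ht
  · refine crit_nat hn0 hL hf C (sm.toFinset ∪ big) ∅ (facs K n) hdC (by simp) hu' (by simp)
      _ _ _ (by simpa using hC) (by omega) ?_ ht
    push_cast
    rw [mul_add]
    linarith
  · refine crit_nat hn0 hL hf C (sm.toFinset ∪ big) (facs K n) ∅ hdC (by simp) hu' (by simp)
      _ _ _ (by omega) (by simpa using hScard) ?_ ht
    push_cast
    rw [Finset.sum_empty, add_zero]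
    linarith

theorem chkCore_sound {K L : Type} [Field K] [Field L] [Fintype K] [Fintype L] [Algebra K L] {n : ℕ}
    (hn0 : 0 < n)
    (hL : Fintype.card L = Fintype.card K ^ n) {f : RatFunc L} (hf : f ∈ Upsilon L 3 2)
    (big : Finset ℕ) (hbig : ∀ p ∈ big, 301 ≤ p) (r E pl : ℕ) (hr : big.card ≤ r)
    (hE : (facs K n).card ≤ E)
    (hpl : (dD : ℝ) * ∑ P ∈ facs K n, ((Fintype.card K : ℝ) ^ P.natDegree)⁻¹ ≤ pl)
    (sm : List ℕ) (u : ℕ) (C : Finset ℕ) (hC : C.card ≤ u) (hnd : sm.Nodup)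
    (hpos : ∀ p ∈ sm, 0 < p ∧ p ≤ 300 ∧ p ∉ C) (hCb : ∀ p ∈ C, p ≤ 300)
    (hu : ∀ p, p ∈ (Fintype.card L - 1).primeFactors ↔ p ∈ C ∨ p ∈ sm ∨ p ∈ big)
    (ht : chkCore (Fintype.card L) E pl r sm u = true) :
    ∃ α : L, IsPrimitiveElem α ∧ IsNormalElem K n α ∧ IsPrimitiveElem (ratEval f α) := by
  classical
  induction sm generalizing u C with
  | nil =>
    rw [chkCore, Bool.or_eq_true] at ht
    exact tst_sound hn0 hL hf big hbig r E pl hr hE hpl [] u C hC hnd hpos hCb hu ht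
  | cons p t ih =>
    rw [chkCore, Bool.or_eq_true, Bool.or_eq_true] at ht
    rcases ht with ht | ht | ht
    · exact tst_sound hn0 hL hf big hbig r E pl hr hE hpl (p :: t) u C hC hnd hpos hCb hu (Or.inl ht)
    · exact tst_sound hn0 hL hf big hbig r E pl hr hE hpl (p :: t) u C hC hnd hpos hCb hu (Or.inr ht)
    · rw [List.nodup_cons] at hnd
      refine ih (u + 1) (insert p C) ?_ hnd.2 ?_ ?_ ?_ ht
      · exact (Finset.card_insert_le _ _).trans (by omega)
      · intro x hx
        obtain ⟨h1, h2, h3⟩ := hpos x (List.mem_cons_of_mem _ hx)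
        refine ⟨h1, h2, ?_⟩
        rw [Finset.mem_insert, not_or]
        exact ⟨fun h => hnd.1 (h ▸ hx), h3⟩
      · intro x hx
        rcases Finset.mem_insert.1 hx with rfl | hx
        · exact (hpos x List.mem_cons_self).2.1
        · exact hCb x hx
      · intro x
        rw [hu, Finset.mem_insert, List.mem_cons]
        tauto


def smallPr : List ℕ := [2, 3, 5, 7, 11, 13, 17, 19, 23, 29, 31, 37, 41, 43, 47, 53, 59, 61, 67, 71, 73, 79, 83,
  89, 97, 101, 103, 107, 109, 113, 127, 131, 137, 139, 149, 151, 157, 163, 167, 173, 179,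
  181, 191, 193, 197, 199, 211, 223, 227, 229, 233, 239, 241, 251, 257, 263, 269, 271, 277,
  281, 283, 293]

def smPr : ℕ := 2043779758005154482257388030892804056228591188672553240869361360495290305558100337270153956915591354354320728837959427210


theorem smPr_eq : smPr = smallPr.prod := by decide +kernel

theorem smallPr_prime : ∀ p ∈ smallPr, p.Prime := by
  unfold smallPr
  simp only [List.forall_mem_cons, List.not_mem_nil, false_imp_iff, forall_const, and_true]
  norm_num

theorem smallPr_le : ∀ p ∈ smallPr, p ≤ 300 := by decide +kernel

theorem smallPr_nodup : smallPr.Nodup := by decide +kernel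

theorem mem_smallPr {p : ℕ} (hp : p.Prime) (h : p ≤ 300) : p ∈ smallPr := by
  have key : ∀ p < 301, 2 ≤ p → p ∈ smallPr ∨ ∃ d ∈ [2, 3, 5, 7, 11, 13, 17], d ∣ p ∧ d ≠ p := by
    decide +kernel
  rcases key p (by omega) hp.two_le with h1 | ⟨d, hd, h1, h2⟩
  · exact h1
  · rcases (Nat.dvd_prime hp).1 h1 with h3 | h3
    · subst h3; simp at hd
    · exact absurd h3 h2

def smOf (N : ℕ) : List ℕ := smallPr.filter (fun p => Nat.beq (N % p) 0)

theorem mem_smOf {N p : ℕ} (hN : N ≠ 0) : p ∈ smOf N ↔ p ∈ N.primeFactors ∧ p ≤ 300 := by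
  unfold smOf
  rw [List.mem_filter, Nat.beq_eq, ← Nat.dvd_iff_mod_eq_zero, Nat.mem_primeFactors]
  constructor
  · rintro ⟨h1, h2⟩
    exact ⟨⟨smallPr_prime p h1, h2, hN⟩, smallPr_le p h1⟩
  · rintro ⟨⟨h1, h2, -⟩, h3⟩
    exact ⟨mem_smallPr h1 h3, h2⟩

def bigM (N : ℕ) : ℕ := N / Nat.gcd N (smPr ^ 10)

def rOf (N : ℕ) : ℕ := 100 * (Nat.log2 (bigM N) + 1) / 823

theorem big_card_le {N : ℕ} (hN : N ≠ 0) :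
    (N.primeFactors.filter (fun p => 301 ≤ p)).card ≤ rOf N := by
  set big := N.primeFactors.filter (fun p => 301 ≤ p) with hbig
  have hb : ∀ p ∈ big, p.Prime ∧ p ∣ N ∧ 301 ≤ p := by
    intro p hp
    have h1 := Finset.mem_filter.1 hp
    exact ⟨Nat.prime_of_mem_primeFactors h1.1, Nat.dvd_of_mem_primeFactors h1.1, h1.2⟩
  have hdN : ∏ p ∈ big, p ∣ N :=
    (Finset.prod_dvd_prod_of_subset _ _ _ (Finset.filter_subset _ _)).trans
      (Nat.prod_primeFactors_dvd N)
  have hcop : (∏ p ∈ big, p).Coprime (smPr ^ 10) := by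
    refine Nat.Coprime.prod_left fun p hp => Nat.Coprime.pow_right _ ?_
    obtain ⟨h1, h2, h3⟩ := hb p hp
    rw [Nat.Prime.coprime_iff_not_dvd h1, smPr_eq, Prime.dvd_prod_iff h1.prime]
    rintro ⟨a, ha, hd⟩
    have := smallPr_le a ha
    have := Nat.le_of_dvd (smallPr_prime a ha).pos hd
    omega
  have hg : Nat.gcd N (smPr ^ 10) * bigM N = N := Nat.mul_div_cancel' (Nat.gcd_dvd_left _ _)
  have hdM : ∏ p ∈ big, p ∣ bigM N := by
    rw [← hg] at hdN
    exact (Nat.Coprime.coprime_dvd_right (Nat.gcd_dvd_right _ _) hcop).dvd_of_dvd_mul_left hdN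
  have hM0 : bigM N ≠ 0 := by
    intro h
    rw [h, mul_zero] at hg
    exact hN hg.symm
  have h1 : 301 ^ big.card ≤ bigM N := by
    refine le_trans ?_ (Nat.le_of_dvd (Nat.pos_of_ne_zero hM0) hdM)
    exact Finset.pow_card_le_prod _ _ _ fun p hp => (hb p hp).2.2
  have h2 : bigM N < 2 ^ (Nat.log2 (bigM N) + 1) := Nat.lt_log2_self
  unfold rOf
  rw [Nat.le_div_iff_mul_le (by norm_num)]
  have h3 : 2 ^ (big.card * 823) ≤ 2 ^ (100 * (Nat.log2 (bigM N) + 1)) := by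
    calc 2 ^ (big.card * 823) = (2 ^ 823) ^ big.card := by rw [mul_comm, pow_mul]
      _ ≤ (301 ^ 100) ^ big.card := Nat.pow_le_pow_left (by decide +kernel) _
      _ = (301 ^ big.card) ^ 100 := by rw [← pow_mul, ← pow_mul, mul_comm]
      _ ≤ (2 ^ (Nat.log2 (bigM N) + 1)) ^ 100 := Nat.pow_le_pow_left (h1.trans h2.le) _
      _ = _ := by rw [← pow_mul, mul_comm]
  exact (Nat.pow_le_pow_iff_right (by norm_num)).1 h3

def EOf (q m : ℕ) : ℕ := (2 * m + Nat.gcd m (q ^ 2 - 1) + 3 * Nat.gcd m (q - 1)) / 6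

def plOf (q m : ℕ) : ℕ :=
  (dD * (Nat.gcd m (q - 1) * (6 * q ^ 2 - 3 * q) + Nat.gcd m (q ^ 2 - 1) * (3 * q - 2) + 2 * m)
    + 6 * q ^ 3 - 1) / (6 * q ^ 3)

theorem facs_EOf {K : Type} [Field K] [Fintype K] {q n p a m : ℕ} [Fact p.Prime] [CharP K p]
    (hq : Fintype.card K = q) (hm : 0 < m) (hn : n = m * p ^ a) :
    (facs K n).card ≤ EOf q m ∧
    (dD : ℝ) * ∑ P ∈ facs K n, ((Fintype.card K : ℝ) ^ P.natDegree)⁻¹ ≤ plOf q m := by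
  obtain ⟨l₁, l₂, l₃, h1, h2, h3, h4, h5⟩ := facs_counts (K := K) hq hm hn
  have hq1 : 1 < q := hq ▸ Fintype.one_lt_card
  constructor
  · rw [h4]
    unfold EOf
    omega
  · rw [hq]
    have hq0 : (0 : ℝ) < q := by positivity
    have hq1' : (1 : ℝ) ≤ q := by exact_mod_cast hq1.le
    have hD : (0 : ℝ) < dD := by norm_num [dD]
    set G1 := Nat.gcd m (q - 1)
    set G2 := Nat.gcd m (q ^ 2 - 1)
    have e1 : 3 * q ≤ 6 * q ^ 2 := by nlinarith
    have e2 : 2 ≤ 3 * q := by omega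
    have h1r : (l₁ : ℝ) ≤ G1 := by exact_mod_cast h1
    have h2r : (l₁ : ℝ) + 2 * l₂ ≤ G2 := by exact_mod_cast h2
    have h3r : (l₁ : ℝ) + 2 * l₂ + 3 * l₃ ≤ m := by exact_mod_cast h3
    have key := le_invc (a := dD * (G1 * (6 * q ^ 2 - 3 * q) + G2 * (3 * q - 2) + 2 * m))
      (k := 6 * q ^ 3) (by positivity)
    refine le_trans ?_ key
    rw [← div_eq_mul_inv]
    push_cast [Nat.cast_sub e1, Nat.cast_sub e2]
    rw [le_div_iff₀ (by positivity), mul_assoc]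
    refine mul_le_mul_of_nonneg_left ?_ hD.le
    calc _ ≤ ((l₁ : ℝ) * (q : ℝ)⁻¹ + l₂ * ((q : ℝ) ^ 2)⁻¹ + l₃ * ((q : ℝ) ^ 3)⁻¹) * (6 * q ^ 3) := by
          gcongr
      _ = l₁ * (6 * q ^ 2) + l₂ * (6 * q) + 6 * l₃ := by
          field_simp
      _ = l₁ * (6 * q ^ 2 - 3 * q) + (l₁ + 2 * l₂) * (3 * q - 2) + 2 * (l₁ + 2 * l₂ + 3 * l₃) := by
          ring
      _ ≤ _ := by
          have : (0 : ℝ) ≤ 6 * q ^ 2 - 3 * q := by nlinarith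
          have : (0 : ℝ) ≤ 3 * q - 2 := by linarith
          gcongr

def mOf (p n : ℕ) : ℕ := n / Nat.gcd n (p ^ 8)

/-- the complete numerical check -/
def chk (p q n : ℕ) : Bool :=
  chkCore (q ^ n) (EOf q (mOf p n)) (plOf q (mOf p n)) (rOf (q ^ n - 1)) (smOf (q ^ n - 1)) 0

theorem charP_of_card {K : Type} [Field K] [Fintype K] {p k : ℕ} (hp : p.Prime) (hk : k ≠ 0)
    (h : Fintype.card K = p ^ k) : CharP K p := by
  obtain ⟨p', hp'⟩ := CharP.exists K
  obtain ⟨j, hj, hc⟩ := FiniteField.card K p'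
  rw [h] at hc
  have h1 : p ∣ p' ^ (j : ℕ) := hc ▸ dvd_pow_self p hk
  have h2 : p = p' := (Nat.prime_dvd_prime_iff_eq hp hj).1 (hp.dvd_of_dvd_pow h1)
  rw [h2]; exact hp'

theorem chk_sound {p k q n : ℕ} (hp : p.Prime) (hk : k ≠ 0) (hqp : q = p ^ k) (hn : 0 < n)
    (h : chk p q n = true) : memB 3 2 q n := by
  intro K L _ _ _ _ _ hK hL f hf
  haveI : Fact p.Prime := ⟨hp⟩
  haveI : CharP K p := charP_of_card hp hk (hK.trans hqp)
  have hq1 : 1 < q := hK ▸ Fintype.one_lt_card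
  have hg : Nat.gcd n (p ^ 8) * mOf p n = n := Nat.mul_div_cancel' (Nat.gcd_dvd_left _ _)
  obtain ⟨a, ha, hga⟩ := (Nat.dvd_prime_pow hp).1 (Nat.gcd_dvd_right n (p ^ 8))
  have hm : 0 < mOf p n := by
    rcases Nat.eq_zero_or_pos (mOf p n) with h0 | h0
    · rw [h0, mul_zero] at hg; omega
    · exact h0
  have hnm : n = mOf p n * p ^ a := by rw [← hga, mul_comm]; exact hg.symm
  obtain ⟨hE, hpl⟩ := facs_EOf (K := K) hK hm hnm
  have hN : q ^ n - 1 ≠ 0 := by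
    have := Nat.one_lt_pow hn.ne' hq1
    omega
  refine chkCore_sound (K := K) (L := L) hn (by rw [hL, hK]) hf
    ((q ^ n - 1).primeFactors.filter (fun p => 301 ≤ p)) (fun p hp => (Finset.mem_filter.1 hp).2)
    (rOf (q ^ n - 1)) _ _ (big_card_le hN) hE hpl (smOf (q ^ n - 1)) 0 ∅ (by simp)
    (smallPr_nodup.filter _) ?_ (by simp) ?_ (by rw [hL]; exact h)
  · intro x hx
    have h1 := (mem_smOf hN).1 hx
    exact ⟨(Nat.prime_of_mem_primeFactors h1.1).pos, h1.2, by simp⟩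
  · intro x
    rw [hL, mem_smOf hN, Finset.mem_filter]
    have : x ≤ 300 ∨ 301 ≤ x := by omega
    simp only [Finset.notMem_empty, false_or]
    tauto



theorem chk7 : ∀ n < 200, 3 ≤ n → n ∉ [3, 4, 5, 6, 8, 12] → chk 7 7 n = true := by decide +kernel
theorem chk8 : ∀ n < 200, 3 ≤ n → n ∉ [3, 4, 7] → chk 2 8 n = true := by decide +kernel
theorem chk9 : ∀ n < 200, 3 ≤ n → n ∉ [3, 4, 5, 6, 8] → chk 3 9 n = true := by decide +kernel
theorem chk11 : ∀ n < 200, 3 ≤ n → n ∉ [3, 4, 5, 6] → chk 11 11 n = true := by decide +kernel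
theorem chk13 : ∀ n < 200, 3 ≤ n → n ∉ [3, 4, 6] → chk 13 13 n = true := by decide +kernel
theorem chk16 : ∀ n < 200, 3 ≤ n → n ∉ [3, 4, 5] → chk 2 16 n = true := by decide +kernel
theorem chk17 : ∀ n < 230, 3 ≤ n → n ∉ [3, 4] → chk 17 17 n = true := by decide +kernel
theorem chk19 : ∀ n < 230, 3 ≤ n → n ∉ [3, 4, 6] → chk 19 19 n = true := by decide +kernel


def tinyPr : Finset ℕ := {2, 3, 5, 7, 11, 13, 17, 19, 23, 29, 31, 37, 41, 43, 47, 53, 59, 61}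

theorem tinyPr_prod : ∏ p ∈ tinyPr, p = 117288381359406970983270 := by decide +kernel

theorem tinyPr_card : tinyPr.card = 18 := by decide +kernel

theorem tinyPr_le : ∀ p ∈ tinyPr, p ≤ 64 := by decide +kernel

theorem mem_tinyPr {p : ℕ} (hp : p.Prime) (h : p < 64) : p ∈ tinyPr := by
  have key : ∀ p ∈ smallPr, p < 64 → p ∈ tinyPr := by decide +kernel
  exact key p (mem_smallPr hp (by omega)) h

theorem omega_bound {N : ℕ} (hN : N ≠ 0) :
    64 ^ N.primeFactors.card * 117288381359406970983270 ≤ 64 ^ 18 * N := by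
  set S := N.primeFactors with hS
  have h1 : 64 ^ (S \ tinyPr).card ≤ ∏ p ∈ S \ tinyPr, p := by
    refine Finset.pow_card_le_prod _ _ _ fun p hp => ?_
    rw [Finset.mem_sdiff] at hp
    by_contra hlt
    exact hp.2 (mem_tinyPr (Nat.prime_of_mem_primeFactors hp.1) (by omega))
  have h2 : ∏ p ∈ tinyPr \ S, p ≤ 64 ^ (tinyPr \ S).card := by
    refine Finset.prod_le_pow_card _ _ _ fun p hp => ?_
    rw [Finset.mem_sdiff] at hp
    exact tinyPr_le p hp.1
  have e1 : (S \ tinyPr).card + (S ∩ tinyPr).card = S.card := Finset.card_sdiff_add_card_inter _ _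
  have e2 : (tinyPr \ S).card + (tinyPr ∩ S).card = 18 := by
    rw [← tinyPr_card]; exact Finset.card_sdiff_add_card_inter _ _
  have e3 : (∏ p ∈ tinyPr ∩ S, p) * (∏ p ∈ tinyPr \ S, p) = 117288381359406970983270 := by
    rw [← tinyPr_prod]
    exact Finset.prod_inter_mul_prod_sdiff _ _ _
  have e4 : (∏ p ∈ S ∩ tinyPr, p) * (∏ p ∈ S \ tinyPr, p) = ∏ p ∈ S, p :=
    Finset.prod_inter_mul_prod_sdiff _ _ _
  have h3 : ∏ p ∈ S, p ≤ N := Nat.le_of_dvd (Nat.pos_of_ne_zero hN) (Nat.prod_primeFactors_dvd N)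
  rw [Finset.inter_comm] at e2 e3
  rw [← e1, ← e3, ← e2]
  calc 64 ^ ((S \ tinyPr).card + (S ∩ tinyPr).card) *
        ((∏ p ∈ S ∩ tinyPr, p) * ∏ p ∈ tinyPr \ S, p)
      ≤ ((∏ p ∈ S \ tinyPr, p) * 64 ^ (S ∩ tinyPr).card) *
        ((∏ p ∈ S ∩ tinyPr, p) * 64 ^ (tinyPr \ S).card) := by
        rw [pow_add]; gcongr
    _ = 64 ^ ((tinyPr \ S).card + (S ∩ tinyPr).card) *
        ((∏ p ∈ S ∩ tinyPr, p) * (∏ p ∈ S \ tinyPr, p)) := by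
        rw [pow_add]; ring
    _ ≤ _ := by rw [e4]; gcongr

theorem large_n {p k q n : ℕ} (hp : p.Prime) (hk : k ≠ 0) (hqp : q = p ^ k) (hn : 0 < n)
    (h : 144 ^ 3 * (64 ^ 18) ^ 2 * 2 ^ (q ^ 2 + 3 * q) * 4 ^ n ≤
      117288381359406970983270 ^ 2 * q ^ n) : memB 3 2 q n := by
  intro K L _ _ _ _ _ hK hL f hf
  have : Fact p.Prime := ⟨hp⟩
  have : CharP K p := charP_of_card hp hk (hK.trans hqp)
  have hq1 : 1 < q := hK ▸ Fintype.one_lt_card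
  have hN : q ^ n - 1 ≠ 0 := by
    have := Nat.one_lt_pow hn.ne' hq1
    omega
  obtain ⟨hE, -⟩ := facs_EOf (K := K) (p := p) (a := 0) (n := n) hK hn (by simp)
  have hE6 : 6 * (facs K n).card ≤ 2 * n + (q ^ 2 + 3 * q) := by
    have g1 : Nat.gcd n (q - 1) ≤ q - 1 := Nat.gcd_le_right _ (by omega)
    have g2 : Nat.gcd n (q ^ 2 - 1) ≤ q ^ 2 - 1 := Nat.gcd_le_right _ (by
      have := Nat.one_lt_pow two_ne_zero hq1
      omega)
    unfold EOf at hE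
    omega
  set E := (facs K n).card
  set w := (q ^ n - 1).primeFactors.card with hw
  have hwb := omega_bound hN
  rw [← hw] at hwb
  set Q := q ^ n with hQ
  have hQ0 : 0 < Q := by positivity
  generalize hR : 117288381359406970983270 = R at *
  have hR0 : 0 < R := by rw [← hR]; norm_num
  -- main inequality
  have main : (144 * 2 ^ (4 * w + 2 * E)) ^ 6 * R ^ 4 ≤ Q ^ 6 * R ^ 4 := by
    have a1 : (64 ^ w * R) ^ 4 ≤ (64 ^ 18 * Q) ^ 4 :=
      Nat.pow_le_pow_left (hwb.trans (Nat.mul_le_mul_left _ (by omega))) 4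
    have a2 : 2 ^ (6 * E) ≤ 2 ^ (q ^ 2 + 3 * q) * 4 ^ n := by
      have : (4 : ℕ) ^ n = 2 ^ (2 * n) := by rw [pow_mul]; norm_num
      rw [this, ← pow_add]
      exact Nat.pow_le_pow_right (by norm_num) (by omega)
    have a3 : 144 ^ 3 * (64 ^ 18) ^ 2 * 2 ^ (6 * E) ≤ R ^ 2 * Q :=
      calc 144 ^ 3 * (64 ^ 18) ^ 2 * 2 ^ (6 * E)
          ≤ 144 ^ 3 * (64 ^ 18) ^ 2 * (2 ^ (q ^ 2 + 3 * q) * 4 ^ n) := Nat.mul_le_mul_left _ a2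
        _ ≤ R ^ 2 * Q := by rw [← mul_assoc]; exact h
    have a4 : (64 : ℕ) ^ w = (2 ^ w) ^ 6 := by
      rw [← pow_mul, mul_comm, pow_mul]; norm_num
    generalize hA : (64 : ℕ) ^ 18 = A at *
    rw [a4] at a1
    have a5 : (144 * 2 ^ (4 * w + 2 * E)) ^ 6 * R ^ 4 * R ^ 4 ≤ Q ^ 6 * R ^ 4 * R ^ 4 :=
      calc (144 * 2 ^ (4 * w + 2 * E)) ^ 6 * R ^ 4 * R ^ 4
          = ((2 ^ w) ^ 6 * R) ^ 4 * (144 ^ 3 * 2 ^ (6 * E)) ^ 2 * R ^ 4 := by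
            rw [pow_add, pow_mul 2 4 w, pow_mul 2 2 E, pow_mul 2 6 E]
            rw [show (2 ^ 4) ^ w = ((2 : ℕ) ^ w) ^ 4 by rw [← pow_mul, ← pow_mul, mul_comm],
              show (2 ^ 2) ^ E = ((2 : ℕ) ^ E) ^ 2 by rw [← pow_mul, ← pow_mul, mul_comm],
              show (2 ^ 6) ^ E = ((2 : ℕ) ^ E) ^ 6 by rw [← pow_mul, ← pow_mul, mul_comm]]
            ring
        _ ≤ (A * Q) ^ 4 * (144 ^ 3 * 2 ^ (6 * E)) ^ 2 * R ^ 4 := by gcongr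
        _ = Q ^ 4 * R ^ 4 * (144 ^ 3 * A ^ 2 * 2 ^ (6 * E)) ^ 2 := by ring
        _ ≤ Q ^ 4 * R ^ 4 * (R ^ 2 * Q) ^ 2 := by gcongr
        _ = Q ^ 6 * R ^ 4 * R ^ 4 := by ring
    exact Nat.le_of_mul_le_mul_right a5 (by positivity)
  have main2 : 144 * 2 ^ (4 * w + 2 * E) ≤ Q :=
    (Nat.pow_le_pow_iff_left (by norm_num)).1 (Nat.le_of_mul_le_mul_right main (by positivity))
  have main3 : (12 : ℝ) * 2 ^ (2 * w + E) ≤ √(Q : ℝ) := by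
    apply Real.le_sqrt_of_sq_le
    have : ((144 * 2 ^ (4 * w + 2 * E) : ℕ) : ℝ) ≤ Q := by exact_mod_cast main2
    push_cast at this
    calc ((12 : ℝ) * 2 ^ (2 * w + E)) ^ 2 = 144 * 2 ^ (4 * w + 2 * E) := by
          rw [mul_pow, ← pow_mul]; norm_num; ring_nf
      _ ≤ Q := this
  refine criterion (K := K) (L := L) hn (by rw [hL, hK]) hf (Q - 1).primeFactors ∅
    (Q - 1).primeFactors ∅ (facs K n) ∅ (by simp) (by simp) (by simp) (by rw [hL]; simp)
    (by rw [hL]; simp) (by simp) (2 * w + E) 1 le_rfl 1 one_pos (by omega) (by simp) (by simp) ?_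
  rw [hL]
  have hs : (√(Q : ℝ)) * √(Q : ℝ) = Q := Real.mul_self_sqrt (by positivity)
  have h1 : (1 : ℝ) ≤ 2 ^ (2 * w + E) := one_le_pow₀ (by norm_num)
  have h12 : (12 : ℝ) ≤ √(Q : ℝ) := by linarith
  push_cast
  rw [pow_succ]
  have h3 : √(Q : ℝ) * (12 * 2 ^ (2 * w + E)) ≤ √(Q : ℝ) * √(Q : ℝ) := by gcongr
  have e : (6 * √(Q : ℝ) * (2 ^ (2 * w + E) * (1 - 1) + 1 * (2 ^ (2 * w + E) * 2 - 1)) : ℝ) =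
    √(Q : ℝ) * (12 * 2 ^ (2 * w + E)) - 6 * √(Q : ℝ) := by ring
  rw [e, hs] at *
  linarith

theorem large_ineq {q n₀ n : ℕ} (hq : 4 ≤ q) (hn : n₀ ≤ n) {A R : ℕ} (h : A * 4 ^ n₀ ≤ R * q ^ n₀) :
    A * 4 ^ n ≤ R * q ^ n := by
  obtain ⟨d, rfl⟩ := Nat.exists_eq_add_of_le hn
  rw [pow_add, pow_add, ← mul_assoc, ← mul_assoc]
  exact Nat.mul_le_mul h (Nat.pow_le_pow_left hq d)

theorem stmt15 (q n : ℕ) (hq : q ∈ ({7, 8, 9, 11, 13, 16, 17, 19} : Finset ℕ)) (hn : 3 ≤ n)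
    (h : (q, n) ∉ ({(7, 3), (7, 4), (7, 5), (7, 6), (7, 8), (7, 12), (8, 3), (8, 4), (8, 7),
      (9, 3), (9, 4), (9, 5), (9, 6), (9, 8), (11, 3), (11, 4), (11, 5), (11, 6),
      (13, 3), (13, 4), (13, 6), (16, 3), (16, 4), (16, 5), (17, 3), (17, 4),
      (19, 3), (19, 4), (19, 6)} : Finset (ℕ × ℕ))) :
    memB 3 2 q n := by
  have comb : ∀ (p k q n₀ : ℕ) (l : List ℕ), p.Prime → k ≠ 0 → q = p ^ k → 4 ≤ q → n ∉ l →
      (∀ n < n₀, 3 ≤ n → n ∉ l → chk p q n = true) →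
      144 ^ 3 * (64 ^ 18) ^ 2 * 2 ^ (q ^ 2 + 3 * q) * 4 ^ n₀ ≤
        117288381359406970983270 ^ 2 * q ^ n₀ → memB 3 2 q n := by
    intro p k q n₀ l hp hk hqp hq4 hl hchk hlarge
    rcases Nat.lt_or_ge n n₀ with hlt | hge
    · exact chk_sound hp hk hqp (by omega) (hchk n hlt hn hl)
    · exact large_n hp hk hqp (by omega) (large_ineq hq4 hge hlarge)
  simp only [Finset.mem_insert, Finset.mem_singleton] at hq
  rcases hq with rfl | rfl | rfl | rfl | rfl | rfl | rfl | rfl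
  · exact comb 7 1 7 200 _ (by norm_num) (by norm_num) (by norm_num) (by norm_num)
      (by simpa using h) chk7 (by decide +kernel)
  · exact comb 2 3 8 200 _ (by norm_num) (by norm_num) (by norm_num) (by norm_num)
      (by simpa using h) chk8 (by decide +kernel)
  · exact comb 3 2 9 200 _ (by norm_num) (by norm_num) (by norm_num) (by norm_num)
      (by simpa using h) chk9 (by decide +kernel)
  · exact comb 11 1 11 200 _ (by norm_num) (by norm_num) (by norm_num) (by norm_num)
      (by simpa using h) chk11 (by decide +kernel)
  · exact comb 13 1 13 200 _ (by norm_num) (by norm_num) (by norm_num) (by norm_num)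
      (by simpa using h) chk13 (by decide +kernel)
  · exact comb 2 4 16 200 _ (by norm_num) (by norm_num) (by norm_num) (by norm_num)
      (by simpa using h) chk16 (by decide +kernel)
  · exact comb 17 1 17 230 _ (by norm_num) (by norm_num) (by norm_num) (by norm_num)
      (by simpa using h) chk17 (by decide +kernel)
  · exact comb 19 1 19 230 _ (by norm_num) (by norm_num) (by norm_num) (by norm_num)
      (by simpa using h) chk19 (by decide +kernel)
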